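/- Let D ⊂ ℂⁿ be a bounded domain of class C^{1,1} with defining function ρ, and suppose D is strongly ℂ-linearly convex. Then for every p with 1 < p < ∞ there is a constant A_p < ∞ such that the truncated Cauchy–Leray integrals are uniformly bounded on L^p(bD, σ): for every ε > 0 and every f ∈ L^p(bD, σ), the function z ↦ ∫_{{w ∈ bD : |⟨∂ρ(w), w−z⟩| > ε}} f(w)·⟨∂ρ(w), w−z⟩^{−n} dσ(w), defined for z ∈ bD, satisfies ‖C_L^ε f‖_{L^p(bD,σ)} ≤ A_p ‖f‖_{L^p(bD,σ)}. -/

import Mathlib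

open MeasureTheory Complex

noncomputable section

/-- ℂⁿ with the Euclidean norm. -/
abbrev Cn (n : ℕ) := EuclideanSpace ℂ (Fin n)

instance (n : ℕ) : MeasurableSpace (Cn n) := borel _
instance (n : ℕ) : BorelSpace (Cn n) := ⟨rfl⟩

/-- Wirtinger derivative ∂f/∂ζⱼ of `f : ℂⁿ → ℂ` at `w`. -/
def wderiv {n : ℕ} (f : Cn n → ℂ) (w : Cn n) (j : Fin n) : ℂ :=
  (1/2) * (fderiv ℝ f w (EuclideanSpace.single j (1:ℂ))
            - Complex.I * fderiv ℝ f w (EuclideanSpace.single j Complex.I))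

/-- Conjugate Wirtinger derivative ∂f/∂ζ̄ⱼ of `f : ℂⁿ → ℂ` at `w`. -/
def wderivBar {n : ℕ} (f : Cn n → ℂ) (w : Cn n) (j : Fin n) : ℂ :=
  (1/2) * (fderiv ℝ f w (EuclideanSpace.single j (1:ℂ))
            + Complex.I * fderiv ℝ f w (EuclideanSpace.single j Complex.I))

/-- A real-valued function regarded as complex valued. -/
def realToC {n : ℕ} (ρ : Cn n → ℝ) : Cn n → ℂ := fun w => (ρ w : ℂ)

/-- ⟨∂ρ(w), ξ⟩ = Σⱼ (∂ρ/∂ζⱼ)(w) ξⱼ. -/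
def delPair {n : ℕ} (ρ : Cn n → ℝ) (w ξ : Cn n) : ℂ :=
  ∑ j, wderiv (realToC ρ) w j * ξ j

/-- Second Wirtinger derivative ∂²ρ/∂ζⱼ∂ζₖ. -/
def wderiv2 {n : ℕ} (ρ : Cn n → ℝ) (w : Cn n) (j k : Fin n) : ℂ :=
  wderiv (fun v => wderiv (realToC ρ) v j) w k

/-- The Levi form L_w(ρ)(ξ) = Σ_{j,k} (∂²ρ/∂ζⱼ∂ζ̄ₖ)(w) ξⱼ ξ̄ₖ (a real number). -/
def leviForm {n : ℕ} (ρ : Cn n → ℝ) (w ξ : Cn n) : ℝ :=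
  (∑ j, ∑ k, wderivBar (fun v => wderiv (realToC ρ) v j) w k * ξ j * (starRingEnd ℂ) (ξ k)).re

/-- Surface measure σ on bD: (2n−1)-dimensional Hausdorff measure restricted to the boundary. -/
def bSigma {n : ℕ} (D : Set (Cn n)) : Measure (Cn n) :=
  (μH[(2*(n:ℝ) - 1)]).restrict (frontier D)

/-- Lebesgue measure dV on ℂⁿ ≅ ℝ²ⁿ, realized as 2n-dimensional Hausdorff measure. -/
def dVol (n : ℕ) : Measure (Cn n) := μH[(2*(n:ℝ))]

section PartNoA
open MeasureTheory Complex

/-! ### Cotlar–Stein -/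

section CotlarStein

theorem cotlar_aux {E : Type*} [NormedRing E] [StarRing E] [CStarRing E]
    {ι : Type*} (s : Finset ι) (a : ι → E) (c : ι → ι → ℝ) (A B : ℝ)
    (hB : ∀ i ∈ s, ‖a i‖ ≤ B) (hB0 : 0 ≤ B) (hA0 : 0 ≤ A)
    (hc : ∀ i j, 0 ≤ c i j)
    (h1 : ∀ i ∈ s, ∀ j ∈ s, ‖star (a i) * a j‖ ≤ c i j ^ 2)
    (h2 : ∀ i ∈ s, ∀ j ∈ s, ‖a i * star (a j)‖ ≤ c i j ^ 2)
    (hsum : ∀ i ∈ s, ∑ j ∈ s, c i j ≤ A) (M : ℕ) :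
    (∀ i ∈ s, ∀ x : E, ∀ p e : ℝ, 0 ≤ p → 0 ≤ e → ‖x‖ ≤ p → (∀ y, ‖x * y‖ ≤ e * ‖a i * y‖) →
      ‖x * (star (∑ i ∈ s, a i) * ∑ i ∈ s, a i) ^ M‖ ≤ Real.sqrt (p * e) * Real.sqrt B * A ^ (2 * M)) ∧
    (∀ i ∈ s, ∀ x : E, ∀ p e : ℝ, 0 ≤ p → 0 ≤ e → ‖x‖ ≤ p → (∀ y, ‖x * y‖ ≤ e * ‖star (a i) * y‖) →
      ‖x * ((∑ i ∈ s, a i) * (star (∑ i ∈ s, a i) * ∑ i ∈ s, a i) ^ M)‖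
        ≤ Real.sqrt (p * e) * Real.sqrt B * A ^ (2 * M + 1)) := by
  set b := ∑ i ∈ s, a i with hb
  have step1 : ∀ L : ℕ, ∀ R : E,
      (∀ i ∈ s, ∀ x : E, ∀ p e : ℝ, 0 ≤ p → 0 ≤ e → ‖x‖ ≤ p → (∀ y, ‖x * y‖ ≤ e * ‖a i * y‖) →
      ‖x * R‖ ≤ Real.sqrt (p * e) * Real.sqrt B * A ^ L) →
      (∀ i ∈ s, ∀ x : E, ∀ p e : ℝ, 0 ≤ p → 0 ≤ e → ‖x‖ ≤ p → (∀ y, ‖x * y‖ ≤ e * ‖star (a i) * y‖) →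
      ‖x * (b * R)‖ ≤ Real.sqrt (p * e) * Real.sqrt B * A ^ (L + 1)) := by
    intro L R H i hi x p e hp he hx hxy
    have : x * (b * R) = ∑ j ∈ s, (x * a j) * R := by
      rw [hb, ← mul_assoc, Finset.mul_sum, Finset.sum_mul]
    rw [this]
    calc ‖∑ j ∈ s, (x * a j) * R‖ ≤ ∑ j ∈ s, ‖(x * a j) * R‖ := norm_sum_le _ _
      _ ≤ ∑ j ∈ s, Real.sqrt (p * e) * Real.sqrt B * A ^ L * c i j := by
          apply Finset.sum_le_sum
          intro j hj
          have := H j hj (x * a j) (e * c i j ^ 2) p (by positivity) hp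
            ((hxy _).trans (by gcongr; exact h1 i hi j hj))
            (fun y => by
              rw [mul_assoc]
              exact (norm_mul_le _ _).trans (by gcongr))
          refine this.trans (le_of_eq ?_)
          have : Real.sqrt (e * c i j ^ 2 * p) = Real.sqrt (p * e) * c i j := by
            rw [show e * c i j ^ 2 * p = (p * e) * (c i j) ^ 2 by ring,
              Real.sqrt_mul (by positivity), Real.sqrt_sq (hc i j)]
          rw [this]; ring
      _ = Real.sqrt (p * e) * Real.sqrt B * A ^ L * ∑ j ∈ s, c i j := by rw [Finset.mul_sum]
      _ ≤ Real.sqrt (p * e) * Real.sqrt B * A ^ L * A := by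
          gcongr; exact hsum i hi
      _ = _ := by ring
  have step2 : ∀ L : ℕ, ∀ R : E,
      (∀ i ∈ s, ∀ x : E, ∀ p e : ℝ, 0 ≤ p → 0 ≤ e → ‖x‖ ≤ p → (∀ y, ‖x * y‖ ≤ e * ‖star (a i) * y‖) →
      ‖x * R‖ ≤ Real.sqrt (p * e) * Real.sqrt B * A ^ L) →
      (∀ i ∈ s, ∀ x : E, ∀ p e : ℝ, 0 ≤ p → 0 ≤ e → ‖x‖ ≤ p → (∀ y, ‖x * y‖ ≤ e * ‖a i * y‖) →
      ‖x * (star b * R)‖ ≤ Real.sqrt (p * e) * Real.sqrt B * A ^ (L + 1)) := by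
    intro L R H i hi x p e hp he hx hxy
    have : x * (star b * R) = ∑ j ∈ s, (x * star (a j)) * R := by
      rw [hb, star_sum, ← mul_assoc, Finset.mul_sum, Finset.sum_mul]
    rw [this]
    calc ‖∑ j ∈ s, (x * star (a j)) * R‖ ≤ ∑ j ∈ s, ‖(x * star (a j)) * R‖ := norm_sum_le _ _
      _ ≤ ∑ j ∈ s, Real.sqrt (p * e) * Real.sqrt B * A ^ L * c i j := by
          apply Finset.sum_le_sum
          intro j hj
          have := H j hj (x * star (a j)) (e * c i j ^ 2) p (by positivity) hp
            ((hxy _).trans (by gcongr; exact h2 i hi j hj))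
            (fun y => by
              rw [mul_assoc]
              exact (norm_mul_le _ _).trans (by gcongr))
          refine this.trans (le_of_eq ?_)
          have : Real.sqrt (e * c i j ^ 2 * p) = Real.sqrt (p * e) * c i j := by
            rw [show e * c i j ^ 2 * p = (p * e) * (c i j) ^ 2 by ring,
              Real.sqrt_mul (by positivity), Real.sqrt_sq (hc i j)]
          rw [this]; ring
      _ = Real.sqrt (p * e) * Real.sqrt B * A ^ L * ∑ j ∈ s, c i j := by rw [Finset.mul_sum]
      _ ≤ Real.sqrt (p * e) * Real.sqrt B * A ^ L * A := by
          gcongr; exact hsum i hi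
      _ = _ := by ring
  induction M with
  | zero =>
    have h0 : (∀ i ∈ s, ∀ x : E, ∀ p e : ℝ, 0 ≤ p → 0 ≤ e → ‖x‖ ≤ p →
        (∀ y, ‖x * y‖ ≤ e * ‖a i * y‖) →
        ‖x * (star b * b) ^ 0‖ ≤ Real.sqrt (p * e) * Real.sqrt B * A ^ (2 * 0)) := by
      intro i hi x p e hp he hx hxy
      simp only [pow_zero, mul_one, mul_zero]
      have h3 : ‖x‖ ≤ e * B := by
        have := hxy 1
        simp only [mul_one] at this
        exact this.trans (by gcongr; exact hB i hi)
      rw [← Real.sqrt_mul (by positivity)]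
      apply Real.le_sqrt_of_sq_le
      calc ‖x‖ ^ 2 = ‖x‖ * ‖x‖ := by ring
        _ ≤ p * (e * B) := by gcongr
        _ = _ := by ring
    exact ⟨h0, step1 0 _ h0⟩
  | succ M ih =>
    have h3 := step2 _ _ ih.2
    have h4 : (∀ i ∈ s, ∀ x : E, ∀ p e : ℝ, 0 ≤ p → 0 ≤ e → ‖x‖ ≤ p →
        (∀ y, ‖x * y‖ ≤ e * ‖a i * y‖) →
        ‖x * (star b * b) ^ (M + 1)‖ ≤ Real.sqrt (p * e) * Real.sqrt B * A ^ (2 * (M + 1))) := by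
      intro i hi x p e hp he hx hxy
      have := h3 i hi x p e hp he hx hxy
      rw [pow_succ', mul_assoc (star b)]
      exact this
    exact ⟨h4, step1 _ _ h4⟩

theorem cotlar_stein {E : Type*} [NormedRing E] [StarRing E] [CStarRing E]
    {ι : Type*} (s : Finset ι) (a : ι → E) (c : ι → ι → ℝ) (A : ℝ) (hA0 : 0 < A)
    (hc : ∀ i j, 0 ≤ c i j)
    (h1 : ∀ i ∈ s, ∀ j ∈ s, ‖star (a i) * a j‖ ≤ c i j ^ 2)
    (h2 : ∀ i ∈ s, ∀ j ∈ s, ‖a i * star (a j)‖ ≤ c i j ^ 2)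
    (hsum : ∀ i ∈ s, ∑ j ∈ s, c i j ≤ A) :
    ‖∑ i ∈ s, a i‖ ≤ A := by
  set b := ∑ i ∈ s, a i with hb
  set B := ∑ i ∈ s, ‖a i‖ with hBdef
  have hB0 : 0 ≤ B := Finset.sum_nonneg (fun _ _ => norm_nonneg _)
  have hB : ∀ i ∈ s, ‖a i‖ ≤ B := fun i hi =>
    Finset.single_le_sum (f := fun i => ‖a i‖) (fun _ _ => norm_nonneg _) hi
  -- for every M
  have key : ∀ M : ℕ, ‖(star b * b) ^ (M + 1)‖ ≤ (s.card * B / A) * (A ^ 2) ^ (M + 1) := by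
    intro M
    have h := (cotlar_aux s a c A B hB hB0 hA0.le hc h1 h2 hsum M).2
    have e1 : (star b * b) ^ (M + 1) = ∑ i ∈ s, star (a i) * (b * (star b * b) ^ M) := by
      rw [pow_succ', ← Finset.sum_mul, ← star_sum, ← hb, mul_assoc]
    rw [e1]
    calc _ ≤ ∑ i ∈ s, ‖star (a i) * (b * (star b * b) ^ M)‖ := norm_sum_le _ _
      _ ≤ ∑ i ∈ s, B * A ^ (2 * M + 1) := by
          apply Finset.sum_le_sum
          intro i hi
          have := h i hi (star (a i)) B 1 hB0 zero_le_one (by rw [norm_star]; exact hB i hi)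
            (fun y => by simp)
          rwa [mul_one, Real.mul_self_sqrt hB0] at this
      _ = _ := by
          rw [Finset.sum_const, nsmul_eq_mul]
          field_simp
          ring
  by_contra hlt
  push Not at hlt
  have hb0 : 0 < ‖b‖ := hA0.trans hlt
  have hr : 1 < ‖b‖ ^ 2 / A ^ 2 := by
    rw [one_lt_div (by positivity)]
    gcongr
  have h4 : ∀ k : ℕ, (‖b‖ ^ 2 / A ^ 2) ^ (2 ^ k) ≤ s.card * B / A := by
    intro k
    have e2 : ‖(star b * b) ^ (2 ^ k)‖ = (‖b‖ ^ 2) ^ 2 ^ k := by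
      rw [IsSelfAdjoint.norm_pow_two_pow (IsSelfAdjoint.star_mul_self b), CStarRing.norm_star_mul_self, sq]
    have := key (2 ^ k - 1)
    rw [Nat.sub_add_cancel Nat.one_le_two_pow, e2] at this
    rw [div_pow, div_le_iff₀ (by positivity)]
    exact this
  obtain ⟨N, hN⟩ := pow_unbounded_of_one_lt (s.card * B / A) hr
  have h5 := h4 N
  have h6 : (‖b‖ ^ 2 / A ^ 2) ^ N ≤ (‖b‖ ^ 2 / A ^ 2) ^ 2 ^ N :=
    pow_le_pow_right₀ hr.le (Nat.lt_two_pow_self).le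
  linarith

end CotlarStein

end PartNoA

section PartNoB
open MeasureTheory Complex

/-! ### Schur test -/

section Schur
open scoped ENNReal

theorem schur_lintegral {α β : Type*} [MeasurableSpace α] [MeasurableSpace β]
    (μ : Measure α) (ν : Measure β) [SFinite μ] [SFinite ν]
    (K : α → β → ℝ≥0∞) (hK : Measurable (Function.uncurry K))
    (f : β → ℝ≥0∞) (hf : AEMeasurable f ν) (B : ℝ≥0∞) (p : ℝ) (hp : 1 < p)
    (h1 : ∀ x, ∫⁻ y, K x y ∂ν ≤ B) (h2 : ∀ y, ∫⁻ x, K x y ∂μ ≤ B) :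
    ∫⁻ x, (∫⁻ y, K x y * f y ∂ν) ^ p ∂μ ≤ B ^ p * ∫⁻ y, f y ^ p ∂ν := by
  wlog hfm : Measurable f generalizing f
  · have := this (hf.mk f) hf.measurable_mk.aemeasurable hf.measurable_mk
    have e1 : ∀ x, ∫⁻ y, K x y * f y ∂ν = ∫⁻ y, K x y * hf.mk f y ∂ν := fun x =>
      lintegral_congr_ae (by filter_upwards [hf.ae_eq_mk] with y hy; rw [hy])
    have e2 : ∫⁻ y, f y ^ p ∂ν = ∫⁻ y, hf.mk f y ^ p ∂ν :=
      lintegral_congr_ae (by filter_upwards [hf.ae_eq_mk] with y hy; rw [hy])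
    simp_rw [e1, e2]; exact this
  have hp0 : 0 < p := by linarith
  set q := p.conjExponent with hq
  have hpq : p.HolderConjugate q := Real.HolderConjugate.conjExponent hp
  have hqp : q.HolderConjugate p := hpq.symm
  have hKx : ∀ x, Measurable (K x) := fun x => hK.of_uncurry_left
  have step : ∀ x, (∫⁻ y, K x y * f y ∂ν) ^ p ≤ B ^ (p / q) * ∫⁻ y, K x y * f y ^ p ∂ν := by
    intro x
    have hh : ∫⁻ y, K x y * f y ∂ν ≤
        (∫⁻ y, (K x y ^ (1/q)) ^ q ∂ν) ^ (1/q) * (∫⁻ y, (K x y ^ (1/p) * f y) ^ p ∂ν) ^ (1/p) := by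
      have := ENNReal.lintegral_mul_le_Lp_mul_Lq ν hqp (f := fun y => K x y ^ (1/q))
        (g := fun y => K x y ^ (1/p) * f y) ((hKx x).pow_const _).aemeasurable
        (((hKx x).pow_const _).mul hfm).aemeasurable
      refine le_trans (le_of_eq ?_) this
      apply lintegral_congr
      intro y
      simp only [Pi.mul_apply]
      rw [← mul_assoc, ← ENNReal.rpow_add_of_nonneg _ _ (by simp [hpq.symm.nonneg]) (by positivity)]
      have : 1 / q + 1 / p = 1 := by simpa [one_div] using hqp.inv_add_inv_eq_one
      rw [this, ENNReal.rpow_one]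
    have e1 : ∀ y, (K x y ^ (1/q)) ^ q = K x y := fun y => by
      rw [← ENNReal.rpow_mul, one_div_mul_cancel hpq.symm.ne_zero, ENNReal.rpow_one]
    have e2 : ∀ y, (K x y ^ (1/p) * f y) ^ p = K x y * f y ^ p := fun y => by
      rw [ENNReal.mul_rpow_of_nonneg _ _ hp0.le, ← ENNReal.rpow_mul,
        one_div_mul_cancel hp0.ne', ENNReal.rpow_one]
    simp_rw [e1, e2] at hh
    calc (∫⁻ y, K x y * f y ∂ν) ^ p
        ≤ ((∫⁻ y, K x y ∂ν) ^ (1/q) * (∫⁻ y, K x y * f y ^ p ∂ν) ^ (1/p)) ^ p := by gcongr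
      _ = (∫⁻ y, K x y ∂ν) ^ (p/q) * (∫⁻ y, K x y * f y ^ p ∂ν) := by
          rw [ENNReal.mul_rpow_of_nonneg _ _ hp0.le, ← ENNReal.rpow_mul, ← ENNReal.rpow_mul,
            one_div_mul_cancel hp0.ne', ENNReal.rpow_one]
          congr 2; ring
      _ ≤ _ := by
          have : 0 ≤ p / q := div_nonneg hp0.le hpq.symm.nonneg
          gcongr
          exact h1 x
  have hm : Measurable (Function.uncurry fun x y => K x y * f y ^ p) := by
    have : Measurable fun z : α × β => f z.2 ^ p := (hfm.comp measurable_snd).pow_const _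
    exact hK.mul this
  calc _ ≤ ∫⁻ x, B ^ (p / q) * ∫⁻ y, K x y * f y ^ p ∂ν ∂μ := lintegral_mono step
    _ = B ^ (p / q) * ∫⁻ x, ∫⁻ y, K x y * f y ^ p ∂ν ∂μ := by
        rw [lintegral_const_mul]
        exact hm.lintegral_prod_right'
    _ = B ^ (p / q) * ∫⁻ y, ∫⁻ x, K x y * f y ^ p ∂μ ∂ν := by
        rw [lintegral_lintegral_swap hm.aemeasurable]
    _ ≤ B ^ (p / q) * ∫⁻ y, B * f y ^ p ∂ν := by
        gcongr with y
        rw [lintegral_mul_const _ (hK.of_uncurry_right)]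
        gcongr
        exact h2 y
    _ = B ^ (p/q) * (B * ∫⁻ y, f y ^ p ∂ν) := by
        rw [lintegral_const_mul _ (hfm.pow_const _)]
    _ = _ := by
        rw [← mul_assoc]
        congr 1
        have : p = p / q + 1 := by
          have := hpq.inv_add_inv_eq_one
          have hq0 := hpq.symm.ne_zero
          field_simp at this ⊢
          linarith
        conv_lhs => rw [← ENNReal.rpow_one B, ← ENNReal.rpow_mul]
        rw [one_mul, ← ENNReal.rpow_add_of_nonneg _ _ (div_nonneg hp0.le hpq.symm.nonneg) zero_le_one, ← this]

end Schur

end PartNoB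

section PartNoC
open MeasureTheory Complex

section KerOp
open scoped ENNReal
variable {α : Type*} [MeasurableSpace α]

theorem eLpNorm_ofReal_eq {μ : Measure α} (f : α → ℂ) {p : ℝ} (hp : 1 < p) :
    eLpNorm f (ENNReal.ofReal p) μ = (∫⁻ x, ‖f x‖ₑ ^ p ∂μ) ^ (1 / p) := by
  rw [eLpNorm_eq_lintegral_rpow_enorm_toReal (by simp; linarith) (by simp),
    ENNReal.toReal_ofReal (by linarith)]

/-- L^p bound deduced from the integral bound. -/
theorem eLpNorm_le_of_lintegral {μ : Measure α} {ν : Measure α} (f g : α → ℂ) {p : ℝ} (hp : 1 < p)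
    (B : ℝ≥0∞) (h : ∫⁻ x, ‖f x‖ₑ ^ p ∂μ ≤ B ^ p * ∫⁻ x, ‖g x‖ₑ ^ p ∂ν) :
    eLpNorm f (ENNReal.ofReal p) μ ≤ B * eLpNorm g (ENNReal.ofReal p) ν := by
  have hp0 : 0 < p := by linarith
  rw [eLpNorm_ofReal_eq f hp, eLpNorm_ofReal_eq g hp]
  calc _ ≤ (B ^ p * ∫⁻ x, ‖g x‖ₑ ^ p ∂ν) ^ (1/p) := by gcongr
    _ = _ := by
      rw [ENNReal.mul_rpow_of_nonneg _ _ (by positivity), ← ENNReal.rpow_mul,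
        mul_one_div_cancel hp0.ne', ENNReal.rpow_one]

theorem schur_eLpNorm (μ : Measure α) [SFinite μ]
    (K : α → α → ℂ) (hK : Measurable (Function.uncurry K))
    (f : α → ℂ) (hf : AEStronglyMeasurable f μ) (B : ℝ≥0∞) (p : ℝ) (hp : 1 < p)
    (h1 : ∀ x, ∫⁻ y, ‖K x y‖ₑ ∂μ ≤ B) (h2 : ∀ y, ∫⁻ x, ‖K x y‖ₑ ∂μ ≤ B) :
    eLpNorm (fun x => ∫ y, K x y * f y ∂μ) (ENNReal.ofReal p) μ
      ≤ B * eLpNorm f (ENNReal.ofReal p) μ := by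
  apply eLpNorm_le_of_lintegral _ _ hp
  refine le_trans ?_ (schur_lintegral μ μ (fun x y => ‖K x y‖ₑ) hK.enorm
    (fun y => ‖f y‖ₑ) hf.enorm B p hp h1 h2)
  gcongr with x
  refine (enorm_integral_le_lintegral_enorm _).trans ?_
  simp [enorm_mul]

/-- bounded jointly measurable kernel -/
structure BK (K : α → α → ℂ) (C : ℝ) : Prop where
  meas : Measurable (Function.uncurry K)
  bdd : ∀ x y, ‖K x y‖ ≤ C

theorem BK.nonneg_of {K : α → α → ℂ} {C : ℝ} (h : BK K C) (x : α) : 0 ≤ C :=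
  (norm_nonneg _).trans (h.bdd x x)

variable {μ : Measure α} [IsFiniteMeasure μ]

theorem BK.integrable_mul {K : α → α → ℂ} {C : ℝ} (h : BK K C) {f : α → ℂ} (hf : Integrable f μ)
    (x : α) : Integrable (fun y => K x y * f y) μ :=
  hf.bdd_mul (c := C) (h.meas.of_uncurry_left.aestronglyMeasurable) (Filter.Eventually.of_forall (h.bdd x))

theorem BK.aesm {K : α → α → ℂ} {C : ℝ} (h : BK K C) {f : α → ℂ} (hf : AEStronglyMeasurable f μ) :
    AEStronglyMeasurable (fun x => ∫ y, K x y * f y ∂μ) μ := by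
  have h1 : AEStronglyMeasurable (fun z : α × α => K z.1 z.2 * f z.2) (μ.prod μ) := by
    apply AEStronglyMeasurable.mul
    · exact h.meas.aestronglyMeasurable
    · exact hf.comp_snd
  exact h1.integral_prod_right'

theorem BK.lint {K : α → α → ℂ} {C : ℝ} (h : BK K C) (x : α) :
    ∫⁻ y, ‖K x y‖ₑ ∂μ ≤ ENNReal.ofReal (C * μ.real Set.univ) := by
  calc _ ≤ ∫⁻ y, ENNReal.ofReal C ∂μ := by
        gcongr with y
        rw [← ofReal_norm]
        exact ENNReal.ofReal_le_ofReal (h.bdd x y)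
    _ = _ := by
        rw [lintegral_const, ENNReal.ofReal_mul (h.nonneg_of x)]
        simp [measureReal_def]

theorem BK.transpose {K : α → α → ℂ} {C : ℝ} (h : BK K C) : BK (fun x y => K y x) C :=
  ⟨h.meas.comp measurable_swap, fun x y => h.bdd y x⟩

theorem BK.star {K : α → α → ℂ} {C : ℝ} (h : BK K C) : BK (fun x y => (starRingEnd ℂ) (K y x)) C :=
  ⟨(Complex.continuous_conj.measurable.comp (h.meas.comp measurable_swap)),
    fun x y => by simpa using h.bdd y x⟩

theorem ofReal_two : ENNReal.ofReal 2 = 2 := by simp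

theorem BK.eLp {K : α → α → ℂ} {C : ℝ} (h : BK K C) {f : α → ℂ} (hf : AEStronglyMeasurable f μ)
    {p : ℝ} (hp : 1 < p) :
    eLpNorm (fun x => ∫ y, K x y * f y ∂μ) (ENNReal.ofReal p) μ
      ≤ ENNReal.ofReal (C * μ.real Set.univ) * eLpNorm f (ENNReal.ofReal p) μ :=
  schur_eLpNorm μ K h.meas f hf _ p hp h.lint h.transpose.lint

theorem BK.memLp {K : α → α → ℂ} {C : ℝ} (h : BK K C) {f : α → ℂ} (hf : MemLp f 2 μ) :
    MemLp (fun x => ∫ y, K x y * f y ∂μ) 2 μ := by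
  refine ⟨h.aesm hf.1, ?_⟩
  have := h.eLp hf.1 (p := 2) (by norm_num)
  rw [ofReal_two] at this
  exact this.trans_lt (ENNReal.mul_lt_top (by simp) hf.2)

theorem intLp (f : Lp ℂ 2 μ) : Integrable f μ := (Lp.memLp f).integrable (by norm_num)

noncomputable def kopL {K : α → α → ℂ} {C : ℝ} (μ : Measure α) [IsFiniteMeasure μ] (h : BK K C) :
    Lp ℂ 2 μ →ₗ[ℂ] Lp ℂ 2 μ where
  toFun f := (h.memLp (Lp.memLp f)).toLp
  map_add' f g := by
    rw [← MemLp.toLp_add, MemLp.toLp_eq_toLp_iff]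
    apply Filter.Eventually.of_forall
    intro x
    simp only [Pi.add_apply]
    rw [← integral_add (h.integrable_mul (intLp f) x) (h.integrable_mul (intLp g) x)]
    apply integral_congr_ae
    filter_upwards [Lp.coeFn_add f g] with y hy
    rw [hy, Pi.add_apply, mul_add]
  map_smul' c f := by
    rw [RingHom.id_apply, ← MemLp.toLp_const_smul, MemLp.toLp_eq_toLp_iff]
    apply Filter.Eventually.of_forall
    intro x
    simp only [Pi.smul_apply, smul_eq_mul]
    rw [← integral_const_mul]
    apply integral_congr_ae
    filter_upwards [Lp.coeFn_smul c f] with y hy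
    rw [hy, Pi.smul_apply, smul_eq_mul]; ring

theorem kopL_norm_le {K : α → α → ℂ} {C : ℝ} (h : BK K C) (B : ℝ) (hB : 0 ≤ B)
    (h1 : ∀ x, ∫⁻ y, ‖K x y‖ₑ ∂μ ≤ ENNReal.ofReal B)
    (h2 : ∀ y, ∫⁻ x, ‖K x y‖ₑ ∂μ ≤ ENNReal.ofReal B) (f : Lp ℂ 2 μ) :
    ‖kopL μ h f‖ ≤ B * ‖f‖ := by
  have := schur_eLpNorm μ K h.meas f (Lp.aestronglyMeasurable f) _ 2 (by norm_num) h1 h2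
  rw [ofReal_two] at this
  change ‖(h.memLp (Lp.memLp f)).toLp‖ ≤ _
  rw [Lp.norm_toLp, Lp.norm_def]
  refine (ENNReal.toReal_mono ?_ this).trans ?_
  · exact (ENNReal.mul_lt_top (by simp) (Lp.eLpNorm_lt_top f)).ne
  · rw [ENNReal.toReal_mul, ENNReal.toReal_ofReal hB]

noncomputable def kop {K : α → α → ℂ} {C : ℝ} (μ : Measure α) [IsFiniteMeasure μ] (h : BK K C) :
    Lp ℂ 2 μ →L[ℂ] Lp ℂ 2 μ :=
  (kopL μ h).mkContinuous (max C 0 * μ.real Set.univ) (fun f => by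
    apply kopL_norm_le h _ (by positivity)
    · intro x
      exact (h.lint x).trans (ENNReal.ofReal_le_ofReal (by gcongr; exact le_max_left _ _))
    · intro x
      exact (h.transpose.lint x).trans (ENNReal.ofReal_le_ofReal (by gcongr; exact le_max_left _ _)))

theorem kop_coe {K : α → α → ℂ} {C : ℝ} (h : BK K C) (f : Lp ℂ 2 μ) :
    kop μ h f =ᵐ[μ] fun x => ∫ y, K x y * f y ∂μ :=
  MemLp.coeFn_toLp (h.memLp (Lp.memLp f))

theorem kop_norm_le {K : α → α → ℂ} {C : ℝ} (h : BK K C) (B : ℝ) (hB : 0 ≤ B)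
    (h1 : ∀ x, ∫⁻ y, ‖K x y‖ₑ ∂μ ≤ ENNReal.ofReal B)
    (h2 : ∀ y, ∫⁻ x, ‖K x y‖ₑ ∂μ ≤ ENNReal.ofReal B) : ‖kop μ h‖ ≤ B :=
  ContinuousLinearMap.opNorm_le_bound _ hB (fun f => kopL_norm_le h B hB h1 h2 f)

theorem kop_star {K : α → α → ℂ} {C : ℝ} (h : BK K C) :
    star (kop μ h) = kop μ h.star := by
  rw [ContinuousLinearMap.star_eq_adjoint, eq_comm, ContinuousLinearMap.eq_adjoint_iff]
  intro f g
  simp only [L2.inner_def, RCLike.inner_apply]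
  have hintg : Integrable (Function.uncurry fun x y => K x y * g y * (starRingEnd ℂ) (f x)) (μ.prod μ) := by
    have h0 : Integrable (fun z : α × α => (starRingEnd ℂ) (f z.1) * g z.2) (μ.prod μ) :=
      Integrable.mul_prod (f := fun x => (starRingEnd ℂ) (f x)) (g := fun y => g y)
        ((LinearIsometryEquiv.integrable_comp_iff Complex.conjLIE).2 (intLp f)) (intLp g)
    have := h0.bdd_mul (c := C) (f := Function.uncurry K) h.meas.aestronglyMeasurable
      (Filter.Eventually.of_forall fun z => h.bdd _ _)
    refine this.congr (Filter.Eventually.of_forall fun z => ?_)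
    simp only [Function.uncurry]; ring
  calc ∫ y, g y * (starRingEnd ℂ) (kop μ h.star f y) ∂μ
      = ∫ y, ∫ x, K x y * g y * (starRingEnd ℂ) (f x) ∂μ ∂μ := by
        apply integral_congr_ae
        filter_upwards [kop_coe h.star f] with y hy
        rw [hy, ← integral_conj, ← integral_const_mul]
        congr 1; ext x
        simp; ring
    _ = ∫ x, ∫ y, K x y * g y * (starRingEnd ℂ) (f x) ∂μ ∂μ := (integral_integral_swap hintg).symm
    _ = _ := by
        apply integral_congr_ae
        filter_upwards [kop_coe h g] with x hx
        rw [hx, ← integral_mul_const]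

theorem kop_mul {K L : α → α → ℂ} {C C' C'' : ℝ} (h : BK K C) (h' : BK L C')
    (h'' : BK (fun x y => ∫ w, K x w * L w y ∂μ) C'') :
    kop μ h * kop μ h' = kop μ h'' := by
  ext1 f
  change kop μ h (kop μ h' f) = _
  apply Lp.ext
  refine (kop_coe h _).trans ?_
  refine Filter.EventuallyEq.trans ?_ (kop_coe h'' _).symm
  apply Filter.Eventually.of_forall
  intro x
  have hintg : Integrable (Function.uncurry fun w y => K x w * (L w y * f y)) (μ.prod μ) := by
    have h0 : Integrable (fun z : α × α => f z.2) (μ.prod μ) := (intLp f).comp_snd μ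
    have h1 := h0.bdd_mul (c := C') (f := Function.uncurry L) h'.meas.aestronglyMeasurable
      (Filter.Eventually.of_forall fun z => h'.bdd _ _)
    have := h1.bdd_mul (c := C) (f := fun z => K x z.1)
      (h.meas.of_uncurry_left.comp measurable_fst).aestronglyMeasurable
      (Filter.Eventually.of_forall fun z => h.bdd _ _)
    exact this
  calc ∫ w, K x w * kop μ h' f w ∂μ = ∫ w, ∫ y, K x w * (L w y * f y) ∂μ ∂μ := by
        apply integral_congr_ae
        filter_upwards [kop_coe h' f] with w hw
        rw [hw, ← integral_const_mul]
    _ = ∫ y, ∫ w, K x w * (L w y * f y) ∂μ ∂μ := integral_integral_swap hintg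
    _ = _ := by
        congr 1; ext y
        rw [← integral_mul_const]
        congr 1; ext w; ring

end KerOp

end PartNoC

section PartNoD
open MeasureTheory Complex

section L2Theory
open scoped ENNReal
variable {α : Type*} [MeasurableSpace α]

/-- quasi-metric with Ahlfors regular measure -/
structure HS (μ : Measure α) (d : α → α → ℝ) (A : ℝ) (m : ℕ) : Prop where
  one_le : 1 ≤ A
  meas : Measurable (Function.uncurry d)
  nonneg : ∀ x y, 0 ≤ d x y
  diag : ∀ x, d x x = 0
  symm : ∀ x y, d x y = d y x
  tri : ∀ x y z, d x z ≤ A * (d x y + d y z)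
  ub : ∀ x r, 0 < r → μ {y | d x y ≤ r} ≤ ENNReal.ofReal (A * r ^ m)
  lb : ∀ x r, 0 < r → r ≤ 1 → ENNReal.ofReal (A⁻¹ * r ^ m) ≤ μ {y | d x y ≤ r}

/-- multi-scale kernel family -/
structure KF (μ : Measure α) (d : α → α → ℝ) (A : ℝ) (m : ℕ) (k : ℕ → α → α → ℂ) : Prop where
  meas : ∀ i, Measurable (Function.uncurry (k i))
  bdd : ∀ i x y, ‖k i x y‖ ≤ A * (2 ^ i) ^ m
  supp : ∀ i x y, A < 2 ^ i * d x y → k i x y = 0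
  sm1 : ∀ i x x' y, ‖k i x y - k i x' y‖ ≤ A * (2 ^ i) ^ m * (2 ^ i * d x x')
  sm2 : ∀ i x y y', ‖k i x y - k i x y'‖ ≤ A * (2 ^ i) ^ m * (2 ^ i * d y y')
  can1 : ∀ i y, 2 ^ i * ‖∫ x, k i x y ∂μ‖ ≤ A
  can2 : ∀ i x, 2 ^ i * ‖∫ y, k i x y ∂μ‖ ≤ A

variable {μ : Measure α} {d : α → α → ℝ} {A : ℝ} {m : ℕ} {k : ℕ → α → α → ℂ}

theorem KF.transpose (hs : HS μ d A m) (h : KF μ d A m k) : KF μ d A m (fun i x y => k i y x) where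
  meas i := (h.meas i).comp measurable_swap
  bdd i x y := h.bdd i y x
  supp i x y hh := h.supp i y x (by rwa [hs.symm y x])
  sm1 i x x' y := h.sm2 i y x x'
  sm2 i x y y' := h.sm1 i y y' x
  can1 i y := h.can2 i y
  can2 i y := h.can1 i y

theorem KF.conjT (hs : HS μ d A m) (h : KF μ d A m k) :
    KF μ d A m (fun i x y => (starRingEnd ℂ) (k i y x)) where
  meas i := Complex.continuous_conj.measurable.comp ((h.meas i).comp measurable_swap)
  bdd i x y := by simpa using h.bdd i y x
  supp i x y hh := by simpa using h.supp i y x (by rwa [hs.symm y x])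
  sm1 i x x' y := by rw [← map_sub, RCLike.norm_conj]; exact h.sm2 i y x x'
  sm2 i x y y' := by rw [← map_sub, RCLike.norm_conj]; exact h.sm1 i y y' x
  can1 i y := by rw [integral_conj, RCLike.norm_conj]; exact h.can2 i y
  can2 i y := by rw [integral_conj, RCLike.norm_conj]; exact h.can1 i y

theorem HS.measBall (hs : HS μ d A m) (x : α) (r : ℝ) : MeasurableSet {y | d x y ≤ r} :=
  measurableSet_le hs.meas.of_uncurry_left measurable_const

theorem HS.lint_supp (hs : HS μ d A m) (g : α → ℂ) (x : α) (C r : ℝ) (hr : 0 < r)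
    (hC : ∀ y, ‖g y‖ ≤ C) (h0 : ∀ y, r < d x y → g y = 0) :
    ∫⁻ y, ‖g y‖ₑ ∂μ ≤ ENNReal.ofReal (C * (A * r ^ m)) := by
  have hC0 : 0 ≤ C := (norm_nonneg _).trans (hC x)
  calc _ ≤ ∫⁻ y, ({y | d x y ≤ r}.indicator (fun _ => ENNReal.ofReal C)) y ∂μ := by
        gcongr with y
        by_cases hy : d x y ≤ r
        · rw [Set.indicator_of_mem (by exact hy), ← ofReal_norm]
          exact ENNReal.ofReal_le_ofReal (hC y)
        · rw [h0 y (by linarith)]; simp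
    _ = ENNReal.ofReal C * μ {y | d x y ≤ r} := by
        rw [lintegral_indicator (hs.measBall x r), setLIntegral_const]
    _ ≤ ENNReal.ofReal C * ENNReal.ofReal (A * r ^ m) := by gcongr; exact hs.ub x r hr
    _ = _ := (ENNReal.ofReal_mul hC0).symm


theorem KF.bk (h : KF μ d A m k) (i : ℕ) : BK (k i) (A * (2 ^ i) ^ m) := ⟨h.meas i, h.bdd i⟩

theorem HS.pos (hs : HS μ d A m) : 0 < A := by linarith [hs.one_le]

variable [IsFiniteMeasure μ]

theorem KF.lint (hs : HS μ d A m) (h : KF μ d A m k) (i : ℕ) (x : α) :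
    ∫⁻ y, ‖k i x y‖ₑ ∂μ ≤ ENNReal.ofReal (A ^ (m + 2)) := by
  have hA := hs.pos
  refine (hs.lint_supp _ x _ (A / 2 ^ i) (by positivity) (h.bdd i x) ?_).trans (le_of_eq ?_)
  · intro y hy
    apply h.supp
    rw [div_lt_iff₀ (by positivity)] at hy
    linarith
  · congr 1
    rw [div_pow]
    field_simp
    ring

theorem KF.comp_bound (hs : HS μ d A m) (h : KF μ d A m k) (i l : ℕ) (hil : l ≤ i)
    (x y : α) (k' : α → α → ℂ) (hk' : k' = fun x w => (starRingEnd ℂ) (k i w x)) :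
    ‖∫ w, k' x w * k l w y ∂μ‖
      ≤ (2 ^ l) ^ m * (2 ^ l / 2 ^ i) * (A ^ (m + 4) + A ^ 2) := by
  have hA := hs.pos
  have hst := h.conjT hs
  have hb : BK k' (A * (2 ^ i) ^ m) := by rw [hk']; exact (h.bk i).star
  have hbl := (h.bk l)
  have i0 : Integrable (fun w => k' x w) μ := by
    have := hb.integrable_mul (integrable_const (1:ℂ)) (μ := μ) x
    simpa using this
  have i1 : Integrable (fun w => k' x w * k l x y) μ := i0.mul_const _
  have i2 : Integrable (fun w => k' x w * (k l w y - k l x y)) μ := by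
    have := i0.mul_bdd (c := A * (2 ^ l) ^ m + ‖k l x y‖) (g := fun w => k l w y - k l x y)
      ((hbl.meas.of_uncurry_right.sub_const _).aestronglyMeasurable)
      (Filter.Eventually.of_forall fun w => (norm_sub_le _ _).trans (by gcongr; exact h.bdd l w y))
    exact this
  have e : ∫ w, k' x w * k l w y ∂μ = ∫ w, k' x w * (k l w y - k l x y) ∂μ
      + (∫ w, k' x w ∂μ) * k l x y := by
    rw [← integral_mul_const, ← integral_add i2 i1]
    congr 1; ext w; ring
  have b1 : ‖∫ w, k' x w * (k l w y - k l x y) ∂μ‖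
      ≤ (A * (2 ^ l) ^ m * (2 ^ l * (A / 2 ^ i))) * A ^ (m + 2) := by
    have pt : ∀ w, ‖k' x w * (k l w y - k l x y)‖
        ≤ (A * (2 ^ l) ^ m * (2 ^ l * (A / 2 ^ i))) * ‖k' x w‖ := by
      intro w
      by_cases hw : A < 2 ^ i * d x w
      · have : k' x w = 0 := by rw [hk']; exact hst.supp i x w hw
        simp [this]
      · rw [norm_mul, mul_comm]
        have hd : d w x ≤ A / 2 ^ i := by
          rw [le_div_iff₀ (by positivity), hs.symm]; linarith
        gcongr
        refine (h.sm1 l w x y).trans ?_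
        gcongr
    have hintg : ∫ w, ‖k' x w‖ ∂μ ≤ A ^ (m + 2) := by
      rw [integral_norm_eq_lintegral_enorm i0.1]
      apply ENNReal.toReal_le_of_le_ofReal (by positivity)
      have := hst.lint hs i x
      rw [hk']; exact this
    calc _ ≤ ∫ w, (A * (2 ^ l) ^ m * (2 ^ l * (A / 2 ^ i))) * ‖k' x w‖ ∂μ :=
          norm_integral_le_of_norm_le (i0.norm.const_mul _) (Filter.Eventually.of_forall pt)
      _ ≤ _ := by
          rw [integral_const_mul]; gcongr
  have b2 : ‖(∫ w, k' x w ∂μ) * k l x y‖ ≤ (A / 2 ^ i) * (A * (2 ^ l) ^ m) := by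
    rw [norm_mul]
    gcongr
    · rw [le_div_iff₀ (by positivity), mul_comm, hk']
      exact hst.can2 i x
    · exact h.bdd l x y
  rw [e]
  refine (norm_add_le _ _).trans ((add_le_add b1 b2).trans ?_)
  have h2 : (1:ℝ) ≤ 2 ^ l := one_le_pow₀ (by norm_num)
  have : (A / 2 ^ i) * (A * (2 ^ l) ^ m) ≤ (A / 2 ^ i) * (A * (2 ^ l) ^ m) * 2 ^ l :=
    le_mul_of_one_le_right (by positivity) h2
  refine (add_le_add_right this _).trans (le_of_eq ?_)
  ring

/-- constant in Cotlar-Stein -/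
noncomputable def csB (A : ℝ) (m : ℕ) : ℝ := (A ^ (m + 4) + A ^ 2) * (A * (2 * A ^ 2) ^ m)

theorem KF.comp_norm (hs : HS μ d A m) (h : KF μ d A m k) (i l : ℕ) (hil : l ≤ i) :
    ‖star (kop μ (h.bk i)) * kop μ (h.bk l)‖ ≤ csB A m * (2 ^ l / 2 ^ i) := by
  have hA := hs.pos
  have hst := h.conjT hs
  set q : α → α → ℂ := fun x y => ∫ w, (starRingEnd ℂ) (k i w x) * k l w y ∂μ with hq
  have hqb : ∀ x y, ‖q x y‖ ≤ (2 ^ l) ^ m * (2 ^ l / 2 ^ i) * (A ^ (m + 4) + A ^ 2) :=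
    fun x y => h.comp_bound hs i l hil x y _ rfl
  have hqm : Measurable (Function.uncurry q) := by
    have : StronglyMeasurable (fun p : (α × α) × α => (starRingEnd ℂ) (k i p.2 p.1.1) * k l p.2 p.1.2) := by
      apply Measurable.stronglyMeasurable
      apply Measurable.mul
      · exact (hst.meas i).comp ((measurable_fst.comp measurable_fst).prodMk measurable_snd)
      · exact (h.meas l).comp (measurable_snd.prodMk (measurable_snd.comp measurable_fst))
    exact (this.integral_prod_right' (ν := μ)).measurable
  have hqs : ∀ x y, 2 * A ^ 2 / 2 ^ l < d x y → q x y = 0 := by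
    intro x y hxy
    apply integral_eq_zero_of_ae
    apply Filter.Eventually.of_forall
    intro w
    simp only [Pi.zero_apply, mul_eq_zero]
    by_contra! hcon
    have h1 : 2 ^ i * d x w ≤ A := by
      by_contra! hh
      exact hcon.1 (hst.supp i x w hh)
    have h2 : 2 ^ l * d w y ≤ A := by
      by_contra! hh
      exact hcon.2 (h.supp l w y hh)
    have h3 : 2 ^ l * d x w ≤ A := by
      refine le_trans ?_ h1
      have := hs.nonneg x w
      gcongr
      norm_num
    have h4 := hs.tri x w y
    rw [div_lt_iff₀ (by positivity)] at hxy
    have : d x y * 2 ^ l ≤ A * (d x w + d w y) * 2 ^ l := by gcongr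
    nlinarith
  have hqB : BK q _ := ⟨hqm, hqb⟩
  have e : star (kop μ (h.bk i)) * kop μ (h.bk l) = kop μ hqB := by
    rw [kop_star]
    exact kop_mul _ _ _
  rw [e]
  have hcst : csB A m * (2 ^ l / 2 ^ i) =
      (2 ^ l) ^ m * (2 ^ l / 2 ^ i) * (A ^ (m + 4) + A ^ 2) * (A * (2 * A ^ 2 / 2 ^ l) ^ m) := by
    unfold csB
    rw [div_pow]
    field_simp
  rw [hcst]
  apply kop_norm_le
  · positivity
  · intro x
    exact hs.lint_supp (q x) x _ _ (by positivity) (hqb x) (hqs x)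
  · intro y
    exact hs.lint_supp (fun x => q x y) y _ _ (by positivity) (fun x => hqb x y)
      (fun x hx => hqs x y (by rwa [hs.symm]))

theorem sum_theta (θ : ℝ) (h0 : 0 ≤ θ) (h1 : θ < 1) (i N : ℕ) :
    ∑ j ∈ Finset.range N, θ ^ ((i - j) + (j - i)) ≤ 2 / (1 - θ) := by
  have hg : ∀ M, ∑ t ∈ Finset.range M, θ ^ t ≤ 1 / (1 - θ) := by
    intro M
    rw [one_div]
    exact (Summable.sum_le_tsum _ (fun _ _ => by positivity)
      (summable_geometric_of_lt_one h0 h1)).trans (tsum_geometric_of_lt_one h0 h1).le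
  have hsub : Finset.range N ⊆ Finset.range (i + 1) ∪ Finset.Ico i N := by
    intro j hj
    simp at hj ⊢
    omega
  calc _ ≤ ∑ j ∈ Finset.range (i + 1) ∪ Finset.Ico i N, θ ^ ((i - j) + (j - i)) :=
        Finset.sum_le_sum_of_subset_of_nonneg hsub (fun _ _ _ => by positivity)
    _ ≤ ∑ j ∈ Finset.range (i + 1), θ ^ ((i - j) + (j - i))
        + ∑ j ∈ Finset.Ico i N, θ ^ ((i - j) + (j - i)) := by
        rw [← Finset.sum_union_inter]
        exact le_add_of_nonneg_right (Finset.sum_nonneg fun _ _ => by positivity)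
    _ ≤ 1 / (1 - θ) + 1 / (1 - θ) := by
        gcongr
        · refine le_trans (le_of_eq ?_) (hg (i + 1))
          rw [← Finset.sum_range_reflect]
          apply Finset.sum_congr rfl
          intro j hj
          simp at hj
          congr 1; omega
        · rw [Finset.sum_Ico_eq_sum_range]
          refine le_trans (le_of_eq ?_) (hg (N - i))
          apply Finset.sum_congr rfl
          intro j hj
          congr 1; omega
    _ = _ := by ring

theorem KF.comp_norm' (hs : HS μ d A m) (h : KF μ d A m k) (i l : ℕ) :
    ‖star (kop μ (h.bk i)) * kop μ (h.bk l)‖ ≤ csB A m * (1 / 2) ^ ((i - l) + (l - i)) := by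
  rcases le_total l i with hil | hil
  · refine (h.comp_norm hs i l hil).trans (le_of_eq ?_)
    congr 1
    rw [Nat.sub_eq_zero_of_le hil, add_zero, one_div, inv_pow, pow_sub₀ _ (by norm_num) hil]
    field_simp
  · rw [← norm_star, star_mul, star_star]
    refine (h.comp_norm hs l i hil).trans (le_of_eq ?_)
    congr 1
    rw [Nat.sub_eq_zero_of_le hil, zero_add, one_div, inv_pow, pow_sub₀ _ (by norm_num) hil]
    field_simp

/-- L² bound constant -/
noncomputable def l2C (A : ℝ) (m : ℕ) : ℝ := Real.sqrt (csB A m) * (2 / (1 - Real.sqrt (1/2)))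

theorem sqrt_half_lt : Real.sqrt (1/2) < 1 := by
  rw [Real.sqrt_lt' one_pos]; norm_num

theorem csB_pos (hA : 0 < A) : 0 < csB A m := by unfold csB; positivity

theorem l2C_pos (hA : 0 < A) : 0 < l2C A m := by
  unfold l2C
  have := sqrt_half_lt
  have h2 : 0 < 1 - Real.sqrt (1/2) := by linarith
  have := csB_pos (m := m) hA
  positivity

theorem KF.op_bound (hs : HS μ d A m) (h : KF μ d A m k) (N : ℕ) :
    ‖∑ i ∈ Finset.range N, kop μ (h.bk i)‖ ≤ l2C A m := by
  have hA := hs.pos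
  have hB := csB_pos (m := m) hA
  have hsq : ∀ i j : ℕ, (Real.sqrt (csB A m) * Real.sqrt (1/2) ^ ((i - j) + (j - i))) ^ 2
      = csB A m * (1 / 2) ^ ((i - j) + (j - i)) := by
    intro i j
    rw [mul_pow, Real.sq_sqrt hB.le, ← pow_mul, mul_comm _ 2, pow_mul, Real.sq_sqrt (by norm_num)]
  have hst := h.conjT hs
  have hadj : ∀ i, star (kop μ (h.bk i)) = kop μ (hst.bk i) := fun i => kop_star _
  apply cotlar_stein (Finset.range N) (fun i => kop μ (h.bk i))
    (fun i j => Real.sqrt (csB A m) * Real.sqrt (1/2) ^ ((i - j) + (j - i))) _ (l2C_pos hA)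
  · intro i j; positivity
  · intro i _ j _
    rw [hsq]
    exact h.comp_norm' hs i j
  · intro i _ j _
    rw [hsq]
    have := hst.comp_norm' hs i j
    rw [← hadj, ← hadj, star_star] at this
    exact this
  · intro i _
    rw [← Finset.mul_sum]
    unfold l2C
    gcongr
    exact sum_theta _ (by positivity) sqrt_half_lt i N

theorem KF.L2bound (hs : HS μ d A m) (h : KF μ d A m k) (N : ℕ) (f : α → ℂ) (hf : MemLp f 2 μ) :
    eLpNorm (fun x => ∫ y, (∑ i ∈ Finset.range N, k i x y) * f y ∂μ) 2 μ
      ≤ ENNReal.ofReal (l2C A m) * eLpNorm f 2 μ := by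
  set T := ∑ i ∈ Finset.range N, kop μ (h.bk i) with hT
  have hTf : T hf.toLp =ᵐ[μ] fun x => ∫ y, (∑ i ∈ Finset.range N, k i x y) * f y ∂μ := by
    have h1 : ∀ i ∈ Finset.range N, kop μ (h.bk i) hf.toLp =ᵐ[μ] fun x => ∫ y, k i x y * f y ∂μ := by
      intro i _
      refine (kop_coe (h.bk i) _).trans (Filter.Eventually.of_forall fun x => ?_)
      apply integral_congr_ae
      filter_upwards [hf.coeFn_toLp] with y hy
      rw [hy]
    have h2 : (T hf.toLp : α → ℂ) =ᵐ[μ] ∑ i ∈ Finset.range N, (kop μ (h.bk i) hf.toLp : α → ℂ) := by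
      rw [hT, sum_apply]
      exact Lp.coeFn_finsetSum _ _
    refine h2.trans ?_
    have h3 : ∀ᵐ x ∂μ, ∀ i ∈ Finset.range N, kop μ (h.bk i) hf.toLp x = ∫ y, k i x y * f y ∂μ := by
      rw [Filter.eventually_all_finset]
      exact h1
    filter_upwards [h3] with x hx
    rw [Finset.sum_apply, Finset.sum_congr rfl hx, ← integral_finsetSum]
    · congr 1; ext y; rw [Finset.sum_mul]
    · intro i _
      exact (h.bk i).integrable_mul (hf.integrable (by norm_num)) x
  rw [← eLpNorm_congr_ae hTf]
  have h4 : ‖T hf.toLp‖ ≤ l2C A m * ‖hf.toLp‖ :=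
    T.le_of_opNorm_le (h.op_bound hs N) _
  rw [Lp.norm_def, Lp.norm_toLp] at h4
  have h5 := ENNReal.ofReal_le_ofReal h4
  rw [ENNReal.ofReal_toReal (Lp.eLpNorm_ne_top _), ENNReal.ofReal_mul (l2C_pos hs.pos).le,
    ENNReal.ofReal_toReal hf.2.ne] at h5
  exact h5

end L2Theory

end PartNoD

section PartNoE
open MeasureTheory Complex

section GoodLambda
open scoped ENNReal
variable {α : Type*} [MeasurableSpace α]
variable {μ : Measure α} {d : α → α → ℝ} {A : ℝ} {m : ℕ} {k : ℕ → α → α → ℂ}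

theorem eLpNorm_two_sq (μ : Measure α) (f : α → ℂ) : eLpNorm f 2 μ ^ 2 = ∫⁻ x, ‖f x‖ₑ ^ 2 ∂μ := by
  rw [← ofReal_two, eLpNorm_ofReal_eq f (by norm_num), ← ENNReal.rpow_natCast, ← ENNReal.rpow_mul]
  simp

/-- The truncated kernel -/
noncomputable def KS (k : ℕ → α → α → ℂ) (N : ℕ) (x y : α) : ℂ := ∑ i ∈ Finset.range N, k i x y

/-- The truncated operator -/
noncomputable def TN (μ : Measure α) (k : ℕ → α → α → ℂ) (N : ℕ) (f : α → ℂ) (x : α) : ℂ :=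
  ∫ y, KS k N x y * f y ∂μ

theorem KF.bkS (h : KF μ d A m k) (N : ℕ) :
    BK (KS k N) (∑ i ∈ Finset.range N, A * (2 ^ i) ^ m) where
  meas := by
    have : Function.uncurry (KS k N) = fun z => ∑ i ∈ Finset.range N, Function.uncurry (k i) z := rfl
    rw [this]
    exact Finset.measurable_sum _ (fun i _ => h.meas i)
  bdd x y := (norm_sum_le _ _).trans (Finset.sum_le_sum fun i _ => h.bdd i x y)

variable [IsFiniteMeasure μ]

theorem KF.L2sq (hs : HS μ d A m) (h : KF μ d A m k) (N : ℕ) (f : α → ℂ) (hf : MemLp f 2 μ) :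
    ∫⁻ x, ‖TN μ k N f x‖ₑ ^ 2 ∂μ ≤ ENNReal.ofReal (l2C A m ^ 2) * ∫⁻ x, ‖f x‖ₑ ^ 2 ∂μ := by
  have := h.L2bound hs N f hf
  rw [← eLpNorm_two_sq, ← eLpNorm_two_sq, ENNReal.ofReal_pow (l2C_pos hs.pos).le, ← mul_pow]
  gcongr
  exact this

theorem KF.measTN (h : KF μ d A m k) (N : ℕ) (f : α → ℂ) (hf : Measurable f) :
    Measurable (TN μ k N f) := by
  have : StronglyMeasurable (fun z : α × α => KS k N z.1 z.2 * f z.2) :=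
    ((h.bkS N).meas.mul (hf.comp measurable_snd)).stronglyMeasurable
  exact this.integral_prod_right'.measurable

theorem TN_sum (h : KF μ d A m k) (N : ℕ) (f : α → ℂ) (hf : Integrable f μ) (x : α) :
    TN μ k N f x = ∑ i ∈ Finset.range N, ∫ y, k i x y * f y ∂μ := by
  unfold TN KS
  simp_rw [Finset.sum_mul]
  exact integral_finsetSum _ (fun i _ => (h.bk i).integrable_mul hf x)

theorem TN_add (h : KF μ d A m k) (N : ℕ) (f g : α → ℂ) (hf : Integrable f μ) (hg : Integrable g μ)
    (x : α) : TN μ k N (f + g) x = TN μ k N f x + TN μ k N g x := by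
  unfold TN
  rw [← integral_add ((h.bkS N).integrable_mul hf x) ((h.bkS N).integrable_mul hg x)]
  congr 1; ext y; simp [mul_add]

/-- Mean value of f on a ball from its quadratic mean. -/
theorem HS.mean_le (hs : HS μ d A m) (f : α → ℂ) (hf : Measurable f) (x : α) (R g : ℝ) (hR : 0 < R)
    (hg : 0 < g)
    (h2 : ∫⁻ y in {y | d x y ≤ R}, ‖f y‖ₑ ^ 2 ∂μ ≤ ENNReal.ofReal (g ^ 2 * R ^ m)) :
    ∫⁻ y in {y | d x y ≤ R}, ‖f y‖ₑ ∂μ ≤ ENNReal.ofReal (A * g * R ^ m) := by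
  have hA := hs.pos
  have pt : ∀ y, ‖f y‖ₑ ≤ ENNReal.ofReal (g / 2) + ENNReal.ofReal (1 / (2 * g)) * ‖f y‖ₑ ^ 2 := by
    intro y
    rw [← ofReal_norm, ← ENNReal.ofReal_pow (norm_nonneg _), ← ENNReal.ofReal_mul (by positivity),
      ← ENNReal.ofReal_add (by positivity) (by positivity)]
    apply ENNReal.ofReal_le_ofReal
    have : g / 2 + 1 / (2 * g) * ‖f y‖ ^ 2 - ‖f y‖ = (‖f y‖ - g) ^ 2 / (2 * g) := by
      field_simp; ring
    have h3 : 0 ≤ (‖f y‖ - g) ^ 2 / (2 * g) := by positivity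
    linarith
  calc _ ≤ ∫⁻ y in {y | d x y ≤ R}, (ENNReal.ofReal (g / 2)
        + ENNReal.ofReal (1 / (2 * g)) * ‖f y‖ₑ ^ 2) ∂μ := lintegral_mono pt
    _ = ENNReal.ofReal (g / 2) * μ {y | d x y ≤ R}
        + ENNReal.ofReal (1 / (2 * g)) * ∫⁻ y in {y | d x y ≤ R}, ‖f y‖ₑ ^ 2 ∂μ := by
        rw [lintegral_add_left measurable_const, setLIntegral_const,
          lintegral_const_mul _ (hf.enorm.pow_const 2)]
    _ ≤ ENNReal.ofReal (g / 2) * ENNReal.ofReal (A * R ^ m)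
        + ENNReal.ofReal (1 / (2 * g)) * ENNReal.ofReal (g ^ 2 * R ^ m) := by
        gcongr
        exact hs.ub x R hR
    _ = ENNReal.ofReal (g / 2 * (A * R ^ m) + 1 / (2 * g) * (g ^ 2 * R ^ m)) := by
        rw [ENNReal.ofReal_add (by positivity) (by positivity),
          ENNReal.ofReal_mul (p := g / 2) (by positivity),
          ENNReal.ofReal_mul (p := 1 / (2 * g)) (by positivity)]
    _ ≤ _ := by
        apply ENNReal.ofReal_le_ofReal
        have e : 1 / (2 * g) * (g ^ 2 * R ^ m) = g / 2 * (1 * R ^ m) := by field_simp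
        rw [e]
        have : g / 2 * (1 * R ^ m) ≤ g / 2 * (A * R ^ m) := by
          gcongr
          exact hs.one_le
        nlinarith

theorem sum_two_pow_le (N : ℕ) (r : ℝ) (hr : 0 < r) :
    ∑ i ∈ (Finset.range N).filter (fun i : ℕ => (2:ℝ) ^ i * r < 1), (2:ℝ) ^ i * r ≤ 2 := by
  induction N with
  | zero => simp
  | succ N ih =>
    by_cases hN : (2:ℝ) ^ N * r < 1
    · have : (Finset.range (N+1)).filter (fun i : ℕ => (2:ℝ) ^ i * r < 1) = Finset.range (N+1) := by
        apply Finset.filter_true_of_mem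
        intro i hi
        simp at hi
        refine lt_of_le_of_lt ?_ hN
        gcongr
        norm_num
      rw [this, ← Finset.sum_mul]
      have h2 := geom_sum_eq (x := (2:ℝ)) (by norm_num) (N + 1)
      rw [h2]
      have : (2:ℝ) ^ (N+1) = 2 * 2 ^ N := by ring
      rw [this]
      nlinarith
    · rw [Finset.range_add_one, Finset.filter_insert, if_neg hN]
      exact ih

/-- oscillation of the far part -/
theorem KF.osc (hs : HS μ d A m) (h : KF μ d A m k) (N : ℕ) (f : α → ℂ) (hf : Measurable f)
    (hfi : Integrable f μ) (x y y' : α) (r g : ℝ) (hr : 0 < r) (hg : 0 < g)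
    (hy : d x y ≤ 3 * A * r) (hy' : d x y' ≤ 3 * A * r)
    (h2 : ∀ R, 2 * r ≤ R → ∫⁻ z in {z | d x z ≤ R}, ‖f z‖ₑ ^ 2 ∂μ ≤ ENNReal.ofReal (g ^ 2 * R ^ m)) :
    ‖TN μ k N ({z | d x z ≤ 4 * A ^ 2 * r}ᶜ.indicator f) y
      - TN μ k N ({z | d x z ≤ 4 * A ^ 2 * r}ᶜ.indicator f) y'‖
      ≤ 12 * A ^ 4 * (4 * A ^ 2) ^ m * g := by
  have hA := hs.pos
  have hA1 := hs.one_le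
  set B := {z | d x z ≤ 4 * A ^ 2 * r} with hB
  have hBm : MeasurableSet B := hs.measBall x _
  have hgi : Integrable (Bᶜ.indicator f) μ := hfi.indicator hBm.compl
  rw [TN_sum h N _ hgi, TN_sum h N _ hgi, ← Finset.sum_sub_distrib]
  have hyy : d y y' ≤ 6 * A ^ 2 * r := by
    have := hs.tri y x y'
    rw [hs.symm y x] at this
    nlinarith
  -- small scales vanish
  have small : ∀ i : ℕ, ¬ ((2:ℝ) ^ i * r < 1) → ∀ u, d x u ≤ 3 * A * r →
      ∫ w, k i u w * Bᶜ.indicator f w ∂μ = 0 := by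
    intro i hi u hu
    apply integral_eq_zero_of_ae
    apply Filter.Eventually.of_forall
    intro w
    by_cases hw : w ∈ B
    · simp [hw]
    · have : k i u w = 0 := by
        apply h.supp
        by_contra! hcon
        apply hw
        have h3 := hs.tri x u w
        have h4 : d u w ≤ A * r := by
          have : d u w ≤ d u w * (2 ^ i * r) := le_mul_of_one_le_right (hs.nonneg _ _) (by linarith)
          calc d u w ≤ (2 ^ i * d u w) * r := by linarith
            _ ≤ A * r := by gcongr
        change d x w ≤ _
        nlinarith
      simp [this]
  have big : ∀ i : ℕ, ((2:ℝ) ^ i * r < 1) →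
      ‖∫ w, k i y w * Bᶜ.indicator f w ∂μ - ∫ w, k i y' w * Bᶜ.indicator f w ∂μ‖
        ≤ 6 * A ^ 4 * (4 * A ^ 2) ^ m * g * (2 ^ i * r) := by
    intro i hi
    have h2i : (0:ℝ) < 2 ^ i := by positivity
    have hri : r ≤ 1 / 2 ^ i := by
      rw [le_div_iff₀ h2i]; linarith
    rw [← integral_sub ((h.bk i).integrable_mul hgi y) ((h.bk i).integrable_mul hgi y')]
    set R := 4 * A ^ 2 / 2 ^ i with hRdef
    have hR : 0 < R := by positivity
    have hRr : 2 * r ≤ R := by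
      have : R = (4 * A ^ 2) * (1 / 2 ^ i) := by rw [hRdef]; ring
      rw [this]
      have : (2:ℝ) ≤ 4 * A ^ 2 := by nlinarith
      gcongr
    have hm := hs.mean_le f hf x R g hR hg (h2 R hRr)
    have hsup : ∀ u, d x u ≤ 3 * A * r → ∀ w, ¬ (d x w ≤ R) → k i u w = 0 := by
      intro u hu w hw
      apply h.supp
      by_contra! hcon
      apply hw
      have h3 := hs.tri x u w
      have h4 : d u w ≤ A * (1 / 2 ^ i) := by
        rw [mul_one_div, le_div_iff₀ h2i]; linarith
      have : R = (4 * A ^ 2) * (1 / 2 ^ i) := by rw [hRdef]; ring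
      rw [this]
      have h5 : 3 * A * r ≤ 3 * A * (1 / 2 ^ i) := by gcongr
      nlinarith
    set Q := A * (2 ^ i) ^ m * (2 ^ i * (6 * A ^ 2 * r)) with hQ
    have hQ0 : 0 ≤ Q := by positivity
    have pt : ∀ w, ‖k i y w * Bᶜ.indicator f w - k i y' w * Bᶜ.indicator f w‖ₑ
        ≤ {z | d x z ≤ R}.indicator (fun w => ENNReal.ofReal Q * ‖f w‖ₑ) w := by
      intro w
      by_cases hw : d x w ≤ R
      · rw [Set.indicator_of_mem (s := {z | d x z ≤ R}) hw, ← sub_mul, enorm_mul]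
        gcongr
        · rw [← ofReal_norm]
          apply ENNReal.ofReal_le_ofReal
          refine (h.sm1 i y y' w).trans ?_
          rw [hQ]; gcongr
        · by_cases hwB : w ∈ B <;> simp [hwB]
      · rw [hsup y hy w hw, hsup y' hy' w hw]
        simp
    have hle : ‖∫ w, (k i y w * Bᶜ.indicator f w - k i y' w * Bᶜ.indicator f w) ∂μ‖ₑ
        ≤ ENNReal.ofReal (Q * (A * g * R ^ m)) := by
      refine (enorm_integral_le_lintegral_enorm _).trans ((lintegral_mono pt).trans ?_)
      rw [lintegral_indicator (hs.measBall x R), lintegral_const_mul _ hf.enorm,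
        ENNReal.ofReal_mul hQ0]
      gcongr
    rw [← ofReal_norm, ENNReal.ofReal_le_ofReal_iff (by positivity)] at hle
    refine hle.trans (le_of_eq ?_)
    rw [hQ, hRdef, div_pow]
    field_simp
  calc _ ≤ ∑ i ∈ Finset.range N, ‖∫ w, k i y w * Bᶜ.indicator f w ∂μ
          - ∫ w, k i y' w * Bᶜ.indicator f w ∂μ‖ := norm_sum_le _ _
    _ = ∑ i ∈ (Finset.range N).filter (fun i : ℕ => (2:ℝ) ^ i * r < 1),
          ‖∫ w, k i y w * Bᶜ.indicator f w ∂μ - ∫ w, k i y' w * Bᶜ.indicator f w ∂μ‖ := by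
        rw [Finset.sum_filter_of_ne]
        intro i _ hne
        by_contra hcon
        apply hne
        rw [small i hcon y hy, small i hcon y' hy']
        simp
    _ ≤ ∑ i ∈ (Finset.range N).filter (fun i : ℕ => (2:ℝ) ^ i * r < 1),
          6 * A ^ 4 * (4 * A ^ 2) ^ m * g * (2 ^ i * r) := by
        apply Finset.sum_le_sum
        intro i hi
        exact big i (Finset.mem_filter.1 hi).2
    _ ≤ 6 * A ^ 4 * (4 * A ^ 2) ^ m * g * 2 := by
        rw [← Finset.mul_sum]
        gcongr
        exact sum_two_pow_le N r hr
    _ = _ := by ring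

end GoodLambda

end PartNoE

section PartNoF
open MeasureTheory Complex

section GoodLambda2
open scoped ENNReal
variable {α : Type*} [MeasurableSpace α]
variable {μ : Measure α} {d : α → α → ℝ} {A : ℝ} {m : ℕ} {k : ℕ → α → α → ℂ}
variable [IsFiniteMeasure μ]

noncomputable def glM (A : ℝ) (m : ℕ) : ℝ := 4 * A * (2 ^ m + l2C A m ^ 2 * (4 * A ^ 2) ^ m) + 1
noncomputable def gla (A : ℝ) (m : ℕ) : ℝ := 2 * glM A m + 12 * A ^ 4 * (4 * A ^ 2) ^ m + 1
noncomputable def glL (A : ℝ) (m : ℕ) : ℝ := l2C A m ^ 2 * (4 * A ^ 2) ^ m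

theorem cheb (μ : Measure α) (F : α → ℂ) (hF : Measurable F) (t : ℝ) (ht : 0 < t) (S : ℝ)
    (h : ∫⁻ y, ‖F y‖ₑ ^ 2 ∂μ ≤ ENNReal.ofReal (S * t ^ 2)) :
    μ {y | t < ‖F y‖} ≤ ENNReal.ofReal S := by
  have h1 := meas_ge_le_lintegral_div (μ := μ) (f := fun y => ‖F y‖ₑ ^ 2)
    (hF.enorm.pow_const 2).aemeasurable (ε := ENNReal.ofReal (t ^ 2)) (by simp; positivity) (by simp)
  calc _ ≤ μ {x | ENNReal.ofReal (t ^ 2) ≤ ‖F x‖ₑ ^ 2} := by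
        apply measure_mono
        intro y hy
        change ENNReal.ofReal (t ^ 2) ≤ _
        rw [← ofReal_norm, ← ENNReal.ofReal_pow (norm_nonneg _)]
        apply ENNReal.ofReal_le_ofReal
        have : t < ‖F y‖ := hy
        gcongr
    _ ≤ _ := h1
    _ ≤ ENNReal.ofReal (S * t ^ 2) / ENNReal.ofReal (t ^ 2) := by gcongr
    _ = _ := by
        rw [← ENNReal.ofReal_div_of_pos (by positivity)]
        congr 1; field_simp

theorem cheb1 (μ : Measure α) (F : α → ℂ) (hF : Measurable F) (t : ℝ) (ht : 0 < t) (S : ℝ)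
    (h : ∫⁻ y, ‖F y‖ₑ ∂μ ≤ ENNReal.ofReal (S * t)) :
    μ {y | t < ‖F y‖} ≤ ENNReal.ofReal S := by
  have h1 := meas_ge_le_lintegral_div (μ := μ) (f := fun y => ‖F y‖ₑ)
    (hF.enorm).aemeasurable (ε := ENNReal.ofReal t) (by simp; positivity) (by simp)
  calc _ ≤ μ {x | ENNReal.ofReal t ≤ ‖F x‖ₑ} := by
        apply measure_mono
        intro y hy
        change ENNReal.ofReal t ≤ _
        rw [← ofReal_norm]
        apply ENNReal.ofReal_le_ofReal
        exact le_of_lt hy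
    _ ≤ _ := h1
    _ ≤ ENNReal.ofReal (S * t) / ENNReal.ofReal t := by gcongr
    _ = _ := by
        rw [← ENNReal.ofReal_div_of_pos (by positivity)]
        congr 1; field_simp

theorem KF.local (hs : HS μ d A m) (h : KF μ d A m k) (N : ℕ) (f : α → ℂ) (hf : Measurable f)
    (hf2 : MemLp f 2 μ) (x : α) (r t γ : ℝ) (hr : 0 < r) (hr1 : r ≤ 1) (ht : 0 < t)
    (hγ : 0 < γ) (hγ1 : γ ≤ 1)
    (hF : ∫⁻ z in {z | d x z ≤ 2 * r}, ‖TN μ k N f z‖ₑ ∂μ ≤ ENNReal.ofReal (t * (2 * r) ^ m))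
    (h2 : ∀ R, 2 * r ≤ R →
      ∫⁻ z in {z | d x z ≤ R}, ‖f z‖ₑ ^ 2 ∂μ ≤ ENNReal.ofReal ((γ * t) ^ 2 * R ^ m)) :
    μ ({y | gla A m * t < ‖TN μ k N f y‖} ∩ {y | d x y ≤ 3 * A * r})
      ≤ ENNReal.ofReal (glL A m * γ ^ 2 * r ^ m) := by
  have hA := hs.pos
  have hA1 := hs.one_le
  have hL := l2C_pos (m := m) hA
  have hfi : Integrable f μ := hf2.integrable (by norm_num)
  set B := {z | d x z ≤ 4 * A ^ 2 * r} with hB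
  have hBm : MeasurableSet B := hs.measBall x _
  set F := TN μ k N f with hFdef
  set F1 := TN μ k N (B.indicator f) with hF1
  set F2 := TN μ k N (Bᶜ.indicator f) with hF2
  have hFm : Measurable F := h.measTN N f hf
  have hF1m : Measurable F1 := h.measTN N _ (hf.indicator hBm)
  have hsum : ∀ y, F y = F1 y + F2 y := by
    intro y
    rw [hFdef, hF1, hF2, ← TN_add h N _ _ (hfi.indicator hBm) (hfi.indicator hBm.compl)]
    congr 1
    exact (Set.indicator_self_add_compl B f).symm
  have hF1L : ∫⁻ y, ‖F1 y‖ₑ ^ 2 ∂μ ≤ ENNReal.ofReal (glL A m * γ ^ 2 * r ^ m * t ^ 2) := by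
    have h3 := h.L2sq hs N _ (hf2.indicator hBm)
    have h4 : ∫⁻ y, ‖B.indicator f y‖ₑ ^ 2 ∂μ = ∫⁻ z in B, ‖f z‖ₑ ^ 2 ∂μ := by
      rw [← lintegral_indicator hBm]
      congr 1; ext y
      by_cases hy : y ∈ B <;> simp [hy]
    have h24 : (2:ℝ) ≤ 4 * A ^ 2 := by nlinarith
    have h5 := h2 (4 * A ^ 2 * r) (by gcongr)
    rw [h4] at h3
    refine h3.trans ?_
    calc _ ≤ ENNReal.ofReal (l2C A m ^ 2) * ENNReal.ofReal ((γ * t) ^ 2 * (4 * A ^ 2 * r) ^ m) := by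
          gcongr
      _ = _ := by
          rw [← ENNReal.ofReal_mul (by positivity)]
          congr 1
          unfold glL
          ring
  have hM1 : 1 ≤ glM A m := by
    unfold glM
    have : 0 ≤ 4 * A * (2 ^ m + l2C A m ^ 2 * (4 * A ^ 2) ^ m) := by positivity
    linarith
  have hMp : 0 < glM A m := by linarith
  -- good point
  obtain ⟨y0, hy0, hy0F, hy0F1⟩ : ∃ y0, d x y0 ≤ r ∧ ‖F y0‖ ≤ glM A m * t ∧ ‖F1 y0‖ ≤ glM A m * t := by
    by_contra! hcon
    have c1 : μ {y | glM A m * t < ‖F1 y‖} ≤ ENNReal.ofReal (glL A m * r ^ m / glM A m) := by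
      apply cheb μ F1 hF1m _ (by positivity)
      refine hF1L.trans (ENNReal.ofReal_le_ofReal ?_)
      have e : glL A m * r ^ m / glM A m * (glM A m * t) ^ 2 = glL A m * r ^ m * t ^ 2 * glM A m := by
        field_simp
      rw [e]
      have hLL : 0 ≤ glL A m := by unfold glL; positivity
      calc glL A m * γ ^ 2 * r ^ m * t ^ 2 ≤ glL A m * 1 * r ^ m * t ^ 2 := by
            gcongr
            exact pow_le_one₀ hγ.le hγ1
        _ = glL A m * r ^ m * t ^ 2 * 1 := by ring
        _ ≤ _ := by gcongr
    have c2 : μ.restrict {z | d x z ≤ 2 * r} {y | glM A m * t < ‖F y‖}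
        ≤ ENNReal.ofReal (2 ^ m * r ^ m / glM A m) := by
      apply cheb1 _ F hFm _ (by positivity)
      refine hF.trans (ENNReal.ofReal_le_ofReal (le_of_eq ?_))
      rw [mul_pow]; field_simp
    have c3 : μ {y | d x y ≤ r} ≤ ENNReal.ofReal (2 ^ m * r ^ m / glM A m)
        + ENNReal.ofReal (glL A m * r ^ m / glM A m) := by
      refine le_trans ?_ (add_le_add c2 c1)
      rw [Measure.restrict_apply (measurableSet_lt measurable_const hFm.norm)]
      refine le_trans (measure_mono ?_) (measure_union_le _ _)
      intro y hy
      have hy' : d x y ≤ r := hy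
      by_cases hyF : ‖F y‖ ≤ glM A m * t
      · right; exact hcon y hy' hyF
      · left
        refine ⟨?_, ?_⟩
        · change glM A m * t < ‖F y‖; linarith
        · change d x y ≤ 2 * r; linarith
    have c4 := (hs.lb x r hr hr1).trans c3
    have hLL : 0 ≤ glL A m := by unfold glL; positivity
    rw [← ENNReal.ofReal_add (by positivity) (by positivity),
      ENNReal.ofReal_le_ofReal_iff (by positivity)] at c4
    have e : 2 ^ m * r ^ m / glM A m + glL A m * r ^ m / glM A m
      = r ^ m * ((2 ^ m + glL A m) / glM A m) := by ring
    rw [e, mul_comm] at c4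
    have c5 := le_of_mul_le_mul_left c4 (by positivity)
    rw [le_div_iff₀ hMp, inv_mul_le_iff₀ hA] at c5
    have : glM A m = 4 * A * (2 ^ m + glL A m) + 1 := rfl
    rw [this] at c5
    have : 0 ≤ A * (2 ^ m + glL A m) := by positivity
    linarith
  have hsub : {y | gla A m * t < ‖F y‖} ∩ {y | d x y ≤ 3 * A * r} ⊆ {y | t < ‖F1 y‖} := by
    rintro y ⟨hy1, hy2⟩
    have hy1' : gla A m * t < ‖F y‖ := hy1
    have hy2' : d x y ≤ 3 * A * r := hy2
    change t < ‖F1 y‖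
    have ho := h.osc hs N f hf hfi x y y0 r (γ * t) hr (by positivity) hy2'
      (hy0.trans (by nlinarith)) h2
    have ho' : ‖F2 y - F2 y0‖ ≤ 12 * A ^ 4 * (4 * A ^ 2) ^ m * t := by
      refine ho.trans ?_
      have : γ * t ≤ t := by nlinarith
      gcongr
    have h6 : ‖F2 y0‖ ≤ 2 * glM A m * t := by
      have : F2 y0 = F y0 - F1 y0 := by rw [hsum y0]; ring
      rw [this]
      refine (norm_sub_le _ _).trans ?_
      linarith
    have h7 : ‖F2 y‖ ≤ 12 * A ^ 4 * (4 * A ^ 2) ^ m * t + 2 * glM A m * t := by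
      have : F2 y = (F2 y - F2 y0) + F2 y0 := by ring
      rw [this]
      exact (norm_add_le _ _).trans (add_le_add ho' h6)
    have h8 : ‖F y‖ ≤ ‖F1 y‖ + ‖F2 y‖ := by rw [hsum y]; exact norm_add_le _ _
    have : gla A m * t = 2 * glM A m * t + 12 * A ^ 4 * (4 * A ^ 2) ^ m * t + t := by
      unfold gla; ring
    linarith
  exact (measure_mono hsub).trans (cheb μ F1 hF1m t ht _ hF1L)

/-- Vitali type covering -/
theorem HS.cover (hs : HS μ d A m) (E : Set α) (r : α → ℝ) (hr : ∀ x ∈ E, 0 < r x)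
    (hr1 : ∀ x ∈ E, r x ≤ 1) :
    ∃ u ⊆ E, u.Countable ∧ u.PairwiseDisjoint (fun x => {y | d x y ≤ r x}) ∧
      E ⊆ ⋃ x ∈ u, {y | d x y ≤ 3 * A * r x} := by
  have hA := hs.pos
  obtain ⟨u, huE, hdis, hcov⟩ := Vitali.exists_disjoint_subfamily_covering_enlargement
    (fun x => {y | d x y ≤ r x}) E r 2 (by norm_num) (fun a ha => (hr a ha).le) 1 hr1
    (fun a ha => ⟨a, by change d a a ≤ r a; rw [hs.diag]; exact (hr a ha).le⟩)
  refine ⟨u, huE, ?_, hdis, ?_⟩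
  · have hd : Pairwise (Function.onFun Disjoint (fun x : u => {y | d (x:α) y ≤ r x})) := by
      intro x y hxy
      exact hdis x.2 y.2 (fun hh => hxy (Subtype.ext hh))
    have hc := Measure.countable_meas_pos_of_disjoint_iUnion (μ := μ)
      (As := fun x : u => {y | d (x:α) y ≤ r x}) (fun x => hs.measBall _ _) hd
    have : {i : u | 0 < μ {y | d (i:α) y ≤ r i}} = Set.univ := by
      ext i
      simp only [Set.mem_ofPred_eq, Set.mem_univ, iff_true]
      have h1 := hr i (huE i.2)
      refine lt_of_lt_of_le ?_ (hs.lb i (r i) h1 (hr1 i (huE i.2)))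
      simp only [ENNReal.ofReal_pos]; positivity
    rw [this] at hc
    exact Set.countable_univ_iff.1 hc
  · intro a ha
    obtain ⟨b, hb, ⟨z, hz1, hz2⟩, hab⟩ := hcov a ha
    rw [Set.mem_iUnion₂]
    refine ⟨b, hb, ?_⟩
    change d b a ≤ _
    have h1 : d a z ≤ r a := hz1
    have h2 : d b z ≤ r b := hz2
    have h3 := hs.tri b z a
    rw [hs.symm z a] at h3
    nlinarith

theorem HS.trunc (hs : HS μ d A m) (φ : α → ℝ≥0∞) (x : α) (r s : ℝ)
    (hr : 0 < r) (hsp : 0 < s)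
    (h : ENNReal.ofReal (s * r ^ m) ≤ ∫⁻ y in {y | d x y ≤ r}, φ y ∂μ) (hφ : Measurable φ) :
    ENNReal.ofReal (r ^ m) ≤ ENNReal.ofReal (2 / s) * ∫⁻ y in {y | d x y ≤ r},
      {y | ENNReal.ofReal (s / (2 * A)) < φ y}.indicator φ y ∂μ := by
  have hA := hs.pos
  set I := ∫⁻ y in {y | d x y ≤ r}, {y | ENNReal.ofReal (s / (2 * A)) < φ y}.indicator φ y ∂μ with hI
  have h1 : ∫⁻ y in {y | d x y ≤ r}, φ y ∂μ ≤ I + ENNReal.ofReal (s * r ^ m / 2) := by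
    calc _ ≤ ∫⁻ y in {y | d x y ≤ r}, ({y | ENNReal.ofReal (s / (2 * A)) < φ y}.indicator φ y
          + ENNReal.ofReal (s / (2 * A))) ∂μ := by
          gcongr with y
          by_cases hy : y ∈ {y | ENNReal.ofReal (s / (2 * A)) < φ y}
          · rw [Set.indicator_of_mem hy]; exact le_self_add
          · rw [Set.indicator_of_notMem hy, zero_add]
            exact not_lt.1 hy
      _ = I + ENNReal.ofReal (s / (2 * A)) * μ {y | d x y ≤ r} := by
          rw [lintegral_add_right _ measurable_const, setLIntegral_const]
      _ ≤ I + ENNReal.ofReal (s / (2 * A)) * ENNReal.ofReal (A * r ^ m) := by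
          gcongr; exact hs.ub x r hr
      _ = _ := by
          rw [← ENNReal.ofReal_mul (by positivity)]
          congr 2
          field_simp
  have h2 : ENNReal.ofReal (s * r ^ m / 2) ≤ I := by
    have h3 := h.trans h1
    have e : s * r ^ m = s * r ^ m / 2 + s * r ^ m / 2 := by ring
    have e2 : ENNReal.ofReal (s * r ^ m)
        = ENNReal.ofReal (s * r ^ m / 2) + ENNReal.ofReal (s * r ^ m / 2) := by
      rw [← ENNReal.ofReal_add (by positivity) (by positivity), ← e]
    rw [e2] at h3
    exact (ENNReal.add_le_add_iff_right ENNReal.ofReal_ne_top).1 h3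
  calc _ = ENNReal.ofReal (2 / s) * ENNReal.ofReal (s * r ^ m / 2) := by
        rw [← ENNReal.ofReal_mul (by positivity)]
        congr 1; field_simp
    _ ≤ _ := by gcongr

end GoodLambda2

end PartNoF

section PartNoG
open MeasureTheory Complex

section GoodLambda3
open scoped ENNReal
variable {α : Type*} [MeasurableSpace α]
variable {μ : Measure α} {d : α → α → ℝ} {A : ℝ} {m : ℕ} {k : ℕ → α → α → ℂ}
variable [IsFiniteMeasure μ]

/-- upper truncation -/
noncomputable def upT (φ : α → ℝ≥0∞) (s : ℝ) (y : α) : ℝ≥0∞ :=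
  {y | ENNReal.ofReal s < φ y}.indicator φ y

theorem measurable_upT (φ : α → ℝ≥0∞) (hφ : Measurable φ) (s : ℝ) : Measurable (upT φ s) :=
  hφ.indicator (measurableSet_lt measurable_const hφ)

theorem KF.nonempty_radius (hs : HS μ d A m) (h : KF μ d A m k) (N : ℕ) (f : α → ℂ)
    (hfi : Integrable f μ) (x : α) (t : ℝ) (ht : 0 < t)
    (hx : gla A m * t < ‖TN μ k N f x‖) :
    ∃ r, 0 < r ∧ ENNReal.ofReal (t * r ^ m) < ∫⁻ z in {z | d x z ≤ r}, ‖TN μ k N f z‖ₑ ∂μ := by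
  have hA := hs.pos
  have hA1 := hs.one_le
  set F := TN μ k N f with hF
  set L := (∑ i ∈ Finset.range N, A * (2 ^ i) ^ m * 2 ^ i) * ∫ w, ‖f w‖ ∂μ with hL
  have hL0 : 0 ≤ L := by
    apply mul_nonneg
    · exact Finset.sum_nonneg fun i _ => by positivity
    · exact integral_nonneg fun _ => norm_nonneg _
  have hlip : ∀ z, ‖F x - F z‖ ≤ L * d x z := by
    intro z
    rw [hF, TN_sum h N f hfi, TN_sum h N f hfi, ← Finset.sum_sub_distrib, hL, Finset.sum_mul,
      Finset.sum_mul]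
    refine (norm_sum_le _ _).trans (Finset.sum_le_sum fun i _ => ?_)
    rw [← integral_sub ((h.bk i).integrable_mul hfi x) ((h.bk i).integrable_mul hfi z)]
    calc _ ≤ ∫ w, (A * (2 ^ i) ^ m * (2 ^ i * d x z)) * ‖f w‖ ∂μ := by
          apply norm_integral_le_of_norm_le (hfi.norm.const_mul _)
          apply Filter.Eventually.of_forall
          intro w
          rw [← sub_mul, norm_mul]
          gcongr
          exact h.sm1 i x z w
      _ = _ := by rw [integral_const_mul]; ring
  have hgla : 4 * A + 1 ≤ gla A m := by
    unfold gla glM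
    have h1 : (1:ℝ) ≤ 2 ^ m := one_le_pow₀ (by norm_num)
    have h2 : 0 ≤ 4 * A * (l2C A m ^ 2 * (4 * A ^ 2) ^ m) := by positivity
    have h3 : 0 ≤ 12 * A ^ 4 * (4 * A ^ 2) ^ m := by positivity
    nlinarith
  set r := min 1 (t / (L + 1)) with hr
  have hr0 : 0 < r := by rw [hr]; positivity
  refine ⟨r, hr0, ?_⟩
  have hLr : L * r ≤ t := by
    calc L * r ≤ L * (t / (L + 1)) := by gcongr; exact min_le_right _ _
      _ ≤ (L + 1) * (t / (L + 1)) := by gcongr; linarith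
      _ = t := by field_simp
  have hpt : ∀ z ∈ {z | d x z ≤ r}, ENNReal.ofReal (4 * A * t) ≤ ‖F z‖ₑ := by
    intro z hz
    have hz' : d x z ≤ r := hz
    rw [← ofReal_norm]
    apply ENNReal.ofReal_le_ofReal
    have h1 := hlip z
    have h2 : L * d x z ≤ t := le_trans (by gcongr) hLr
    have h3 : ‖F x‖ ≤ ‖F z‖ + ‖F x - F z‖ := by
      have : F x = F z + (F x - F z) := by ring
      conv_lhs => rw [this]
      exact norm_add_le _ _
    nlinarith
  calc ENNReal.ofReal (t * r ^ m) < ENNReal.ofReal (4 * A * t * (A⁻¹ * r ^ m)) := by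
        rw [ENNReal.ofReal_lt_ofReal_iff (by positivity)]
        have : 4 * A * t * (A⁻¹ * r ^ m) = 4 * (t * r ^ m) := by field_simp
        rw [this]
        have : 0 < t * r ^ m := by positivity
        linarith
    _ = ENNReal.ofReal (4 * A * t) * ENNReal.ofReal (A⁻¹ * r ^ m) := ENNReal.ofReal_mul (by positivity)
    _ ≤ ENNReal.ofReal (4 * A * t) * μ {z | d x z ≤ r} := by
        gcongr; exact hs.lb x r hr0 (min_le_left _ _)
    _ = ∫⁻ z in {z | d x z ≤ r}, ENNReal.ofReal (4 * A * t) ∂μ := (setLIntegral_const _ _).symm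
    _ ≤ _ := setLIntegral_mono' (hs.measBall x r) hpt

theorem KF.good_lambda (hm : m ≠ 0) (hs : HS μ d A m) (h : KF μ d A m k) (N : ℕ) (f : α → ℂ)
    (hf : Measurable f)
    (hf2 : MemLp f 2 μ) (t γ : ℝ) (ht : 0 < t) (hγ : 0 < γ) (hγ1 : γ ≤ 1)
    (ht1 : ∫⁻ z, ‖TN μ k N f z‖ₑ ∂μ ≤ ENNReal.ofReal t)
    (ht2 : ∫⁻ z, ‖f z‖ₑ ^ 2 ∂μ ≤ ENNReal.ofReal ((γ * t) ^ 2)) :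
    μ {y | gla A m * t < ‖TN μ k N f y‖} ≤ ENNReal.ofReal (glL A m * γ ^ 2) *
      (ENNReal.ofReal (2 / t) * ∫⁻ y, upT (fun y => ‖TN μ k N f y‖ₑ) (t / (2 * A)) y ∂μ
      + ENNReal.ofReal (2 / (γ * t) ^ 2) *
        ∫⁻ y, upT (fun y => ‖f y‖ₑ ^ 2) ((γ * t) ^ 2 / (2 * A)) y ∂μ) := by
  have hA := hs.pos
  have hfi : Integrable f μ := hf2.integrable (by norm_num)
  set F := TN μ k N f with hF
  have hFm : Measurable F := h.measTN N f hf
  set E := {y | gla A m * t < ‖F y‖} with hE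
  let R : α → Set ℝ := fun x => {r | 0 < r ∧
    (ENNReal.ofReal (t * r ^ m) < ∫⁻ z in {z | d x z ≤ r}, ‖F z‖ₑ ∂μ ∨
     ENNReal.ofReal ((γ * t) ^ 2 * r ^ m) < ∫⁻ z in {z | d x z ≤ r}, ‖f z‖ₑ ^ 2 ∂μ)}
  have hRle : ∀ x, ∀ r ∈ R x, r ≤ 1 := by
    rintro x r ⟨hr0, hr⟩
    have key : ∀ s : ℝ, 0 < s → ENNReal.ofReal (s * r ^ m) < ENNReal.ofReal s → r ≤ 1 := by
      intro s hs0 hh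
      rw [ENNReal.ofReal_lt_ofReal_iff hs0] at hh
      by_contra! hcon
      have : 1 ≤ r ^ m := one_le_pow₀ hcon.le
      nlinarith
    rcases hr with hr | hr
    · exact key t ht (hr.trans_le ((setLIntegral_le_lintegral _ _).trans ht1))
    · exact key _ (by positivity) (hr.trans_le ((setLIntegral_le_lintegral _ _).trans ht2))
  have hsel : ∀ x ∈ E, ∃ r ∈ R x, ∀ r', 2 * r ≤ r' → r' ∉ R x := by
    intro x hx
    obtain ⟨r0, hr0, hr0'⟩ := h.nonempty_radius hs N f hfi x t ht hx
    have hne : (R x).Nonempty := ⟨r0, hr0, Or.inl hr0'⟩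
    have hbd : BddAbove (R x) := ⟨1, hRle x⟩
    have hpos : 0 < sSup (R x) := lt_of_lt_of_le hr0 (le_csSup hbd ⟨hr0, Or.inl hr0'⟩)
    obtain ⟨r, hr, hlt⟩ := exists_lt_of_lt_csSup hne (show sSup (R x) / 2 < sSup (R x) by linarith)
    refine ⟨r, hr, fun r' hr' hcon => ?_⟩
    have := le_csSup hbd hcon
    linarith
  classical
  choose! r hr1 hr2 using hsel
  obtain ⟨u, huE, huc, hdis, hcov⟩ := hs.cover E r (fun x hx => (hr1 x hx).1)
    (fun x hx => hRle x _ (hr1 x hx))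
  set Φ : α → ℝ≥0∞ := fun y => ENNReal.ofReal (2 / t) * upT (fun y => ‖F y‖ₑ) (t / (2 * A)) y
      + ENNReal.ofReal (2 / (γ * t) ^ 2) * upT (fun y => ‖f y‖ₑ ^ 2) ((γ * t) ^ 2 / (2 * A)) y with hΦ
  have hm1 := measurable_upT (fun y => ‖F y‖ₑ) hFm.enorm (t / (2 * A))
  have hm2 := measurable_upT (fun y => ‖f y‖ₑ ^ 2) (hf.enorm.pow_const 2) ((γ * t) ^ 2 / (2 * A))
  have hΦint : ∀ ν : Measure α, ∫⁻ y, Φ y ∂ν =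
      ENNReal.ofReal (2 / t) * ∫⁻ y, upT (fun y => ‖F y‖ₑ) (t / (2 * A)) y ∂ν
      + ENNReal.ofReal (2 / (γ * t) ^ 2) *
        ∫⁻ y, upT (fun y => ‖f y‖ₑ ^ 2) ((γ * t) ^ 2 / (2 * A)) y ∂ν := by
    intro ν
    rw [hΦ, lintegral_add_left (hm1.const_mul _), lintegral_const_mul _ hm1, lintegral_const_mul _ hm2]
  rw [← hΦint μ]
  have hloc : ∀ x ∈ u, μ (E ∩ {y | d x y ≤ 3 * A * r x}) ≤
      ENNReal.ofReal (glL A m * γ ^ 2) * ∫⁻ y in {y | d x y ≤ r x}, Φ y ∂μ := by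
    intro x hx
    have hxE := huE hx
    obtain ⟨hrp, hror⟩ := hr1 x hxE
    have hst : ∀ r', 2 * r x ≤ r' → ∫⁻ z in {z | d x z ≤ r'}, ‖F z‖ₑ ∂μ ≤ ENNReal.ofReal (t * r' ^ m) ∧
       ∫⁻ z in {z | d x z ≤ r'}, ‖f z‖ₑ ^ 2 ∂μ ≤ ENNReal.ofReal ((γ * t) ^ 2 * r' ^ m) := by
      intro r' hr'
      have h1 := hr2 x hxE r' hr'
      have h2 : 0 < r' := by linarith
      by_contra hcon
      apply h1
      refine ⟨h2, ?_⟩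
      by_contra hcon2
      push Not at hcon2
      exact hcon hcon2
    have h3 := h.local hs N f hf hf2 x (r x) t γ hrp (hRle x _ (hr1 x hxE)) ht hγ hγ1
      (hst _ le_rfl).1 (fun R hR => (hst R hR).2)
    refine h3.trans ?_
    have hg : 0 ≤ glL A m * γ ^ 2 := by unfold glL; positivity
    rw [ENNReal.ofReal_mul hg]
    gcongr
    rw [hΦint]
    rcases hror with hh | hh
    · exact (hs.trunc _ x (r x) t hrp ht hh.le hFm.enorm).trans le_self_add
    · exact (hs.trunc _ x (r x) _ hrp (by positivity) hh.le (hf.enorm.pow_const 2)).trans le_add_self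
  haveI := huc.to_subtype
  calc μ E ≤ μ (⋃ x ∈ u, E ∩ {y | d x y ≤ 3 * A * r x}) := by
        apply measure_mono
        intro y hy
        have := hcov hy
        rw [Set.mem_iUnion₂] at this ⊢
        obtain ⟨x, hx, hxy⟩ := this
        exact ⟨x, hx, hy, hxy⟩
    _ ≤ ∑' x : u, μ (E ∩ {y | d x y ≤ 3 * A * r x}) := measure_biUnion_le μ huc _
    _ ≤ ∑' x : u, ENNReal.ofReal (glL A m * γ ^ 2) * ∫⁻ y in {y | d x y ≤ r x}, Φ y ∂μ :=
        ENNReal.tsum_le_tsum fun x => hloc x x.2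
    _ = ENNReal.ofReal (glL A m * γ ^ 2) * ∑' x : u, ∫⁻ y in {y | d x y ≤ r x}, Φ y ∂μ :=
        ENNReal.tsum_mul_left
    _ = ENNReal.ofReal (glL A m * γ ^ 2) * ∫⁻ y in ⋃ x ∈ u, {y | d x y ≤ r x}, Φ y ∂μ := by
        rw [lintegral_biUnion huc (fun x _ => hs.measBall x _) hdis]
    _ ≤ _ := by
        gcongr
        exact Measure.restrict_le_self

end GoodLambda3

end PartNoG

section PartNoH
open MeasureTheory Complex

section GoodLambda4
open scoped ENNReal
variable {α : Type*} [MeasurableSpace α]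
variable {μ : Measure α} {d : α → α → ℝ} {A : ℝ} {m : ℕ} {k : ℕ → α → α → ℂ}

theorem layer (μ : Measure α) (φ : α → ℝ≥0∞) (hφ : Measurable φ) (g : α → ℝ) (hg : Measurable g)
    (hg0 : ∀ y, 0 ≤ g y) (q : ℝ) (hq : 0 < q) :
    ∫⁻ t in Set.Ioi (0:ℝ), (∫⁻ y in {y | t < g y}, φ y ∂μ) * ENNReal.ofReal (t ^ (q - 1))
      = ENNReal.ofReal (1 / q) * ∫⁻ y, φ y * ENNReal.ofReal (g y ^ q) ∂μ := by
  have h := lintegral_rpow_eq_lintegral_meas_lt_mul (μ.withDensity φ) (f := g)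
    (Filter.Eventually.of_forall hg0) hg.aemeasurable hq
  rw [lintegral_withDensity_eq_lintegral_mul _ hφ (hg.pow_const q).ennreal_ofReal] at h
  have e : ∀ t, (μ.withDensity φ) {y | t < g y} = ∫⁻ y in {y | t < g y}, φ y ∂μ := fun t =>
    withDensity_apply _ (measurableSet_lt measurable_const hg)
  simp_rw [e] at h
  simp only [Pi.mul_apply] at h
  rw [h, ← mul_assoc, ← ENNReal.ofReal_mul (by positivity), one_div_mul_cancel hq.ne']
  simp

theorem enorm_rpow_ofReal (z : ℂ) {p : ℝ} (hp : 0 ≤ p) : ENNReal.ofReal (‖z‖ ^ p) = ‖z‖ₑ ^ p := by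
  rw [← ofReal_norm, ENNReal.ofReal_rpow_of_nonneg (norm_nonneg _) hp]

variable [IsFiniteMeasure μ]

theorem KF.integrated (hm : m ≠ 0) (hs : HS μ d A m) (h : KF μ d A m k) (N : ℕ) (f : α → ℂ)
    (hf : Measurable f) (hf2 : MemLp f 2 μ) (p : ℝ) (hp : 2 < p) (γ : ℝ) (hγ : 0 < γ) (hγ1 : γ ≤ 1)
    (t0 : ℝ) (ht0 : 0 ≤ t0)
    (ht1 : ∫⁻ z, ‖TN μ k N f z‖ₑ ∂μ ≤ ENNReal.ofReal t0)
    (ht2 : ∫⁻ z, ‖f z‖ₑ ^ 2 ∂μ ≤ ENNReal.ofReal ((γ * t0) ^ 2)) :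
    ENNReal.ofReal ((1 / gla A m) ^ p) * ∫⁻ y, ‖TN μ k N f y‖ₑ ^ p ∂μ ≤
      μ Set.univ * ENNReal.ofReal (t0 ^ p) + ENNReal.ofReal (glL A m * γ ^ 2 * p) *
      (ENNReal.ofReal (2 * (1 / (p - 1)) * (2 * A) ^ (p - 1)) * ∫⁻ y, ‖TN μ k N f y‖ₑ ^ p ∂μ
      + ENNReal.ofReal (2 / γ ^ 2 * (1 / (p - 2)) * (Real.sqrt (2 * A) / γ) ^ (p - 2)) *
         ∫⁻ y, ‖f y‖ₑ ^ p ∂μ) := by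
  have hA := hs.pos
  have hp0 : 0 < p := by linarith
  set F := TN μ k N f with hF
  have hFm : Measurable F := h.measTN N f hf
  have hglap : 0 < gla A m := by
    unfold gla glM
    positivity
  have hgL : 0 ≤ glL A m := by unfold glL; positivity
  set a := gla A m with ha
  set b := Real.sqrt (2 * A) with hb
  have hb0 : 0 < b := by rw [hb]; positivity
  have hb2 : b ^ 2 = 2 * A := Real.sq_sqrt (by positivity)
  -- left side
  have L := layer μ (fun _ => 1) measurable_const (fun y => 1 / a * ‖F y‖)
    (hFm.norm.const_mul _) (fun y => by positivity) p hp0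
  have L0 := layer μ (fun _ => 1) measurable_const (fun _ => t0) measurable_const (fun y => ht0) p hp0
  have L1 := layer μ (fun y => ‖F y‖ₑ) hFm.enorm (fun y => 2 * A * ‖F y‖)
    (hFm.norm.const_mul _) (fun y => by positivity) (p - 1) (by linarith)
  have L2 := layer μ (fun y => ‖f y‖ₑ ^ 2) (hf.enorm.pow_const 2) (fun y => b / γ * ‖f y‖)
    (hf.norm.const_mul _) (fun y => by positivity) (p - 2) (by linarith)
  have eL : ∫⁻ y, 1 * ENNReal.ofReal ((1 / a * ‖F y‖) ^ p) ∂μ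
      = ENNReal.ofReal ((1 / a) ^ p) * ∫⁻ y, ‖F y‖ₑ ^ p ∂μ := by
    rw [← lintegral_const_mul _ (hFm.enorm.pow_const p)]
    congr 1; ext y
    rw [one_mul, Real.mul_rpow (by positivity) (norm_nonneg _), ENNReal.ofReal_mul (by positivity),
      enorm_rpow_ofReal _ hp0.le]
  have eL0 : ∫⁻ y, 1 * ENNReal.ofReal (t0 ^ p) ∂μ = μ Set.univ * ENNReal.ofReal (t0 ^ p) := by
    simp [mul_comm]
  have eL1 : ∫⁻ y, ‖F y‖ₑ * ENNReal.ofReal ((2 * A * ‖F y‖) ^ (p - 1)) ∂μ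
      = ENNReal.ofReal ((2 * A) ^ (p - 1)) * ∫⁻ y, ‖F y‖ₑ ^ p ∂μ := by
    rw [← lintegral_const_mul _ (hFm.enorm.pow_const p)]
    congr 1; ext y
    rw [Real.mul_rpow (by positivity) (norm_nonneg _), ENNReal.ofReal_mul (by positivity),
      enorm_rpow_ofReal _ (by linarith), mul_left_comm]
    congr 1
    conv_lhs => rw [← ENNReal.rpow_one ‖F y‖ₑ, ← ENNReal.rpow_mul]
    rw [← ENNReal.rpow_add_of_nonneg _ _ (by norm_num) (by linarith)]
    congr 1; ring
  have eL2 : ∫⁻ y, ‖f y‖ₑ ^ 2 * ENNReal.ofReal ((b / γ * ‖f y‖) ^ (p - 2)) ∂μ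
      = ENNReal.ofReal ((b / γ) ^ (p - 2)) * ∫⁻ y, ‖f y‖ₑ ^ p ∂μ := by
    rw [← lintegral_const_mul _ (hf.enorm.pow_const p)]
    congr 1; ext y
    rw [Real.mul_rpow (by positivity) (norm_nonneg _), ENNReal.ofReal_mul (by positivity),
      enorm_rpow_ofReal _ (by linarith), mul_left_comm]
    congr 1
    rw [← ENNReal.rpow_natCast, ← ENNReal.rpow_add_of_nonneg _ _ (by norm_num) (by linarith)]
    congr 1; push_cast; ring
  rw [eL] at L
  rw [eL0] at L0
  rw [eL1] at L1
  rw [eL2] at L2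
  set ga := ENNReal.ofReal (glL A m * γ ^ 2) with hga
  -- pointwise estimate
  have pt : ∀ t ∈ Set.Ioi (0:ℝ), (∫⁻ y in {y | t < 1 / a * ‖F y‖}, 1 ∂μ) * ENNReal.ofReal (t ^ (p - 1))
      ≤ (∫⁻ y in {y : α | t < t0}, 1 ∂μ) * ENNReal.ofReal (t ^ (p - 1)) + ga *
        (ENNReal.ofReal 2 * ((∫⁻ y in {y | t < 2 * A * ‖F y‖}, ‖F y‖ₑ ∂μ) * ENNReal.ofReal (t ^ (p - 1 - 1)))
         + ENNReal.ofReal (2 / γ ^ 2) *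
          ((∫⁻ y in {y | t < b / γ * ‖f y‖}, ‖f y‖ₑ ^ 2 ∂μ) * ENNReal.ofReal (t ^ (p - 2 - 1)))) := by
    intro t ht
    have htp : 0 < t := ht
    by_cases htt : t < t0
    · refine le_trans ?_ le_self_add
      refine mul_le_mul_left (lintegral_mono_set (fun y _ => ?_)) _
      exact htt
    · push Not at htt
      refine le_trans ?_ le_add_self
      have g := h.good_lambda hm hs N f hf hf2 t γ htp hγ hγ1
        (ht1.trans (ENNReal.ofReal_le_ofReal htt)) (ht2.trans (ENNReal.ofReal_le_ofReal (by gcongr)))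
      have i1 : ∫⁻ y, upT (fun y => ‖TN μ k N f y‖ₑ) (t / (2 * A)) y ∂μ
          ≤ ∫⁻ y in {y | t < 2 * A * ‖F y‖}, ‖F y‖ₑ ∂μ := by
        rw [← lintegral_indicator (measurableSet_lt measurable_const (hFm.norm.const_mul _))]
        gcongr with y
        unfold upT
        apply Set.indicator_le_indicator_of_subset
        · intro y hy
          have hy' : ENNReal.ofReal (t / (2 * A)) < ‖F y‖ₑ := hy
          rw [← ofReal_norm, ENNReal.ofReal_lt_ofReal_iff_of_nonneg (by positivity),
            div_lt_iff₀ (by positivity)] at hy'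
          change t < 2 * A * ‖F y‖
          linarith
        · intro; exact zero_le
      have i2 : ∫⁻ y, upT (fun y => ‖f y‖ₑ ^ 2) ((γ * t) ^ 2 / (2 * A)) y ∂μ
          ≤ ∫⁻ y in {y | t < b / γ * ‖f y‖}, ‖f y‖ₑ ^ 2 ∂μ := by
        rw [← lintegral_indicator (measurableSet_lt measurable_const (hf.norm.const_mul _))]
        gcongr with y
        unfold upT
        apply Set.indicator_le_indicator_of_subset
        · intro y hy
          have hy' : ENNReal.ofReal ((γ * t) ^ 2 / (2 * A)) < ‖f y‖ₑ ^ 2 := hy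
          rw [← ofReal_norm, ← ENNReal.ofReal_pow (norm_nonneg _),
            ENNReal.ofReal_lt_ofReal_iff_of_nonneg (by positivity),
            div_lt_iff₀ (by positivity), ← hb2, ← mul_pow] at hy'
          have h5 := lt_of_pow_lt_pow_left₀ 2 (by positivity) hy'
          change t < b / γ * ‖f y‖
          rw [div_mul_eq_mul_div, lt_div_iff₀ hγ]
          linarith
        · intro; exact zero_le
      have hset : ∫⁻ y in {y | t < 1 / a * ‖F y‖}, 1 ∂μ = μ {y | a * t < ‖F y‖} := by
        rw [setLIntegral_one]
        congr 1; ext y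
        change t < 1 / a * ‖F y‖ ↔ a * t < ‖F y‖
        rw [one_div, ← div_eq_inv_mul, lt_div_iff₀ hglap, mul_comm]
      rw [hset]
      have r1 : ENNReal.ofReal (2 / t) * ENNReal.ofReal (t ^ (p - 1))
          = ENNReal.ofReal 2 * ENNReal.ofReal (t ^ (p - 1 - 1)) := by
        rw [← ENNReal.ofReal_mul (by positivity), ← ENNReal.ofReal_mul (by positivity),
          Real.rpow_sub_one htp.ne' (p - 1)]
        congr 1; ring
      have r2 : ENNReal.ofReal (2 / (γ * t) ^ 2) * ENNReal.ofReal (t ^ (p - 1))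
          = ENNReal.ofReal (2 / γ ^ 2) * ENNReal.ofReal (t ^ (p - 2 - 1)) := by
        rw [← ENNReal.ofReal_mul (by positivity), ← ENNReal.ofReal_mul (by positivity)]
        have : p - 2 - 1 = (p - 1) - 1 - 1 := by ring
        rw [this, Real.rpow_sub_one htp.ne' (p - 1 - 1), Real.rpow_sub_one htp.ne' (p - 1)]
        congr 1; field_simp
      calc _ ≤ ga * (ENNReal.ofReal (2 / t) * (∫⁻ y in {y | t < 2 * A * ‖F y‖}, ‖F y‖ₑ ∂μ)
            + ENNReal.ofReal (2 / (γ * t) ^ 2) *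
              (∫⁻ y in {y | t < b / γ * ‖f y‖}, ‖f y‖ₑ ^ 2 ∂μ)) * ENNReal.ofReal (t ^ (p - 1)) := by
            gcongr
            refine g.trans ?_
            gcongr
        _ = ga * ((ENNReal.ofReal (2 / t) * ENNReal.ofReal (t ^ (p - 1))) *
              (∫⁻ y in {y | t < 2 * A * ‖F y‖}, ‖F y‖ₑ ∂μ)
            + (ENNReal.ofReal (2 / (γ * t) ^ 2) * ENNReal.ofReal (t ^ (p - 1))) *
              (∫⁻ y in {y | t < b / γ * ‖f y‖}, ‖f y‖ₑ ^ 2 ∂μ)) := by ring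
        _ = _ := by rw [r1, r2]; ring
  have hmono : ∀ (φ : α → ℝ≥0∞) (g : α → ℝ) (q : ℝ), Measurable (fun t : ℝ =>
      (∫⁻ y in {y | t < g y}, φ y ∂μ) * ENNReal.ofReal (t ^ q)) := by
    intro φ g q
    apply Measurable.mul
    · apply Antitone.measurable
      intro s t hst
      apply lintegral_mono_set
      intro y hy
      exact lt_of_le_of_lt hst hy
    · exact (measurable_id.pow_const q).ennreal_ofReal
  have key := setLIntegral_mono' (μ := volume) measurableSet_Ioi pt
  rw [lintegral_add_left (hmono _ _ _), lintegral_const_mul, lintegral_add_left, lintegral_const_mul,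
    lintegral_const_mul, L, L0, L1, L2] at key
  · have k2 : ENNReal.ofReal p * (ENNReal.ofReal (1 / p) * (ENNReal.ofReal ((1 / a) ^ p) * ∫⁻ y, ‖F y‖ₑ ^ p ∂μ))
        = ENNReal.ofReal ((1 / a) ^ p) * ∫⁻ y, ‖F y‖ₑ ^ p ∂μ := by
      rw [← mul_assoc, ← ENNReal.ofReal_mul (by positivity), mul_one_div_cancel hp0.ne']
      simp
    rw [← k2]
    refine (mul_le_mul_right key (ENNReal.ofReal p)).trans (le_of_eq ?_)
    rw [mul_add]
    congr 1
    · rw [← mul_assoc, ← ENNReal.ofReal_mul (by positivity), mul_one_div_cancel hp0.ne']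
      simp
    · have hp1 : 0 < p - 1 := by linarith
      have hp2 : 0 < p - 2 := by linarith
      rw [hga, ENNReal.ofReal_mul (p := glL A m * γ ^ 2) (by positivity),
        ENNReal.ofReal_mul (p := 2 * (1 / (p - 1))) (by positivity),
        ENNReal.ofReal_mul (p := 2) (by positivity),
        ENNReal.ofReal_mul (p := 2 / γ ^ 2 * (1 / (p - 2))) (by positivity),
        ENNReal.ofReal_mul (p := 2 / γ ^ 2) (by positivity)]
      ring
  · exact hmono _ _ _
  · exact hmono _ _ _
  · exact (hmono _ _ _).const_mul _
  · exact ((hmono _ _ _).const_mul _).add ((hmono _ _ _).const_mul _)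

end GoodLambda4

end PartNoH

section PartNoI
open MeasureTheory Complex

section LpTheory
open scoped ENNReal
variable {α : Type*} [MeasurableSpace α]
variable {μ : Measure α} {d : α → α → ℝ} {A : ℝ} {m : ℕ} {k : ℕ → α → α → ℂ}

theorem TN_congr (k : ℕ → α → α → ℂ) (N : ℕ) {f g : α → ℂ} (h : f =ᵐ[μ] g) : TN μ k N f = TN μ k N g := by
  ext x
  unfold TN
  apply integral_congr_ae
  filter_upwards [h] with y hy
  rw [hy]

theorem lint_rpow_eq (f : α → ℂ) {p : ℝ} (hp : 1 < p) :
    ∫⁻ x, ‖f x‖ₑ ^ p ∂μ = eLpNorm f (ENNReal.ofReal p) μ ^ p := by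
  rw [eLpNorm_ofReal_eq f hp, ← ENNReal.rpow_mul]
  simp [(by linarith : p ≠ 0)]

variable [IsFiniteMeasure μ]

theorem KF.eLpTN (h : KF μ d A m k) (N : ℕ) {f : α → ℂ} {p : ℝ} (hp : 1 < p)
    (hf : MemLp f (ENNReal.ofReal p) μ) : MemLp (TN μ k N f) (ENNReal.ofReal p) μ := by
  refine ⟨(h.bkS N).aesm hf.1, ?_⟩
  refine ((h.bkS N).eLp hf.1 hp).trans_lt ?_
  exact ENNReal.mul_lt_top ENNReal.ofReal_lt_top hf.2

set_option maxHeartbeats 1000000 in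
theorem KF.Lp_gt (hm : m ≠ 0) (hs : HS μ d A m) (h : KF μ d A m k) (p : ℝ) (hp : 2 < p) :
    ∃ C : ℝ, 0 ≤ C ∧ ∀ N f, MemLp f (ENNReal.ofReal p) μ →
      eLpNorm (TN μ k N f) (ENNReal.ofReal p) μ ≤ ENNReal.ofReal C * eLpNorm f (ENNReal.ofReal p) μ := by
  have hA := hs.pos
  have hglap : 0 < gla A m := by
    unfold gla glM
    positivity
  have hgL : 0 ≤ glL A m := by unfold glL; positivity
  have hl2 : 0 < l2C A m := l2C_pos hA
  have hp0 : 0 < p := by linarith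
  have hp1 : 0 < p - 1 := by linarith
  have hp2 : 0 < p - 2 := by linarith
  set a' := (1 / gla A m) ^ p with ha'
  have ha'0 : 0 < a' := by positivity
  set Q := glL A m * p * (2 * (1 / (p - 1)) * (2 * A) ^ (p - 1)) with hQ
  have hQ0 : 0 ≤ Q := by positivity
  obtain ⟨γ, hγ, hγ1, hγQ⟩ : ∃ γ : ℝ, 0 < γ ∧ γ ≤ 1 ∧ γ * Q ≤ a' / 2 := by
    refine ⟨min 1 (a' / (2 * (Q + 1))), by positivity, min_le_left _ _, ?_⟩
    calc _ ≤ a' / (2 * (Q + 1)) * Q := by gcongr; exact min_le_right _ _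
      _ ≤ a' / (2 * (Q + 1)) * (Q + 1) := by gcongr; linarith
      _ = _ := by field_simp
  set V := μ.real Set.univ with hV
  have hV0 : 0 ≤ V := measureReal_nonneg
  have hVe : μ Set.univ = ENNReal.ofReal V := by simp [hV, measureReal_def]
  set W := V ^ (1 / 2 - 1 / p) with hW
  have hex : 0 ≤ 1 / 2 - 1 / p := by
    rw [sub_nonneg]; exact one_div_le_one_div_of_le (by norm_num) hp.le
  have hW0 : 0 ≤ W := by positivity
  set T := (l2C A m * V ^ ((1:ℝ)/2) + 1 / γ) * W with hT
  have hT0 : 0 ≤ T := by positivity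
  set β := glL A m * γ ^ 2 * p * (2 * (1 / (p - 1)) * (2 * A) ^ (p - 1)) with hβ
  set β' := glL A m * γ ^ 2 * p * (2 / γ ^ 2 * (1 / (p - 2)) * (Real.sqrt (2 * A) / γ) ^ (p - 2)) with hβ'
  have hβ0 : 0 ≤ β := by positivity
  have hβ'0 : 0 ≤ β' := by positivity
  have hβa : β ≤ a' / 2 := by
    refine le_trans ?_ hγQ
    have : β = γ ^ 2 * Q := by rw [hβ, hQ]; ring
    rw [this]
    gcongr
    nlinarith
  set C0 := 2 / a' * (V * T ^ p + β') with hC0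
  have hC00 : 0 ≤ C0 := by positivity
  refine ⟨C0 ^ (1 / p), by positivity, ?_⟩
  have main : ∀ N f, Measurable f → MemLp f (ENNReal.ofReal p) μ →
      eLpNorm (TN μ k N f) (ENNReal.ofReal p) μ ≤
        ENNReal.ofReal (C0 ^ (1/p)) * eLpNorm f (ENNReal.ofReal p) μ := by
    intro N f hf hfp
    have hf2 : MemLp f 2 μ := hfp.mono_exponent (by
      rw [← ofReal_two]; exact ENNReal.ofReal_le_ofReal hp.le)
    set s := (eLpNorm f (ENNReal.ofReal p) μ).toReal with hsdef
    have hse : eLpNorm f (ENNReal.ofReal p) μ = ENNReal.ofReal s :=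
      (ENNReal.ofReal_toReal hfp.2.ne).symm
    have hs0 : 0 ≤ s := ENNReal.toReal_nonneg
    have e2 : eLpNorm f 2 μ ≤ ENNReal.ofReal (W * s) := by
      have := eLpNorm_le_eLpNorm_mul_rpow_measure_univ (p := 2) (q := ENNReal.ofReal p)
        (by rw [← ofReal_two]; exact ENNReal.ofReal_le_ofReal hp.le) hf.aestronglyMeasurable (μ := μ)
      rw [hse, hVe, ENNReal.toReal_ofReal hp0.le, ENNReal.ofReal_rpow_of_nonneg hV0 (by simpa using hex),
        ← ENNReal.ofReal_mul hs0] at this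
      rw [mul_comm W]
      simpa [hW] using this
    have eF : ∫⁻ z, ‖TN μ k N f z‖ₑ ∂μ ≤ ENNReal.ofReal (T * s) := by
      have h1 : ∫⁻ z, ‖TN μ k N f z‖ₑ ∂μ = eLpNorm (TN μ k N f) 1 μ :=
        eLpNorm_one_eq_lintegral_enorm.symm
      have := eLpNorm_le_eLpNorm_mul_rpow_measure_univ (p := 1) (q := 2)
        (by norm_num) (h.measTN N f hf).aestronglyMeasurable (μ := μ)
      rw [h1]
      refine this.trans ?_
      have h3 := (h.L2bound hs N f hf2).trans (mul_le_mul_right e2 _)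
      refine (mul_le_mul_left h3 _).trans ?_
      rw [hVe, ENNReal.ofReal_rpow_of_nonneg hV0 (by norm_num),
        ← ENNReal.ofReal_mul hl2.le, ← ENNReal.ofReal_mul (by positivity)]
      apply ENNReal.ofReal_le_ofReal
      norm_num
      rw [hT]
      have : 0 ≤ 1 / γ * W * s := by positivity
      norm_num at this ⊢
      nlinarith
    have eG : ∫⁻ z, ‖f z‖ₑ ^ 2 ∂μ ≤ ENNReal.ofReal ((γ * (T * s)) ^ 2) := by
      rw [← eLpNorm_two_sq, ENNReal.ofReal_pow (by positivity)]
      gcongr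
      refine e2.trans (ENNReal.ofReal_le_ofReal ?_)
      have : γ * (T * s) = W * s + γ * l2C A m * V ^ ((1:ℝ)/2) * W * s := by
        rw [hT]; field_simp; ring
      rw [this]
      have : 0 ≤ γ * l2C A m * V ^ ((1:ℝ)/2) * W * s := by positivity
      linarith
    have key := h.integrated hm hs N f hf hf2 p hp γ hγ hγ1 (T * s) (by positivity) eF eG
    have hFp := h.eLpTN N (by linarith) hfp
    set I := (eLpNorm (TN μ k N f) (ENNReal.ofReal p) μ).toReal with hI
    have hIe : eLpNorm (TN μ k N f) (ENNReal.ofReal p) μ = ENNReal.ofReal I :=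
      (ENNReal.ofReal_toReal hFp.2.ne).symm
    have hI0 : 0 ≤ I := ENNReal.toReal_nonneg
    rw [lint_rpow_eq _ (by linarith), lint_rpow_eq _ (by linarith), hIe, hse, hVe,
      ENNReal.ofReal_rpow_of_nonneg hI0 hp0.le, ENNReal.ofReal_rpow_of_nonneg hs0 hp0.le,
      ← ENNReal.ofReal_mul (by positivity), ← ENNReal.ofReal_mul (by positivity),
      ← ENNReal.ofReal_mul (by positivity), ← ENNReal.ofReal_mul (by positivity),
      ← ENNReal.ofReal_add (by positivity) (by positivity), ← ENNReal.ofReal_mul (by positivity),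
      ← ENNReal.ofReal_add (by positivity) (by positivity),
      ENNReal.ofReal_le_ofReal_iff (by positivity), Real.mul_rpow hT0 hs0] at key
    rw [hIe, hse, ← ENNReal.ofReal_mul (by positivity)]
    apply ENNReal.ofReal_le_ofReal
    have k2 : a' * I ^ p ≤ V * T ^ p * s ^ p + β * I ^ p + β' * s ^ p := by
      refine key.trans (le_of_eq ?_)
      rw [hβ, hβ']; ring
    have hIp : 0 ≤ I ^ p := by positivity
    have k3 : I ^ p ≤ C0 * s ^ p := by
      have : a' / 2 * I ^ p ≤ (V * T ^ p + β') * s ^ p := by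
        have h5 := mul_le_mul_of_nonneg_right hβa hIp
        linarith
      rw [hC0]
      calc I ^ p = 2 / a' * (a' / 2 * I ^ p) := by field_simp
        _ ≤ 2 / a' * ((V * T ^ p + β') * s ^ p) := by gcongr
        _ = _ := by ring
    calc I = (I ^ p) ^ (1 / p) := by rw [← Real.rpow_mul hI0]; simp [hp0.ne']
      _ ≤ (C0 * s ^ p) ^ (1 / p) := by gcongr
      _ = _ := by rw [Real.mul_rpow hC00 (by positivity), ← Real.rpow_mul hs0]; simp [hp0.ne']
  intro N f hf
  obtain ⟨g, hgm, hae⟩ := hf.1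
  rw [TN_congr k N hae, eLpNorm_congr_ae hae]
  exact main N _ hgm.measurable ((memLp_congr_ae hae).1 hf)

theorem KF.Lp_lt (hm : m ≠ 0) (hs : HS μ d A m) (h : KF μ d A m k) (p : ℝ) (hp : 1 < p) (hp2 : p < 2) :
    ∃ C : ℝ, 0 ≤ C ∧ ∀ N f, MemLp f (ENNReal.ofReal p) μ →
      eLpNorm (TN μ k N f) (ENNReal.ofReal p) μ ≤ ENNReal.ofReal C * eLpNorm f (ENNReal.ofReal p) μ := by
  have hpq := Real.HolderConjugate.conjExponent hp
  set q := p.conjExponent with hq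
  have hp0 : 0 < p := by linarith
  have hq2 : 2 < q := by
    rw [hq, Real.conjExponent, lt_div_iff₀ (by linarith)]; linarith
  obtain ⟨C, hC, hb⟩ := (h.transpose hs).Lp_gt hm hs q hq2
  refine ⟨C, hC, fun N f hf => ?_⟩
  set F := TN μ k N f with hF
  have hFp : MemLp F (ENNReal.ofReal p) μ := h.eLpTN N hp hf
  set H : α → ℂ := fun x => (starRingEnd ℂ) (F x) * ((‖F x‖ ^ (p - 2) : ℝ) : ℂ) with hH
  have hHn : ∀ x, ‖H x‖ = ‖F x‖ ^ (p - 1) := by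
    intro x
    rw [hH]
    simp only [norm_mul, RCLike.norm_conj, Complex.norm_real]
    rw [Real.norm_of_nonneg (by positivity)]
    rcases eq_or_lt_of_le (norm_nonneg (F x)) with h0 | h0
    · rw [← h0, Real.zero_rpow (by linarith : p - 1 ≠ 0)]; simp
    · rw [show p - 1 = 1 + (p - 2) by ring, Real.rpow_add h0, Real.rpow_one]
  have hFH : ∀ x, F x * H x = ((‖F x‖ ^ p : ℝ) : ℂ) := by
    intro x
    rw [hH]
    simp only
    rw [← mul_assoc, Complex.mul_conj, Complex.normSq_eq_norm_sq, ← Complex.ofReal_mul]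
    congr 1
    rcases eq_or_lt_of_le (norm_nonneg (F x)) with h0 | h0
    · rw [← h0, Real.zero_rpow hp0.ne']; simp
    · rw [show p = 2 + (p - 2) by ring, Real.rpow_add h0]; simp
  have hHm : AEStronglyMeasurable H μ := by
    have hFm := hFp.1
    apply AEStronglyMeasurable.mul
    · exact Complex.continuous_conj.comp_aestronglyMeasurable hFm
    · exact (Complex.measurable_ofReal.comp_aemeasurable
        (hFm.norm.aemeasurable.pow_const (p - 2))).aestronglyMeasurable
  have hHq : ∀ x, ‖H x‖ₑ ^ q = ‖F x‖ₑ ^ p := by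
    intro x
    rw [← enorm_rpow_ofReal _ (by linarith), hHn, ← Real.rpow_mul (norm_nonneg _), hpq.sub_one_mul_conj,
      enorm_rpow_ofReal _ hp0.le]
  have hI : ∫⁻ x, ‖H x‖ₑ ^ q ∂μ = ∫⁻ x, ‖F x‖ₑ ^ p ∂μ := by simp_rw [hHq]
  have hIf : ∫⁻ x, ‖F x‖ₑ ^ p ∂μ ≠ ⊤ := by
    rw [lint_rpow_eq _ hp]
    exact (ENNReal.rpow_lt_top_of_nonneg hp0.le hFp.2.ne).ne
  have hHLp : MemLp H (ENNReal.ofReal q) μ := by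
    refine ⟨hHm, ?_⟩
    rw [eLpNorm_ofReal_eq _ (by linarith), hI]
    exact ENNReal.rpow_lt_top_of_nonneg (by have : 0 < q := by linarith
                                            positivity) hIf
  have hfi : Integrable f μ := hf.integrable (by simpa using hp.le)
  have hHi : Integrable H μ := hHLp.integrable (by simp; linarith)
  have B := h.bkS N
  have fub : ∫ x, F x * H x ∂μ = ∫ y, TN μ (fun i x y => k i y x) N H y * f y ∂μ := by
    have hintg : Integrable (fun z : α × α => KS k N z.1 z.2 * (H z.1 * f z.2)) (μ.prod μ) :=
      (hHi.mul_prod hfi).bdd_mul (c := _) B.meas.aestronglyMeasurable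
        (Filter.Eventually.of_forall (fun z => B.bdd z.1 z.2))
    have := integral_integral_swap (f := fun x y => KS k N x y * (H x * f y)) hintg
    have e1 : ∀ x, F x * H x = ∫ y, KS k N x y * (H x * f y) ∂μ := by
      intro x
      rw [hF]; unfold TN
      rw [← integral_mul_const]
      congr 1; ext y; ring
    have e2 : ∀ y, TN μ (fun i x y => k i y x) N H y * f y = ∫ x, KS k N x y * (H x * f y) ∂μ := by
      intro y
      unfold TN
      rw [← integral_mul_const]
      congr 1; ext x; unfold KS; ring
    simp_rw [e1, e2]; exact this
  have hI2 : ∫⁻ x, ‖F x‖ₑ ^ p ∂μ = ‖∫ x, F x * H x ∂μ‖ₑ := by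
    simp_rw [hFH]
    rw [integral_complex_ofReal, ← ofReal_norm, Complex.norm_real, Real.norm_of_nonneg (integral_nonneg (fun x => by positivity)),
      ofReal_integral_eq_lintegral_ofReal]
    · simp_rw [enorm_rpow_ofReal _ hp0.le]
    · have := hFp.integrable_norm_rpow (by simpa using hp0) (by simp)
      rwa [ENNReal.toReal_ofReal hp0.le] at this
    · exact Filter.Eventually.of_forall (fun x => by positivity)
  have step : ∫⁻ x, ‖F x‖ₑ ^ p ∂μ ≤ eLpNorm f (ENNReal.ofReal p) μ *
      (ENNReal.ofReal C * eLpNorm H (ENNReal.ofReal q) μ) := by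
    rw [hI2, fub]
    refine (enorm_integral_le_lintegral_enorm _).trans ?_
    have hT := (h.transpose hs).eLpTN N (by linarith) hHLp
    have := ENNReal.lintegral_mul_le_Lp_mul_Lq μ hpq hf.1.enorm hT.1.enorm
    rw [← eLpNorm_ofReal_eq f hp, ← eLpNorm_ofReal_eq _ (by linarith)] at this
    calc _ = ∫⁻ y, ‖f y‖ₑ * ‖TN μ (fun i x y => k i y x) N H y‖ₑ ∂μ := by
          congr 1; ext y; rw [enorm_mul, mul_comm]
      _ ≤ _ := this
      _ ≤ _ := by gcongr; exact hb N H hHLp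
  rw [eLpNorm_ofReal_eq H (by linarith), hI] at step
  rw [eLpNorm_ofReal_eq F hp]
  set I := ∫⁻ x, ‖F x‖ₑ ^ p ∂μ with hIdef
  rcases eq_or_ne I 0 with h0 | h0
  · rw [h0, ENNReal.zero_rpow_of_pos (by positivity)]; simp
  have hq0 : 0 < q := by linarith
  have e : I = I ^ (1 / p) * I ^ (1 / q) := by
    rw [← ENNReal.rpow_add _ _ h0 hIf, one_div, one_div, hpq.inv_add_inv_eq_one, ENNReal.rpow_one]
  have hIq0 : I ^ (1 / q) ≠ 0 := by
    simp [h0, hIf]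
  have hIqt : I ^ (1 / q) ≠ ⊤ := (ENNReal.rpow_lt_top_of_nonneg (by positivity) hIf).ne
  rw [← ENNReal.mul_le_mul_iff_left hIq0 hIqt, ← e]
  refine step.trans (le_of_eq ?_)
  ring

theorem KF.Lp_bound (hm : m ≠ 0) (hs : HS μ d A m) (h : KF μ d A m k) (p : ℝ) (hp : 1 < p) :
    ∃ C : ℝ, 0 ≤ C ∧ ∀ N f, MemLp f (ENNReal.ofReal p) μ →
      eLpNorm (TN μ k N f) (ENNReal.ofReal p) μ ≤ ENNReal.ofReal C * eLpNorm f (ENNReal.ofReal p) μ := by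
  rcases lt_trichotomy p 2 with h1 | h1 | h1
  · exact h.Lp_lt hm hs p hp h1
  · subst h1
    refine ⟨l2C A m, (l2C_pos hs.pos).le, fun N f hf => ?_⟩
    rw [ofReal_two] at *
    exact h.L2bound hs N f hf
  · exact h.Lp_gt hm hs p h1

end LpTheory

end PartNoI

section PartNoJ
open MeasureTheory Complex

section KernelPieces

/-- The primitive of the kernel in the imaginary direction. -/
theorem exists_lam0 (q : ℕ) : ∃ (Λ : ℂ → ℂ) (b : ℂ),
    (∀ ζ, ζ ≠ 0 → ContDiffAt ℝ 2 Λ ζ) ∧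
    (∀ ζ, ζ ≠ 0 → 4 ^ q * Λ (4 * ζ) - Λ ζ = b) ∧
    (∀ ζ, ζ ≠ 0 → ‖fderiv ℝ Λ ζ I - (ζ ^ (q + 1))⁻¹‖ ≤ if q = 0 then |ζ.re| / ‖ζ‖ ^ 2 else 0) := by
  rcases Nat.eq_zero_or_pos q with h0 | h0
  · subst h0
    have hns : ∀ ζ : ℂ, ζ ≠ 0 → normSq ζ ≠ 0 := fun ζ h => by simpa using h
    have hnsf : ∀ ζ : ℂ, HasFDerivAt (fun ζ : ℂ => ζ.re * ζ.re + ζ.im * ζ.im)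
        (ζ.re • reCLM + ζ.re • reCLM + (ζ.im • imCLM + ζ.im • imCLM)) ζ := fun ζ => by
      have h1 : HasFDerivAt (fun ζ : ℂ => ζ.re) reCLM ζ := reCLM.hasFDerivAt
      have h2 : HasFDerivAt (fun ζ : ℂ => ζ.im) imCLM ζ := imCLM.hasFDerivAt
      exact (h1.mul h1).add (h2.mul h2)
    refine ⟨fun ζ => (-I / 2) * ((Real.log (ζ.re * ζ.re + ζ.im * ζ.im) : ℝ) : ℂ), (-I / 2) * Real.log 16, ?_, ?_, ?_⟩
    · intro ζ hζ
      apply ContDiffAt.mul contDiffAt_const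
      have h1 : ContDiffAt ℝ 2 (fun ζ : ℂ => Real.log (ζ.re * ζ.re + ζ.im * ζ.im)) ζ := by
        apply ContDiffAt.log
        · have h1 : ContDiffAt ℝ 2 (fun ζ : ℂ => ζ.re) ζ := reCLM.contDiff.contDiffAt
          have h2 : ContDiffAt ℝ 2 (fun ζ : ℂ => ζ.im) ζ := imCLM.contDiff.contDiffAt
          exact (h1.mul h1).add (h2.mul h2)
        · have := hns ζ hζ; rwa [normSq_apply] at this
      exact ofRealCLM.contDiff.contDiffAt.comp ζ h1
    · intro ζ hζ
      have := hns ζ hζ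
      rw [normSq_apply] at this
      have e : (4 * ζ).re * (4 * ζ).re + (4 * ζ).im * (4 * ζ).im = 16 * (ζ.re * ζ.re + ζ.im * ζ.im) := by
        simp; ring
      simp only [pow_zero, one_mul]
      rw [e, Real.log_mul (by norm_num) this]
      push_cast; ring
    · intro ζ hζ
      have hne := hns ζ hζ
      have hne' := hne
      rw [normSq_apply] at hne
      have h1 := (((hnsf ζ).log hne))
      have h2 := (ofRealCLM.hasFDerivAt.comp ζ h1).const_mul (-I / 2)
      have h3 : fderiv ℝ (fun ζ : ℂ => (-I / 2) * ((Real.log (ζ.re * ζ.re + ζ.im * ζ.im) : ℝ) : ℂ)) ζ = _ := h2.fderiv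
      rw [h3]
      simp only [if_true]
      have hnorm : ‖ζ‖ ^ 2 = ζ.re * ζ.re + ζ.im * ζ.im := by rw [← normSq_eq_norm_sq, normSq_apply]
      have e : (((-I / 2) • (ofRealCLM ∘L ((ζ.re * ζ.re + ζ.im * ζ.im)⁻¹ • (ζ.re • reCLM + ζ.re • reCLM + (ζ.im • imCLM + ζ.im • imCLM))))) : ℂ →L[ℝ] ℂ) I
          - (ζ ^ (0 + 1))⁻¹ = ((-(ζ.re / ‖ζ‖ ^ 2) : ℝ) : ℂ) := by
        have hz : (ζ ^ (0 + 1))⁻¹ = (starRingEnd ℂ) ζ * ((ζ.re * ζ.re + ζ.im * ζ.im : ℝ) : ℂ)⁻¹ := by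
          rw [zero_add, pow_one, inv_def, normSq_apply]
          push_cast; rfl
        rw [hz, hnorm]
        apply Complex.ext
        · simp [← Complex.ofReal_mul, ← Complex.ofReal_add, ← Complex.ofReal_inv]
          rw [div_eq_mul_inv]
        · simp [← Complex.ofReal_mul, ← Complex.ofReal_add, ← Complex.ofReal_inv]
          ring
      rw [e, Complex.norm_real, norm_neg, Real.norm_eq_abs, abs_div, abs_of_nonneg (by positivity : 0 ≤ ‖ζ‖ ^ 2)]
  · have hq : (q : ℂ) ≠ 0 := by exact_mod_cast h0.ne'
    refine ⟨fun ζ => (ζ ^ q)⁻¹ * (-(q * I))⁻¹, 0, ?_, ?_, ?_⟩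
    · intro ζ hζ
      have : ContDiffAt ℂ 2 (fun ζ : ℂ => (ζ ^ q)⁻¹ * (-(q * I))⁻¹) ζ :=
        ((contDiffAt_id.pow q).inv (by simpa using fun h => absurd h hζ)).mul contDiffAt_const
      exact this.restrict_scalars ℝ
    · intro ζ hζ
      beta_reduce
      rw [mul_pow]
      field_simp
      simp
    · intro ζ hζ
      have h1 := (((hasDerivAt_pow q ζ).inv (pow_ne_zero _ hζ)).mul_const (-(q * I))⁻¹)
      have h2 := (h1.hasFDerivAt.restrictScalars ℝ).fderiv
      simp only [h0.ne', if_false]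
      have h3 : fderiv ℝ (fun ζ : ℂ => (ζ ^ q)⁻¹ * (-(q * I))⁻¹) ζ = _ := h2
      rw [h3]
      apply le_of_eq
      rw [norm_eq_zero]
      simp
      obtain ⟨r, rfl⟩ : ∃ r, q = r + 1 := ⟨q - 1, by omega⟩
      have : I ^ 2 = -1 := I_sq
      simp only [Nat.add_sub_cancel]
      have hq' : ((r:ℂ) + 1) ≠ 0 := by exact_mod_cast hq
      push_cast
      field_simp
      ring_nf
      rw [this]; ring

theorem sum4 (q N : ℕ) : ∑ i ∈ Finset.range N, ((4:ℝ) ^ i) ^ (q + 1) ≤ (4 ^ N) ^ (q + 1) := by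
  induction N with
  | zero => simp
  | succ N ih =>
    rw [Finset.sum_range_succ]
    have : ((4:ℝ) ^ (N + 1)) ^ (q + 1) = 4 ^ (q + 1) * (4 ^ N) ^ (q + 1) := by
      rw [← mul_pow, ← pow_succ']
    rw [this]
    have h4 : (2:ℝ) ≤ 4 ^ (q + 1) := by
      calc (2:ℝ) ≤ 4 ^ 1 := by norm_num
        _ ≤ 4 ^ (q + 1) := pow_le_pow_right₀ (by norm_num) (by omega)
    have : 0 < ((4:ℝ) ^ N) ^ (q + 1) := by positivity
    nlinarith

/-- The dyadic kernel pieces. -/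
structure KP (q : ℕ) (C : ℝ) (κ Γ : ℂ → ℂ) : Prop where
  one_le : 1 ≤ C
  Gb : ∀ ζ, ‖Γ ζ‖ ≤ C
  Gs : ∀ ζ, 1 < ‖ζ‖ → Γ ζ = 0
  Gc : Continuous Γ
  kb : ∀ ζ, ‖κ ζ‖ ≤ C
  ks : ∀ ζ, 1 < ‖ζ‖ → κ ζ = 0
  kc : Continuous κ
  kl : ∀ ζ ξ, ‖κ ζ - κ ξ‖ ≤ C * ‖ζ - ξ‖
  tay : ∀ ζ e (h : ℝ), |h| ≤ 1 → ‖Γ (ζ + (h * I + e)) - Γ ζ - h * κ ζ‖ ≤ C * (‖e‖ + h ^ 2)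
  sum : ∀ (N : ℕ) ζ, 1 ≤ 4 ^ N * ‖ζ‖ →
    ‖∑ i ∈ Finset.range N, ((4:ℂ) ^ i) ^ (q + 1) * κ (4 ^ i * ζ) - (ζ ^ (q + 1))⁻¹‖
      ≤ C + if q = 0 then |ζ.re| / ‖ζ‖ ^ 2 else 0
  sumb : ∀ (N : ℕ) ζ, ‖∑ i ∈ Finset.range N, ((4:ℂ) ^ i) ^ (q + 1) * κ (4 ^ i * ζ)‖
      ≤ C * (4 ^ N) ^ (q + 1)

theorem cs_bounds (Γ : ℂ → ℂ) (hΓs : ContDiff ℝ 2 Γ) (hΓcs : HasCompactSupport Γ) :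
    ∃ C1 C2 C3 : ℝ, 0 ≤ C1 ∧ 0 ≤ C2 ∧ 0 ≤ C3 ∧ (∀ ζ, ‖Γ ζ‖ ≤ C1) ∧ (∀ ζ, ‖fderiv ℝ Γ ζ‖ ≤ C2) ∧
    (∀ ζ ξ, ‖Γ ζ - Γ ξ‖ ≤ C2 * ‖ζ - ξ‖) ∧
    (∀ ζ ξ, ‖fderiv ℝ Γ ζ - fderiv ℝ Γ ξ‖ ≤ C3 * ‖ζ - ξ‖) := by
  have hcs1 : HasCompactSupport (fderiv ℝ Γ) := hΓcs.fderiv ℝ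
  have hΓ1 : ContDiff ℝ 1 (fderiv ℝ Γ) := hΓs.fderiv_right (by norm_num)
  obtain ⟨C1, hC1⟩ := hΓcs.exists_bound_of_continuous hΓs.continuous
  obtain ⟨C2, hC2⟩ := ContDiff.lipschitzWith_of_hasCompactSupport hΓcs hΓs (by norm_num)
  obtain ⟨C3, hC3⟩ := ContDiff.lipschitzWith_of_hasCompactSupport hcs1 hΓ1 (by norm_num)
  refine ⟨C1, C2, C3, (norm_nonneg _).trans (hC1 0), C2.2, C3.2, hC1,
    fun ζ => norm_fderiv_le_of_lipschitz ℝ hC2, fun ζ ξ => hC2.norm_sub_le ζ ξ, fun ζ ξ => hC3.norm_sub_le ζ ξ⟩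

set_option maxHeartbeats 1000000 in
theorem exists_KP (q : ℕ) : ∃ C κ Γ, KP q C κ Γ := by
  obtain ⟨Λ0, b, hL, hh, hd⟩ := exists_lam0 q
  obtain ⟨χ, χs, χ1, χ0⟩ : ∃ χ : ℂ → ℝ, ContDiff ℝ 2 χ ∧ (∀ ζ ∈ Metric.closedBall (0:ℂ) (1/4), χ ζ = 1) ∧
      (∀ ζ : ℂ, 1/2 ≤ ‖ζ‖ → χ ζ = 0) := by
    let χ : ContDiffBump (0 : ℂ) := ⟨1/4, 1/2, by norm_num, by norm_num⟩
    refine ⟨χ, χ.contDiff, fun ζ h => χ.one_of_mem_closedBall h, fun ζ h => χ.zero_of_le_dist ?_⟩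
    rw [dist_zero_right]; exact h
  set Λ : ℂ → ℂ := fun ζ => ((1 - χ ζ : ℝ) : ℂ) * Λ0 ζ with hΛ
  have hΛs : ContDiff ℝ 2 Λ := by
    rw [contDiff_iff_contDiffAt]
    intro ζ
    by_cases h0 : ζ = 0
    · subst h0
      have : Λ =ᶠ[nhds 0] fun _ => 0 := by
        filter_upwards [Metric.closedBall_mem_nhds (0:ℂ) (by norm_num : (0:ℝ) < 1/4)] with ζ hζ
        rw [hΛ]
        simp [χ1 ζ hζ]
      exact contDiffAt_const.congr_of_eventuallyEq this
    · have h1 : ContDiffAt ℝ 2 (fun ζ => (1 - χ ζ : ℝ)) ζ := contDiffAt_const.sub χs.contDiffAt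
      exact (ofRealCLM.contDiff.contDiffAt.comp ζ h1).mul (hL ζ h0)
  have hΛe : ∀ ζ, 1/2 ≤ ‖ζ‖ → Λ ζ = Λ0 ζ := by
    intro ζ hζ
    have : χ ζ = 0 := χ0 ζ hζ
    simp [hΛ, this]
  have hΛd : ∀ ζ, 1/2 < ‖ζ‖ → fderiv ℝ Λ ζ = fderiv ℝ Λ0 ζ := by
    intro ζ hζ
    apply Filter.EventuallyEq.fderiv_eq
    have : {ζ : ℂ | 1/2 < ‖ζ‖} ∈ nhds ζ := (isOpen_lt continuous_const continuous_norm).mem_nhds hζ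
    filter_upwards [this] with ξ hξ
    exact hΛe ξ hξ.le
  set P : ℂ → ℂ := fun ζ => fderiv ℝ Λ ζ I with hP
  have hPc : Continuous P := (hΛs.continuous_fderiv (by norm_num)).clm_apply continuous_const
  set Γ : ℂ → ℂ := fun ζ => 4 ^ q * Λ (4 * ζ) - Λ ζ - b with hΓ
  have hΓs : ContDiff ℝ 2 Γ := by
    have h1 : ContDiff ℝ 2 (fun ζ : ℂ => Λ (4 * ζ)) := hΛs.comp (contDiff_const.mul contDiff_id)
    exact ((contDiff_const.mul h1).sub hΛs).sub contDiff_const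
  have hΓ0 : ∀ ζ, 1/2 ≤ ‖ζ‖ → Γ ζ = 0 := by
    intro ζ hζ
    have h0 : ζ ≠ 0 := by rintro rfl; norm_num at hζ
    have h4 : 1/2 ≤ ‖4 * ζ‖ := by rw [norm_mul]; norm_num; linarith
    simp only [hΓ]
    rw [hΛe ζ hζ, hΛe _ h4, hh ζ h0, sub_self]
  set κ : ℂ → ℂ := fun ζ => fderiv ℝ Γ ζ I with hκ
  have hκP : ∀ ζ, κ ζ = 4 ^ (q + 1) * P (4 * ζ) - P ζ := by
    intro ζ
    have d1 : ∀ ζ, HasFDerivAt Λ (fderiv ℝ Λ ζ) ζ := fun ζ => (hΛs.differentiable (by norm_num) ζ).hasFDerivAt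
    have d2 : HasFDerivAt (fun ζ : ℂ => 4 * ζ) ((4:ℂ) • ContinuousLinearMap.id ℝ ℂ) ζ :=
      (hasFDerivAt_id ζ).const_mul 4
    have d3 := ((((d1 (4 * ζ)).comp ζ d2).const_mul (4 ^ q)).sub (d1 ζ)).sub_const b
    have d4 : fderiv ℝ Γ ζ = _ := d3.fderiv
    simp only [hκ]
    rw [d4]
    have e : (4:ℂ) * I = (4:ℝ) • I := by simp
    change (4:ℂ) ^ q * fderiv ℝ Λ (4 * ζ) ((4:ℂ) * I) - P ζ = _
    rw [e, map_smul, Complex.real_smul]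
    push_cast
    ring
  have hΓcs : HasCompactSupport Γ := by
    apply HasCompactSupport.intro (isCompact_closedBall (0:ℂ) 1)
    intro ζ hζ
    apply hΓ0
    simp at hζ; linarith
  have hΓ1 : ContDiff ℝ 1 (fderiv ℝ Γ) := hΓs.fderiv_right (by norm_num)
  obtain ⟨C1, C2, C3, hC10, hC20, hC30, hC1, hC2, lipG, lipG'⟩ := cs_bounds Γ hΓs hΓcs
  obtain ⟨C4, hC4⟩ := (isCompact_closedBall (0:ℂ) 1).exists_bound_of_continuousOn hPc.continuousOn
  have hC40 : 0 ≤ C4 := (norm_nonneg _).trans (hC4 0 (by simp))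
  have hRb : ∀ ζ : ℂ, 1 ≤ ‖ζ‖ → (if q = 0 then |ζ.re| / ‖ζ‖ ^ 2 else 0) ≤ 1 := by
    intro ζ hζ
    split_ifs
    · rw [div_le_one (by positivity)]
      have := abs_re_le_norm ζ
      nlinarith
    · norm_num
  have hPl : ∀ ζ, 1 ≤ ‖ζ‖ → ‖P ζ - (ζ ^ (q + 1))⁻¹‖ ≤ if q = 0 then |ζ.re| / ‖ζ‖ ^ 2 else 0 := by
    intro ζ hζ
    have h0 : ζ ≠ 0 := by rintro rfl; norm_num at hζ
    simp only [hP]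
    rw [hΛd ζ (by linarith)]
    exact hd ζ h0
  have hPb : ∀ ζ, ‖P ζ‖ ≤ C4 + 2 := by
    intro ζ
    by_cases h : ‖ζ‖ ≤ 1
    · linarith [hC4 ζ (by simpa using h)]
    · push Not at h
      have h1 := hPl ζ h.le
      have h2 := hRb ζ h.le
      have h3 : ‖(ζ ^ (q + 1))⁻¹‖ ≤ 1 := by
        rw [norm_inv, norm_pow]
        exact inv_le_one_of_one_le₀ (one_le_pow₀ h.le)
      have := norm_add_le (P ζ - (ζ ^ (q + 1))⁻¹) ((ζ ^ (q + 1))⁻¹)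
      rw [sub_add_cancel] at this
      linarith
  have hκb : ∀ ζ, ‖κ ζ‖ ≤ C2 := by
    intro ζ
    refine ((fderiv ℝ Γ ζ).le_opNorm I).trans ?_
    simpa using hC2 ζ
  have tele : ∀ N ζ, ∑ i ∈ Finset.range N, ((4:ℂ) ^ i) ^ (q + 1) * κ (4 ^ i * ζ)
      = (4 ^ N) ^ (q + 1) * P (4 ^ N * ζ) - P ζ := by
    intro N ζ
    induction N with
    | zero => simp
    | succ N ih =>
      rw [Finset.sum_range_succ, ih, hκP, ← mul_assoc, ← pow_succ' (4:ℂ) N]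
      have : ((4:ℂ) ^ (N + 1)) ^ (q + 1) = (4 ^ N) ^ (q + 1) * 4 ^ (q + 1) := by
        rw [← mul_pow, ← pow_succ]
      rw [this]; ring
  refine ⟨C1 + C2 + C3 + C4 + 2, κ, Γ, ?_⟩
  constructor
  · linarith
  · intro ζ; linarith [hC1 ζ]
  · intro ζ hζ; exact hΓ0 ζ (by linarith)
  · exact hΓs.continuous
  · intro ζ; linarith [hκb ζ]
  · intro ζ hζ
    simp only [hκ]
    have : Γ =ᶠ[nhds ζ] fun _ => 0 := by
      have : {ζ : ℂ | 1/2 < ‖ζ‖} ∈ nhds ζ :=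
        (isOpen_lt continuous_const continuous_norm).mem_nhds (by change 1/2 < ‖ζ‖; linarith)
      filter_upwards [this] with ξ hξ
      exact hΓ0 ξ hξ.le
    rw [this.fderiv_eq]; simp
  · exact hΓ1.continuous.clm_apply continuous_const
  · intro ζ ξ
    have : κ ζ - κ ξ = (fderiv ℝ Γ ζ - fderiv ℝ Γ ξ) I := rfl
    rw [this]
    refine (ContinuousLinearMap.le_opNorm _ I).trans ?_
    rw [norm_I, mul_one]
    refine (lipG' ζ ξ).trans ?_
    gcongr; linarith
  · intro ζ e h hh1
    have s1 : ‖Γ (ζ + (h * I + e)) - Γ (ζ + h * I)‖ ≤ C2 * ‖e‖ := by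
      have := lipG (ζ + (h * I + e)) (ζ + h * I)
      rwa [show ζ + (h * I + e) - (ζ + h * I) = e by ring] at this
    have s2 : ‖Γ (ζ + h * I) - Γ ζ - h * κ ζ‖ ≤ C3 * h ^ 2 := by
      have hseg := (convex_segment ζ (ζ + h * I)).norm_image_sub_le_of_norm_fderiv_le' (𝕜 := ℝ)
        (f := Γ) (φ := fderiv ℝ Γ ζ) (C := C3 * |h|)
        (fun x _ => hΓs.differentiable (by norm_num) x) (fun x hx => by
          refine (lipG' x ζ).trans ?_
          gcongr
          have := norm_sub_le_of_mem_segment (x := ζ) (y := x) (z := ζ + h * I) hx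
          simpa using this) (left_mem_segment ℝ _ _) (right_mem_segment ℝ _ _)
      have e1 : fderiv ℝ Γ ζ (ζ + h * I - ζ) = h * κ ζ := by
        have : ζ + h * I - ζ = h • I := by simp
        rw [this, map_smul]; simp [hκ]
      rw [e1] at hseg
      refine hseg.trans (le_of_eq ?_)
      simp
      rw [mul_assoc, abs_mul_abs_self]; ring
    have := norm_add_le (Γ (ζ + (h * I + e)) - Γ (ζ + h * I)) (Γ (ζ + h * I) - Γ ζ - h * κ ζ)
    rw [show Γ (ζ + (h * I + e)) - Γ (ζ + h * I) + (Γ (ζ + h * I) - Γ ζ - h * κ ζ)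
      = Γ (ζ + (h * I + e)) - Γ ζ - h * κ ζ by ring] at this
    have p1 := norm_nonneg e
    have p2 := sq_nonneg h
    nlinarith
  · intro N ζ hN
    rw [tele]
    set M : ℝ := 4 ^ N with hM
    have hM0 : 0 < M := by positivity
    have hMc : (4:ℂ) ^ N = (M : ℂ) := by rw [hM]; push_cast; rfl
    have hnM : ‖(4:ℂ) ^ N * ζ‖ = M * ‖ζ‖ := by rw [norm_mul, norm_pow, hM]; norm_num
    have hl := hPl (4 ^ N * ζ) (by rw [hnM]; exact hN)
    have e : (4 ^ N) ^ (q + 1) * P (4 ^ N * ζ) - P ζ - (ζ ^ (q + 1))⁻¹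
        = (4 ^ N) ^ (q + 1) * (P (4 ^ N * ζ) - ((4 ^ N * ζ) ^ (q + 1))⁻¹) - P ζ := by
      have : (ζ ^ (q + 1))⁻¹ = (4 ^ N) ^ (q + 1) * ((4 ^ N * ζ) ^ (q + 1))⁻¹ := by
        rw [mul_pow, mul_inv, ← mul_assoc, mul_inv_cancel₀ (by simp), one_mul]
      rw [this]; ring
    rw [e]
    refine (norm_sub_le _ _).trans ?_
    have h1 : ‖((4:ℂ) ^ N) ^ (q + 1) * (P (4 ^ N * ζ) - ((4 ^ N * ζ) ^ (q + 1))⁻¹)‖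
        ≤ if q = 0 then |ζ.re| / ‖ζ‖ ^ 2 else 0 := by
      rw [norm_mul]
      refine (mul_le_mul_of_nonneg_left hl (norm_nonneg _)).trans (le_of_eq ?_)
      split_ifs with hq
      · subst hq
        rw [hnM, hMc]
        have : ((M:ℂ) * ζ).re = M * ζ.re := by simp
        rw [this, abs_mul, abs_of_pos hM0]
        simp [abs_of_pos hM0]
        rcases eq_or_ne ζ 0 with h | h
        · simp [h]
        · have := norm_pos_iff.2 h
          field_simp
      · simp
    linarith [hPb ζ]
  · intro N ζ
    refine (norm_sum_le _ _).trans ?_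
    have : ∀ i ∈ Finset.range N, ‖((4:ℂ) ^ i) ^ (q + 1) * κ (4 ^ i * ζ)‖ ≤ C2 * ((4:ℝ) ^ i) ^ (q + 1) := by
      intro i _
      rw [norm_mul, norm_pow, norm_pow, mul_comm]
      norm_num
      exact mul_le_mul_of_nonneg_right (hκb _) (by positivity)
    refine (Finset.sum_le_sum this).trans ?_
    rw [← Finset.mul_sum]
    have h4 := sum4 q N
    have : 0 ≤ ((4:ℝ) ^ N) ^ (q + 1) := by positivity
    calc _ ≤ C2 * (4 ^ N) ^ (q + 1) := by gcongr
      _ ≤ _ := by gcongr; linarith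

end KernelPieces

end PartNoJ

section PartNoK
open MeasureTheory Complex

section GeoHS

/-- Abstract geometric setting. -/
structure Geo {α : Type*} [MetricSpace α] [MeasurableSpace α] (μ : Measure α) (q : ℕ) (K : ℝ)
    (g : α → α → ℂ) (τ : ℝ → α → α) : Prop where
  one_le : 1 ≤ K
  gm : Measurable (Function.uncurry g)
  diag : ∀ z, g z z = 0
  coc : ∀ w t z, ‖g w z - g w t - g t z‖ ≤ K * dist w t * dist t z
  low : ∀ w z, dist w z ^ 2 ≤ K * ‖g w z‖
  re : ∀ w z, |(g w z).re| ≤ K * dist w z ^ 2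
  up : ∀ w z, ‖g w z‖ ≤ K * dist w z
  low1 : q = 0 → ∀ w z, dist w z ≤ K * ‖g w z‖
  tm : ∀ h, |h| ≤ K⁻¹ → Measurable (τ h)
  ti : ∀ h w, |h| ≤ K⁻¹ → τ (-h) (τ h w) = w
  td : ∀ h w, |h| ≤ K⁻¹ → dist (τ h w) w ≤ K * |h|
  tg : ∀ h w, |h| ≤ K⁻¹ → ‖g (τ h w) w - h * I‖ ≤ K * h ^ 2
  tμ : ∀ h S, |h| ≤ K⁻¹ → MeasurableSet S → μ (τ h ⁻¹' S) ≤ ENNReal.ofReal (1 + K * |h|) * μ S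
  ub : ∀ z r, 0 < r → μ (Metric.closedBall z r) ≤ ENNReal.ofReal (K * r ^ (2 * q + 1))
  lb : ∀ z r, 0 < r → r ≤ 1 → ENNReal.ofReal (K⁻¹ * r ^ (2 * q + 1)) ≤ μ (Metric.closedBall z r)

variable {α : Type*} [MetricSpace α] [MeasurableSpace α] {μ : Measure α} {q : ℕ} {K : ℝ}
  {g : α → α → ℂ} {τ : ℝ → α → α}

/-- The quasi-distance. -/
noncomputable def qd (g : α → α → ℂ) (w z : α) : ℝ := Real.sqrt (‖g w z‖ + ‖g z w‖)

theorem qd_sq (g : α → α → ℂ) (w z : α) : qd g w z ^ 2 = ‖g w z‖ + ‖g z w‖ :=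
  Real.sq_sqrt (by positivity)

theorem qd_nonneg (g : α → α → ℂ) (w z : α) : 0 ≤ qd g w z := Real.sqrt_nonneg _

theorem qd_symm (g : α → α → ℂ) (w z : α) : qd g w z = qd g z w := by
  unfold qd; rw [add_comm]

theorem Geo.anti (h : Geo μ q K g τ) (w z : α) : ‖g w z + g z w‖ ≤ K * dist w z ^ 2 := by
  have := h.coc w z w
  rw [h.diag, zero_sub, ← neg_add', norm_neg, dist_comm z w] at this
  rw [pow_two, ← mul_assoc]; exact this

theorem Geo.swap_le (h : Geo μ q K g τ) (w z : α) : ‖g z w‖ ≤ 2 * K ^ 2 * ‖g w z‖ := by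
  have h1 := h.anti w z
  have h2 := h.low w z
  have hK := h.one_le
  have h3 : ‖g z w‖ ≤ ‖g w z + g z w‖ + ‖g w z‖ := by
    have := norm_sub_le (g w z + g z w) (g w z)
    rwa [add_sub_cancel_left] at this
  have h4 := norm_nonneg (g w z)
  have h5 : K * dist w z ^ 2 ≤ K * (K * ‖g w z‖) := by gcongr
  have h6 : ‖g w z‖ ≤ K ^ 2 * ‖g w z‖ := le_mul_of_one_le_left h4 (one_le_pow₀ hK)
  nlinarith

theorem Geo.qd_le (h : Geo μ q K g τ) (w z : α) : qd g w z ^ 2 ≤ 3 * K ^ 2 * ‖g w z‖ := by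
  rw [qd_sq]
  have := h.swap_le w z
  have h4 := norm_nonneg (g w z)
  have h6 : ‖g w z‖ ≤ K ^ 2 * ‖g w z‖ := le_mul_of_one_le_left h4 (one_le_pow₀ h.one_le)
  linarith

theorem g_le_qd (g : α → α → ℂ) (w z : α) : ‖g w z‖ ≤ qd g w z ^ 2 := by
  rw [qd_sq]; linarith [norm_nonneg (g z w)]

theorem Geo.dist_le_qd (h : Geo μ q K g τ) (w z : α) : dist w z ≤ K * qd g w z := by
  have hK := h.one_le
  have h1 := h.low w z
  have h2 := g_le_qd g w z
  apply le_of_sq_le_sq _ (mul_nonneg (by linarith) (qd_nonneg _ _ _)) 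
  calc dist w z ^ 2 ≤ K * qd g w z ^ 2 := h1.trans (by gcongr)
    _ ≤ K ^ 2 * qd g w z ^ 2 := by gcongr; nlinarith
    _ = _ := by ring

theorem Geo.dist_le (h : Geo μ q K g τ) (w z : α) (r : ℝ) (hr : 0 ≤ r) (hw : ‖g w z‖ ≤ r ^ 2) :
    dist w z ≤ K * r := by
  have hK := h.one_le
  have h1 := h.low w z
  apply le_of_sq_le_sq _ (by positivity)
  calc dist w z ^ 2 ≤ K * r ^ 2 := h1.trans (by gcongr)
    _ ≤ K ^ 2 * r ^ 2 := by gcongr; nlinarith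
    _ = _ := by ring

theorem Geo.tri1 (h : Geo μ q K g τ) (w t z : α) :
    ‖g w z‖ ≤ K ^ 4 * (qd g w t + qd g t z) ^ 2 := by
  have hK := h.one_le
  have h1 := h.coc w t z
  have h2 : ‖g w z‖ ≤ ‖g w z - g w t - g t z‖ + ‖g w t‖ + ‖g t z‖ := by
    have := norm_add₃_le (a := g w z - g w t - g t z) (b := g w t) (c := g t z)
    rwa [show g w z - g w t - g t z + g w t + g t z = g w z by ring] at this
  have h3 := h.dist_le_qd w t
  have h4 := h.dist_le_qd t z
  have a1 := qd_nonneg g w t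
  have a2 := qd_nonneg g t z
  have b1 := g_le_qd g w t
  have b2 := g_le_qd g t z
  have h5 : K * dist w t * dist t z ≤ K * (K * qd g w t) * (K * qd g t z) := by gcongr
  have c3 : K ^ 3 ≤ K ^ 4 := pow_le_pow_right₀ hK (by norm_num)
  have c1 : 1 ≤ K ^ 4 := one_le_pow₀ hK
  have p12 := mul_nonneg a1 a2
  have e1 : qd g w t ^ 2 ≤ K ^ 4 * qd g w t ^ 2 := le_mul_of_one_le_left (by positivity) c1
  have e2 : qd g t z ^ 2 ≤ K ^ 4 * qd g t z ^ 2 := le_mul_of_one_le_left (by positivity) c1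
  have e3 : K ^ 3 * (qd g w t * qd g t z) ≤ K ^ 4 * (qd g w t * qd g t z) := by gcongr
  have e4 : 0 ≤ K ^ 4 * (qd g w t * qd g t z) := by positivity
  nlinarith

theorem Geo.tri (h : Geo μ q K g τ) (w t z : α) : qd g w z ≤ 2 * K ^ 2 * (qd g w t + qd g t z) := by
  have hK := h.one_le
  have a1 := qd_nonneg g w t
  have a2 := qd_nonneg g t z
  apply le_of_sq_le_sq _ (by positivity)
  rw [qd_sq]
  have h1 := h.tri1 w t z
  have h2 := h.tri1 z t w
  rw [qd_symm g z t, qd_symm g t w, add_comm (qd g t z)] at h2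
  have : 0 ≤ K ^ 4 * (qd g w t + qd g t z) ^ 2 := by positivity
  calc _ ≤ 2 * (K ^ 4 * (qd g w t + qd g t z) ^ 2) := by linarith
    _ ≤ _ := by nlinarith

theorem Geo.shift1 (h : Geo μ q K g τ) (w z : α) (s : ℝ) (hs : |s| ≤ K⁻¹) :
    ‖g (τ s w) z - g w z - s * I‖ ≤ 2 * K ^ 3 * (s ^ 2 + |s| * dist w z) := by
  have hK := h.one_le
  have h1 := h.coc (τ s w) w z
  have h2 := h.tg s w hs
  have h3 := h.td s w hs
  have e : g (τ s w) z - g w z - s * I = (g (τ s w) z - g (τ s w) w - g w z) + (g (τ s w) w - s * I) := by ring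
  rw [e]
  refine (norm_add_le _ _).trans ?_
  have h4 : K * dist (τ s w) w * dist w z ≤ K * (K * |s|) * dist w z := by gcongr
  have k1 : K ≤ K ^ 3 := le_self_pow₀ hK (by norm_num)
  have k2 : K ^ 2 ≤ K ^ 3 := pow_le_pow_right₀ hK (by norm_num)
  have p1 : 0 ≤ |s| * dist w z := by positivity
  have e1 : K * s ^ 2 ≤ K ^ 3 * s ^ 2 := by gcongr
  have e2 : K ^ 2 * (|s| * dist w z) ≤ K ^ 3 * (|s| * dist w z) := by gcongr
  have e3 : 0 ≤ K ^ 3 * (|s| * dist w z) := by positivity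
  have e4 : 0 ≤ K ^ 3 * s ^ 2 := by positivity
  nlinarith

theorem Geo.shift2 (h : Geo μ q K g τ) (w z : α) (s : ℝ) (hs : |s| ≤ K⁻¹) :
    ‖g w (τ s z) - g w z + s * I‖ ≤ 2 * K ^ 3 * (s ^ 2 + |s| * dist w z) := by
  have hK := h.one_le
  have h1 := h.coc w z (τ s z)
  have h2 := h.tg s z hs
  have h3 := h.td s z hs
  have h5 := h.anti z (τ s z)
  have e : g w (τ s z) - g w z + s * I = (g w (τ s z) - g w z - g z (τ s z)) + (g z (τ s z) + g (τ s z) z)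
    + -(g (τ s z) z - s * I) := by ring
  rw [e]
  refine (norm_add₃_le).trans ?_
  rw [norm_neg]
  rw [dist_comm z (τ s z)] at h1 h5
  have h4 : K * dist w z * dist (τ s z) z ≤ K * dist w z * (K * |s|) := by gcongr
  have h6 : K * dist (τ s z) z ^ 2 ≤ K * (K * |s|) ^ 2 := by gcongr
  rw [mul_pow, sq_abs] at h6
  have k1 : K ≤ K ^ 3 := le_self_pow₀ hK (by norm_num)
  have k2 : K ^ 2 ≤ K ^ 3 := pow_le_pow_right₀ hK (by norm_num)
  have e1 : K * s ^ 2 ≤ K ^ 3 * s ^ 2 := by gcongr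
  have e2 : K ^ 2 * (|s| * dist w z) ≤ K ^ 3 * (|s| * dist w z) := by gcongr
  have e3 : 0 ≤ K ^ 3 * (|s| * dist w z) := by positivity
  have e4 : 0 ≤ K ^ 3 * s ^ 2 := by positivity
  nlinarith

theorem Geo.measE (h : Geo μ q K g τ) (z : α) (r : ℝ) : MeasurableSet {w | ‖g w z‖ ≤ r} :=
  measurableSet_le (h.gm.of_uncurry_right).norm measurable_const

theorem Geo.mulow (h : Geo μ q K g τ) (S : Set α) (hS : MeasurableSet S) (s : ℝ) (hs : |s| ≤ K⁻¹) :
    μ S ≤ 2 * μ (τ s ⁻¹' S) := by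
  have hK := h.one_le
  have hs' : |-s| ≤ K⁻¹ := by rwa [abs_neg]
  have h1 := h.tμ (-s) (τ s ⁻¹' S) hs' (h.tm s hs hS)
  have e : τ (-s) ⁻¹' (τ s ⁻¹' S) = S := by
    ext w
    have := h.ti (-s) w hs'
    rw [neg_neg] at this
    simp only [Set.mem_preimage, this]
  rw [e, abs_neg] at h1
  refine h1.trans ?_
  gcongr
  rw [← ofReal_two]
  apply ENNReal.ofReal_le_ofReal
  have : K * |s| ≤ K * K⁻¹ := by gcongr
  rw [mul_inv_cancel₀ (by linarith)] at this
  linarith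

theorem Geo.muup (h : Geo μ q K g τ) (S : Set α) (hS : MeasurableSet S) (s : ℝ) (hs : |s| ≤ K⁻¹) :
    μ (τ s ⁻¹' S) ≤ 2 * μ S := by
  have hK := h.one_le
  refine (h.tμ s S hs hS).trans ?_
  gcongr
  rw [← ofReal_two]
  apply ENNReal.ofReal_le_ofReal
  have : K * |s| ≤ K * K⁻¹ := by gcongr
  rw [mul_inv_cancel₀ (by linarith)] at this
  linarith

theorem Geo.volE_le (h : Geo μ q K g τ) (z : α) (r : ℝ) (hr : 0 < r) (hr1 : r ≤ 1) :
    μ {w | ‖g w z‖ ≤ r ^ 2} ≤ ENNReal.ofReal (40 * K ^ 5 * (2 * K) ^ (2 * q + 1) * r ^ (2 * q + 2)) := by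
  have hK := h.one_le
  set E := {w | ‖g w z‖ ≤ r ^ 2} with hE
  have hEm : MeasurableSet E := h.measE z _
  set δ := 1 / (4 * K ^ 4) with hδ
  have hδ0 : 0 < δ := by positivity
  have hδK : δ * K ≤ 1 := by
    rw [hδ, div_mul_eq_mul_div, div_le_one (by positivity)]
    have : K ≤ K ^ 4 := le_self_pow₀ hK (by norm_num)
    linarith
  have hδ1 : δ ≤ 1 := by nlinarith
  set J := ⌊δ / (5 * r)⌋₊ + 1 with hJ
  let s : ℕ → ℝ := fun j => 5 * j * r ^ 2
  have hs0 : ∀ j, 0 ≤ s j := fun j => by positivity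
  have hsδ : ∀ j < J, s j ≤ δ * r := by
    intro j hj
    have h1 : (j : ℝ) ≤ δ / (5 * r) := by
      have : j ≤ ⌊δ / (5 * r)⌋₊ := by omega
      exact (Nat.cast_le.2 this).trans (Nat.floor_le (by positivity))
    rw [le_div_iff₀ (by positivity)] at h1
    simp only [s]
    nlinarith
  have hsK : ∀ j < J, |s j| ≤ K⁻¹ := by
    intro j hj
    rw [abs_of_nonneg (hs0 j), ← one_div, le_div_iff₀ (by positivity)]
    have := hsδ j hj
    calc s j * K ≤ δ * r * K := by gcongr
      _ = (δ * K) * r := by ring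
      _ ≤ 1 * 1 := by gcongr
      _ = 1 := by norm_num
  have hsK' : ∀ j < J, |-(s j)| ≤ K⁻¹ := fun j hj => by rw [abs_neg]; exact hsK j hj
  let P : ℕ → Set α := fun j => τ (-(s j)) ⁻¹' E
  have hP : ∀ j < J, ∀ u ∈ P j, |(g u z).im - s j| ≤ 2 * r ^ 2 ∧ dist u z ≤ 2 * K * r := by
    intro j hj u hu
    have hw : ‖g (τ (-(s j)) u) z‖ ≤ r ^ 2 := hu
    set w := τ (-(s j)) u with hwdef
    have hu' : τ (s j) w = u := by
      have := h.ti (-(s j)) u (hsK' j hj)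
      rwa [neg_neg] at this
    have hd := h.dist_le w z r hr.le hw
    have hsh := h.shift1 w z (s j) (hsK j hj)
    rw [hu', abs_of_nonneg (hs0 j)] at hsh
    have hδs := hsδ j hj
    have h1 : 2 * K ^ 3 * (s j ^ 2 + s j * dist w z) ≤ r ^ 2 := by
      have i1 : s j ^ 2 ≤ (δ * r) * (K * r) := by
        rw [pow_two]
        have : δ * r ≤ K * r := by gcongr; linarith
        exact mul_le_mul hδs (hδs.trans this) (hs0 j) (by positivity)
      have i2 : s j * dist w z ≤ (δ * r) * (K * r) := mul_le_mul hδs hd dist_nonneg (by positivity)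
      calc 2 * K ^ 3 * (s j ^ 2 + s j * dist w z) ≤ 2 * K ^ 3 * ((δ * r) * (K * r) + (δ * r) * (K * r)) := by gcongr
        _ = (4 * K ^ 4 * δ) * r ^ 2 := by ring
        _ = r ^ 2 := by rw [hδ]; field_simp
    constructor
    · have h2 := abs_im_le_norm (g u z - g w z - s j * I)
      have h3 := abs_im_le_norm (g w z)
      simp at h2
      have e : (g u z).im - s j = ((g u z).im - (g w z).im - s j) + (g w z).im := by ring
      rw [e]
      refine (abs_add_le _ _).trans ?_
      linarith
    · have := h.td (s j) w (hsK j hj)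
      rw [hu', abs_of_nonneg (hs0 j)] at this
      have h4 : K * s j ≤ K * r := by
        gcongr
        calc s j ≤ δ * r := hδs
          _ ≤ 1 * r := by gcongr
          _ = r := one_mul r
      linarith [dist_triangle u w z]
  have hdisj : Set.PairwiseDisjoint (↑(Finset.range J)) P := by
    intro i hi j hj hij
    rw [Function.onFun, Set.disjoint_left]
    intro u hu1 hu2
    have h1 := (hP i (by simpa using hi) u hu1).1
    have h2 := (hP j (by simpa using hj) u hu2).1
    rw [abs_le] at h1 h2
    simp only [s] at h1 h2
    have hr2 : 0 < r ^ 2 := by positivity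
    rcases lt_or_gt_of_ne hij with hlt | hlt
    · have : (i : ℝ) + 1 ≤ j := by exact_mod_cast hlt
      nlinarith
    · have : (j : ℝ) + 1 ≤ i := by exact_mod_cast hlt
      nlinarith
  have hPm : ∀ j ∈ Finset.range J, MeasurableSet (P j) := fun j hj =>
    h.tm _ (hsK' j (by simpa using hj)) hEm
  have hsum : (J : ENNReal) * μ E ≤ 2 * ENNReal.ofReal (K * (2 * K * r) ^ (2 * q + 1)) := by
    calc (J : ENNReal) * μ E = ∑ j ∈ Finset.range J, μ E := by simp
      _ ≤ ∑ j ∈ Finset.range J, 2 * μ (P j) := by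
          apply Finset.sum_le_sum
          intro j hj
          exact h.mulow E hEm _ (hsK' j (by simpa using hj))
      _ = 2 * μ (⋃ j ∈ Finset.range J, P j) := by
          rw [measure_biUnion_finset hdisj hPm, Finset.mul_sum]
      _ ≤ 2 * μ (Metric.closedBall z (2 * K * r)) := by
          gcongr
          intro u hu
          simp only [Set.mem_iUnion] at hu
          obtain ⟨j, hj, hu⟩ := hu
          exact (hP j (by simpa using hj) u hu).2
      _ ≤ _ := by gcongr; exact h.ub z _ (by positivity)
  have hJ1 : δ / (5 * r) ≤ J := by
    rw [hJ]; push_cast; exact (Nat.lt_floor_add_one _).le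
  have hJ2 : ENNReal.ofReal (δ / (5 * r)) ≤ (J : ENNReal) := by
    rw [← ENNReal.ofReal_natCast]; exact ENNReal.ofReal_le_ofReal hJ1
  have hfin := (mul_le_mul_left hJ2 (μ E)).trans hsum
  have e : μ E = ENNReal.ofReal (5 * r / δ) * (ENNReal.ofReal (δ / (5 * r)) * μ E) := by
    rw [← mul_assoc, ← ENNReal.ofReal_mul (by positivity)]
    have : 5 * r / δ * (δ / (5 * r)) = 1 := by field_simp
    rw [this]; simp
  rw [e]
  refine (mul_le_mul_right hfin _).trans (le_of_eq ?_)
  rw [← ofReal_two, ← ENNReal.ofReal_mul (by positivity), ← ENNReal.ofReal_mul (by positivity)]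
  congr 1
  rw [hδ, mul_pow]
  field_simp
  ring

theorem Geo.volE_ge (h : Geo μ q K g τ) (z : α) (r : ℝ) (hr : 0 < r) (hr1 : r ≤ 1 / (8 * K ^ 3)) :
    ENNReal.ofReal (r / 4 * (K⁻¹ * (1 / (8 * K ^ 3) * r) ^ (2 * q + 1))) ≤ μ {w | ‖g w z‖ ≤ r ^ 2} := by
  have hK := h.one_le
  set E := {w | ‖g w z‖ ≤ r ^ 2} with hE
  have hEm : MeasurableSet E := h.measE z _
  set a := 1 / (8 * K ^ 3) with ha
  have ha0 : 0 < a := by positivity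
  have hK3 : 1 ≤ K ^ 3 := one_le_pow₀ hK
  have haK : a * K ^ 3 = 1 / 8 := by rw [ha]; field_simp
  have ha1 : a ≤ 1 / 8 := by nlinarith
  have hKK3 : K ≤ K ^ 3 := le_self_pow₀ hK (by norm_num)
  have haK1 : a * K ≤ 1 / 8 := by rw [← haK]; gcongr
  have hr1' : r ≤ 1 := by linarith
  set J := ⌊1 / (2 * r)⌋₊ with hJ
  let s : ℤ → ℝ := fun j => j * (r ^ 2 / 2)
  have hKinv : 2 * K * (a * r) ≤ K⁻¹ := by
    rw [← one_div, le_div_iff₀ (by positivity)]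
    have hk2 : K ^ 2 ≤ K ^ 3 := pow_le_pow_right₀ hK (by norm_num)
    calc 2 * K * (a * r) * K = 2 * (a * K ^ 2) * r := by ring
      _ ≤ 2 * (a * K ^ 3) * 1 := by gcongr
      _ ≤ 1 := by rw [haK]; norm_num
  have cov : ∀ w, dist w z ≤ a * r → ∃ j : ℤ, |s j| ≤ 2 * K * (a * r) ∧ ‖g (τ (s j) w) z‖ ≤ r ^ 2 := by
    intro w hw
    set θ := (g w z).im with hθ
    have hθb : |θ| ≤ K * (a * r) := (abs_im_le_norm _).trans ((h.up w z).trans (by gcongr))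
    refine ⟨round (-θ / (r ^ 2 / 2)), ?_⟩
    set j := round (-θ / (r ^ 2 / 2)) with hj
    have h1 : |θ + s j| ≤ r ^ 2 / 4 := by
      have h2 := abs_sub_round (-θ / (r ^ 2 / 2))
      have e : θ + s j = -((-θ / (r ^ 2 / 2) - j) * (r ^ 2 / 2)) := by
        simp only [s]; field_simp; ring
      rw [e, abs_neg, abs_mul, abs_of_pos (by positivity : 0 < r ^ 2 / 2)]
      calc _ ≤ 1 / 2 * (r ^ 2 / 2) := by gcongr
        _ = _ := by ring
    have h2 : |s j| ≤ 2 * K * (a * r) := by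
      have h3 : |s j| ≤ |θ + s j| + |θ| := by
        have := abs_sub (θ + s j) θ
        rwa [add_sub_cancel_left] at this
      have h4 : r ^ 2 / 4 ≤ K * (a * r) := by
        calc r ^ 2 / 4 ≤ r ^ 2 := by linarith [sq_nonneg r]
          _ = 1 * (r * r) := by ring
          _ ≤ K * (a * r) := by gcongr
      linarith
    refine ⟨h2, ?_⟩
    have hsh := h.shift1 w z (s j) (h2.trans hKinv)
    have hre := h.re w z
    have h5 : 2 * K ^ 3 * (s j ^ 2 + |s j| * dist w z) ≤ 1 / 2 * r ^ 2 := by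
      have i1 : s j ^ 2 ≤ (2 * K * (a * r)) * (2 * K * (a * r)) := by
        rw [← sq_abs, pow_two]
        exact mul_le_mul h2 h2 (abs_nonneg _) (by positivity)
      have i2 : |s j| * dist w z ≤ (2 * K * (a * r)) * (2 * K * (a * r)) := by
        refine mul_le_mul h2 (hw.trans ?_) dist_nonneg (by positivity)
        have : 0 ≤ a * r := by positivity
        nlinarith
      calc 2 * K ^ 3 * (s j ^ 2 + |s j| * dist w z)
          ≤ 2 * K ^ 3 * ((2 * K * (a * r)) * (2 * K * (a * r)) + (2 * K * (a * r)) * (2 * K * (a * r))) := by gcongr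
        _ = 16 * (a * K ^ 3) * (a * K * K) * r ^ 2 := by ring
        _ ≤ 16 * (a * K ^ 3) * (a * K ^ 3) * r ^ 2 := by
            have : a * K * K ≤ a * K ^ 3 := by
              have hk2 : K ^ 2 ≤ K ^ 3 := pow_le_pow_right₀ hK (by norm_num)
              nlinarith
            gcongr
        _ ≤ _ := by rw [haK]; nlinarith [sq_nonneg r]
    have h6 : |(g w z).re| ≤ r ^ 2 / 64 := by
      refine hre.trans ?_
      calc K * dist w z ^ 2 ≤ K * (a * r) ^ 2 := by gcongr
        _ = (a * K) * a * r ^ 2 := by ring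
        _ ≤ (1 / 8) * (1 / 8) * r ^ 2 := by gcongr
        _ = _ := by ring
    have h7 : ‖g w z + s j * I‖ ≤ |(g w z).re| + |θ + s j| := by
      refine (norm_le_abs_re_add_abs_im _).trans ?_
      simp [hθ]
    have h8 := norm_add_le (g (τ (s j) w) z - g w z - s j * I) (g w z + s j * I)
    rw [show g (τ (s j) w) z - g w z - s j * I + (g w z + s j * I) = g (τ (s j) w) z by ring] at h8
    have : 0 < r ^ 2 := by positivity
    linarith
  have hsub : Metric.closedBall z (a * r) ⊆ ⋃ j ∈ Finset.Icc (-(J:ℤ)) J, 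
      if |s j| ≤ K⁻¹ then τ (s j) ⁻¹' E else ∅ := by
    intro w hw
    obtain ⟨j, hj1, hj2⟩ := cov w hw
    simp only [Set.mem_iUnion]
    refine ⟨j, ?_, ?_⟩
    · have h1 : |(j:ℝ)| ≤ 1 / (2 * r) := by
        simp only [s] at hj1
        rw [abs_mul, abs_of_pos (by positivity : 0 < r ^ 2 / 2)] at hj1
        rw [le_div_iff₀ (by positivity)]
        have : |(j:ℝ)| * (r ^ 2 / 2) ≤ 2 * (1 / 8) * r := by
          refine hj1.trans ?_
          calc 2 * K * (a * r) = 2 * (a * K) * r := by ring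
            _ ≤ _ := by gcongr
        have h2 : (|(j:ℝ)| * (2 * r)) * r ≤ 1 * r := by nlinarith
        exact le_of_mul_le_mul_right h2 hr
      have h2 : (j.natAbs : ℝ) ≤ 1 / (2 * r) := by
        rw [Nat.cast_natAbs]; push_cast; exact h1
      have h3 : j.natAbs ≤ J := Nat.le_floor h2
      rw [Finset.mem_Icc]; omega
    · rw [if_pos (hj1.trans hKinv)]
      exact hj2
  have hmes : μ (Metric.closedBall z (a * r)) ≤ ENNReal.ofReal (2 / r) * (2 * μ E) := by
    refine (measure_mono hsub).trans ((measure_biUnion_finset_le _ _).trans ?_)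
    calc _ ≤ ∑ j ∈ Finset.Icc (-(J:ℤ)) J, 2 * μ E := by
          apply Finset.sum_le_sum
          intro j _
          split_ifs with hj
          · exact h.muup E hEm _ hj
          · simp
      _ = ((2 * J + 1 : ℕ) : ENNReal) * (2 * μ E) := by
          rw [Finset.sum_const, Int.card_Icc, nsmul_eq_mul]
          congr 3; omega
      _ ≤ _ := by
          gcongr
          rw [← ENNReal.ofReal_natCast]
          apply ENNReal.ofReal_le_ofReal
          have : (J:ℝ) ≤ 1 / (2 * r) := Nat.floor_le (by positivity)
          push_cast
          have h1 : 1 ≤ 1 / r := by rw [le_div_iff₀ hr]; linarith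
          have e1 : 2 * (1 / (2 * r)) = 1 / r := by field_simp
          have e2 : 2 / r = 1 / r + 1 / r := by ring
          linarith
  have hl := (h.lb z (a * r) (by positivity) (by nlinarith)).trans hmes
  rw [ENNReal.ofReal_mul (by positivity)]
  refine (mul_le_mul_right hl _).trans (le_of_eq ?_)
  rw [← mul_assoc, ← mul_assoc, ← ofReal_two, ← ENNReal.ofReal_mul (by positivity), ← ENNReal.ofReal_mul (by positivity)]
  have : r / 4 * (2 / r) * 2 = 1 := by field_simp; norm_num
  rw [this]; simp

theorem Geo.hs [IsFiniteMeasure μ] (h : Geo μ q K g τ) :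
    ∃ A0 : ℝ, ∀ A, A0 ≤ A → HS μ (qd g) A (2 * q + 2) := by
  have hK := h.one_le
  set a := 1 / (8 * K ^ 3) with ha
  have ha0 : 0 < a := by positivity
  have ha1 : a ≤ 1 := by
    rw [ha, div_le_one (by positivity)]
    have : 1 ≤ K ^ 3 := one_le_pow₀ hK
    linarith
  set c1 := 40 * K ^ 5 * (2 * K) ^ (2 * q + 1) with hc1
  set c2 := μ.real Set.univ with hc2
  set b := a / (2 * K) with hb
  have hb0 : 0 < b := by positivity
  set c3 := b / 4 * (K⁻¹ * (a * b) ^ (2 * q + 1)) with hc3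
  have hc30 : 0 < c3 := by positivity
  have hc20 : 0 ≤ c2 := measureReal_nonneg
  have hc10 : 0 < c1 := by positivity
  refine ⟨1 + 2 * K ^ 2 + c1 + c2 + c3⁻¹, fun A hA => ?_⟩
  have hc3i : 0 < c3⁻¹ := by positivity
  have hK2 : 0 < K ^ 2 := by positivity
  have hA0 : 0 < A := by linarith
  constructor
  · linarith
  · have : Function.uncurry (qd g) = fun z => Real.sqrt (‖Function.uncurry g z‖ + ‖Function.uncurry g z.swap‖) := rfl
    rw [this]
    exact (h.gm.norm.add (h.gm.comp measurable_swap).norm).sqrt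
  · exact qd_nonneg g
  · intro x; simp [qd, h.diag]
  · exact qd_symm g
  · intro x y z
    refine (h.tri x y z).trans ?_
    have a1 := qd_nonneg g x y
    have a2 := qd_nonneg g y z
    gcongr
    linarith
  · intro x r hr
    have hsub : {y | qd g x y ≤ r} ⊆ {w | ‖g w x‖ ≤ r ^ 2} := by
      intro y hy
      have hy' : qd g x y ≤ r := hy
      change ‖g y x‖ ≤ r ^ 2
      refine (g_le_qd g y x).trans ?_
      rw [qd_symm]
      have := qd_nonneg g x y
      gcongr
    by_cases hr1 : r ≤ 1
    · refine (measure_mono hsub).trans ((h.volE_le x r hr hr1).trans (ENNReal.ofReal_le_ofReal ?_))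
      rw [← hc1]
      gcongr; linarith
    · push Not at hr1
      refine (measure_mono (Set.subset_univ _)).trans ?_
      rw [← ENNReal.ofReal_toReal (measure_ne_top μ Set.univ)]
      apply ENNReal.ofReal_le_ofReal
      change c2 ≤ _
      have h1 : 1 ≤ r ^ (2 * q + 2) := one_le_pow₀ hr1.le
      nlinarith
  · intro x r hr hr1
    have hbr : b * r ≤ a := by
      calc b * r ≤ b * 1 := by gcongr
        _ ≤ a := by
          rw [hb, mul_one]
          apply div_le_self ha0.le; linarith
    have hv := h.volE_ge x (b * r) (by positivity) hbr
    have hsub : {w | ‖g w x‖ ≤ (b * r) ^ 2} ⊆ {y | qd g x y ≤ r} := by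
      intro y hy
      have hy' : ‖g y x‖ ≤ (b * r) ^ 2 := hy
      change qd g x y ≤ r
      rw [qd_symm]
      apply le_of_sq_le_sq _ hr.le
      refine (h.qd_le y x).trans ?_
      calc 3 * K ^ 2 * ‖g y x‖ ≤ 3 * K ^ 2 * (b * r) ^ 2 := by gcongr
        _ = 3 / 4 * a ^ 2 * r ^ 2 := by rw [hb]; field_simp; norm_num
        _ ≤ 1 * 1 ^ 2 * r ^ 2 := by gcongr; norm_num
        _ = r ^ 2 := by ring
    refine le_trans (ENNReal.ofReal_le_ofReal ?_) (hv.trans (measure_mono hsub))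
    rw [← ha]
    have e : b * r / 4 * (K⁻¹ * (a * (b * r)) ^ (2 * q + 1)) = c3 * r ^ (2 * q + 2) := by
      rw [hc3, ← mul_assoc a, mul_pow (a * b) r]; ring
    rw [e]
    gcongr
    rw [inv_le_comm₀ hA0 hc30]
    linarith

end GeoHS

end PartNoK

section PartNoL
open MeasureTheory Complex

section GeoKF

theorem quasi_inv {α : Type*} [MeasurableSpace α] {μ : Measure α} [IsFiniteMeasure μ] (T : α → α)
    (hT : Measurable T) (δ : ℝ) (hδ : 0 ≤ δ)
    (h1 : ∀ S, MeasurableSet S → μ (T ⁻¹' S) ≤ ENNReal.ofReal (1 + δ) * μ S)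
    (h2 : ∀ S, MeasurableSet S → μ S ≤ ENNReal.ofReal (1 + δ) * μ (T ⁻¹' S))
    (F : α → ℂ) (hF : Measurable F) (C : ℝ) (hC : ∀ w, ‖F w‖ ≤ C) (E : Set α) (hE : MeasurableSet E)
    (hFE : ∀ w, w ∉ E → F w = 0) :
    ‖∫ w, (F (T w) - F w) ∂μ‖ ≤ 3 * δ * C * μ.real E := by
  classical
  rcases isEmpty_or_nonempty α with hα | ⟨⟨a0⟩⟩
  · have : μ = 0 := Measure.eq_zero_of_isEmpty μ
    simp [this]
  have hC0 : 0 ≤ C := (norm_nonneg _).trans (hC a0)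
  have ib : ∀ (ν : Measure α) [IsFiniteMeasure ν], Integrable F ν := fun ν _ =>
    Integrable.of_bound hF.aestronglyMeasurable C (Filter.Eventually.of_forall hC)
  have nb : ∀ (ν : Measure α) [IsFiniteMeasure ν], ‖∫ w, F w ∂ν‖ ≤ C * ν.real E := fun ν _ => by
    have : ∫ w, F w ∂ν = ∫ w in E, F w ∂ν :=
      (setIntegral_eq_integral_of_forall_compl_eq_zero fun x hx => hFE x hx).symm
    rw [this]
    exact norm_setIntegral_le_of_norm_le_const (measure_lt_top _ _) (fun x _ => hC x)
  set ν := μ.map T with hν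
  haveI : IsFiniteMeasure ν := by rw [hν]; infer_instance
  set c : NNReal := Real.toNNReal (1 + δ) with hc
  have hcR : (c : ℝ) = 1 + δ := Real.coe_toNNReal _ (by linarith)
  have hle : ν ≤ c • μ := by
    refine Measure.le_iff.2 fun S hS => ?_
    rw [hν, Measure.map_apply hT hS]
    exact h1 S hS
  set l := c • μ - ν with hl
  have hsum : l + ν = c • μ := Measure.sub_add_cancel_of_le hle
  haveI : IsFiniteMeasure l := by
    refine ⟨lt_of_le_of_lt ?_ (measure_lt_top (c • μ) Set.univ)⟩
    rw [← hsum]; simp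
  have e1 : ∫ w, F w ∂l + ∫ w, F w ∂ν = (1 + δ : ℝ) * ∫ w, F w ∂μ := by
    rw [← integral_add_measure (ib l) (ib ν), hsum, integral_smul_nnreal_measure, NNReal.smul_def, hcR]
    simp
  have e2 : l.real E + ν.real E = (1 + δ) * μ.real E := by
    rw [← measureReal_add_apply, hsum]
    simp only [measureReal_nnreal_smul_apply, hcR]
  have e3 : μ.real E ≤ (1 + δ) * ν.real E := by
    have := ENNReal.toReal_mono (ENNReal.mul_ne_top ENNReal.ofReal_ne_top (measure_ne_top μ _)) (h2 E hE)
    rw [ENNReal.toReal_mul, ENNReal.toReal_ofReal (by linarith)] at this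
    rw [hν, Measure.real, Measure.real, Measure.map_apply hT hE]; exact this
  have e4 : ∫ w, (F (T w) - F w) ∂μ = (δ : ℝ) * ∫ w, F w ∂μ - ∫ w, F w ∂l := by
    have : ∫ w, F (T w) ∂μ = ∫ w, F w ∂ν := by
      rw [hν, integral_map hT.aemeasurable hF.aestronglyMeasurable]
    rw [integral_sub _ (ib μ), this]
    · push_cast at e1 ⊢
      linear_combination e1
    · exact Integrable.of_bound (hF.comp hT).aestronglyMeasurable C (Filter.Eventually.of_forall fun w => hC _)
  rw [e4]
  have n1 := nb μ
  have n2 := nb l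
  have m0 : 0 ≤ μ.real E := measureReal_nonneg
  have m1 : 0 ≤ ν.real E := measureReal_nonneg
  have m2 : l.real E ≤ 2 * δ * μ.real E := by
    have h3 : l.real E * (1 + δ) ≤ 2 * δ * μ.real E * (1 + δ) := by nlinarith [mul_nonneg (mul_nonneg hδ hδ) m0]
    exact le_of_mul_le_mul_right h3 (by linarith)
  calc ‖((δ : ℝ) : ℂ) * ∫ w, F w ∂μ - ∫ w, F w ∂l‖ ≤ ‖((δ : ℝ) : ℂ) * ∫ w, F w ∂μ‖ + ‖∫ w, F w ∂l‖ := norm_sub_le _ _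
    _ ≤ δ * (C * μ.real E) + C * (2 * δ * μ.real E) := by
        rw [norm_mul, Complex.norm_real, Real.norm_eq_abs, abs_of_nonneg hδ]
        gcongr
        exact n2.trans (by gcongr)
    _ = _ := by ring

theorem can_core {α : Type*} [MeasurableSpace α] {μ : Measure α} [IsFiniteMeasure μ] {q : ℕ} {C : ℝ}
    {κ Γ : ℂ → ℂ} (kp : KP q C κ Γ) (T : α → α)
    (hT : Measurable T) (δ : ℝ) (hδ : 0 ≤ δ) (hδ1 : δ ≤ 1)
    (h1 : ∀ S, MeasurableSet S → μ (T ⁻¹' S) ≤ ENNReal.ofReal (1 + δ) * μ S)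
    (h2 : ∀ S, MeasurableSet S → μ S ≤ ENNReal.ofReal (1 + δ) * μ (T ⁻¹' S))
    (u : α → ℂ) (hu : Measurable u) (t e0 V : ℝ) (ht0 : 0 ≤ t) (ht : t ≤ 1) (he0 : 0 ≤ e0)
    (he : ∀ w, ‖u w‖ ≤ 1 ∨ ‖u (T w)‖ ≤ 1 → ‖u (T w) - u w - t * I‖ ≤ e0)
    (hV : μ.real {w | ‖u w‖ ≤ 1} ≤ V) :
    t * ‖∫ w, κ (u w) ∂μ‖ ≤ C * (3 * (e0 + t ^ 2) * V + 3 * δ * V) := by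
  have hC := kp.one_le
  set E := {w | ‖u w‖ ≤ 1} with hE
  have hEm : MeasurableSet E := measurableSet_le hu.norm measurable_const
  have q1 := quasi_inv T hT δ hδ h1 h2 (fun w => Γ (u w)) (kp.Gc.measurable.comp hu) C (fun w => kp.Gb _) E hEm
    (fun w hw => kp.Gs _ (by simpa [hE] using hw))
  have i1 : Integrable (fun w => Γ (u (T w)) - Γ (u w)) μ := by
    refine Integrable.of_bound (((kp.Gc.measurable.comp hu).comp hT).sub (kp.Gc.measurable.comp hu)).aestronglyMeasurable (C + C)
      (Filter.Eventually.of_forall fun w => (norm_sub_le _ _).trans (add_le_add (kp.Gb _) (kp.Gb _)))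
  have i2 : Integrable (fun w => (t:ℂ) * κ (u w)) μ := by
    refine Integrable.const_mul (Integrable.of_bound (kp.kc.measurable.comp hu).aestronglyMeasurable C
      (Filter.Eventually.of_forall fun w => kp.kb _)) _
  set Er := fun w => Γ (u (T w)) - Γ (u w) - t * κ (u w) with hEr
  have b1 : ∀ w, w ∉ E ∪ T ⁻¹' E → Er w = 0 := by
    intro w hw
    simp only [Set.mem_union, not_or, hE, Set.mem_preimage, Set.mem_setOf_eq, not_le] at hw
    simp only [hEr, kp.Gs _ hw.1, kp.Gs _ hw.2, kp.ks _ hw.1]; simp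
  have b2 : ∀ w ∈ E ∪ T ⁻¹' E, ‖Er w‖ ≤ C * (e0 + t ^ 2) := by
    intro w hw
    have h3 := he w hw
    have h4 := kp.tay (u w) (u (T w) - u w - t * I) t (by rwa [abs_of_nonneg ht0])
    have h5 : u w + (t * I + (u (T w) - u w - t * I)) = u (T w) := by ring
    rw [h5] at h4
    refine h4.trans ?_
    gcongr
  have b3 : ‖∫ w, Er w ∂μ‖ ≤ C * (e0 + t ^ 2) * μ.real (E ∪ T ⁻¹' E) := by
    have : ∫ w, Er w ∂μ = ∫ w in E ∪ T ⁻¹' E, Er w ∂μ :=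
      (setIntegral_eq_integral_of_forall_compl_eq_zero fun x hx => b1 x hx).symm
    rw [this]
    exact norm_setIntegral_le_of_norm_le_const (measure_lt_top _ _) b2
  have m0 : 0 ≤ μ.real E := measureReal_nonneg
  have b4 : μ.real (E ∪ T ⁻¹' E) ≤ 3 * V := by
    have h3 := measureReal_union_le (μ := μ) E (T ⁻¹' E)
    have h4 := ENNReal.toReal_mono (ENNReal.mul_ne_top ENNReal.ofReal_ne_top (measure_ne_top μ _)) (h1 E hEm)
    rw [ENNReal.toReal_mul, ENNReal.toReal_ofReal (by linarith)] at h4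
    change μ.real (T ⁻¹' E) ≤ (1 + δ) * μ.real E at h4
    nlinarith
  have e : (t:ℂ) * ∫ w, κ (u w) ∂μ = ∫ w, (Γ (u (T w)) - Γ (u w)) ∂μ - ∫ w, Er w ∂μ := by
    have := integral_sub i1 i2
    rw [show (∫ w, Er w ∂μ) = _ from this, integral_const_mul]; ring
  have : t * ‖∫ w, κ (u w) ∂μ‖ = ‖(t:ℂ) * ∫ w, κ (u w) ∂μ‖ := by
    rw [norm_mul, Complex.norm_real, Real.norm_eq_abs, abs_of_nonneg ht0]
  rw [this, e]
  calc _ ≤ _ := norm_sub_le _ _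
    _ ≤ 3 * δ * C * V + C * (e0 + t ^ 2) * (3 * V) := by
        apply add_le_add
        · exact q1.trans (by gcongr)
        · exact b3.trans (by gcongr)
    _ = _ := by ring

end GeoKF

end PartNoL

section PartNoM
open MeasureTheory Complex

section GeoKF2

theorem sm_core {q : ℕ} {C K D : ℝ}
    {κ Γ : ℂ → ℂ} (kp : KP q C κ Γ) (hK : 1 ≤ K) (hD : 0 ≤ D) (i : ℕ) (a b : ℂ)
    (hab : ‖a‖ ≤ ((2 ^ i)⁻¹ : ℝ) ^ 2 ∨ ‖b‖ ≤ ((2 ^ i)⁻¹ : ℝ) ^ 2 → ‖a - b‖ ≤ D ^ 2 + K ^ 3 * D * (2 ^ i)⁻¹) :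
    ‖κ (4 ^ i * a) - κ (4 ^ i * b)‖ ≤ 2 * C * K ^ 3 * (2 ^ i * D) := by
  have hC := kp.one_le
  have hK3 : 1 ≤ K ^ 3 := one_le_pow₀ hK
  have p : (0:ℝ) < 2 ^ i := by positivity
  have h4 : (4:ℝ) ^ i = 2 ^ i * 2 ^ i := by rw [← mul_pow]; norm_num
  have hz : ∀ a : ℂ, ¬ ‖a‖ ≤ ((2 ^ i)⁻¹ : ℝ) ^ 2 → κ (4 ^ i * a) = 0 := by
    intro a ha
    apply kp.ks
    push Not at ha
    rw [norm_mul, norm_pow, show ‖(4:ℂ)‖ = 4 by simp, h4]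
    calc (1:ℝ) = 2 ^ i * 2 ^ i * ((2 ^ i)⁻¹ : ℝ) ^ 2 := by field_simp
      _ < _ := by gcongr
  by_cases hcase : ‖a‖ ≤ ((2 ^ i)⁻¹ : ℝ) ^ 2 ∨ ‖b‖ ≤ ((2 ^ i)⁻¹ : ℝ) ^ 2
  swap
  · push Not at hcase
    rw [hz a (not_le.2 hcase.1), hz b (not_le.2 hcase.2)]; simp; positivity
  rcases le_or_gt 1 (2 ^ i * D) with h1 | h1
  · calc _ ≤ C + C := (norm_sub_le _ _).trans (add_le_add (kp.kb _) (kp.kb _))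
      _ = 2 * C * 1 * 1 := by ring
      _ ≤ _ := by gcongr
  · have h2 := hab hcase
    have hDr : D ≤ (2 ^ i)⁻¹ := by
      rw [← one_div, le_div_iff₀ p]; linarith
    refine (kp.kl _ _).trans ?_
    rw [← mul_sub, norm_mul, norm_pow, show ‖(4:ℂ)‖ = 4 by simp, h4]
    calc C * (2 ^ i * 2 ^ i * ‖a - b‖) ≤ C * (2 ^ i * 2 ^ i * (K ^ 3 * D * (2 ^ i)⁻¹ + K ^ 3 * D * (2 ^ i)⁻¹)) := by
          gcongr
          refine h2.trans ?_
          gcongr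
          calc D ^ 2 = 1 * D * D := by ring
            _ ≤ _ := by gcongr
      _ = _ := by field_simp; ring

variable {α : Type*} [MetricSpace α] [MeasurableSpace α] {μ : Measure α} {q : ℕ} {K : ℝ}
  {g : α → α → ℂ} {τ : ℝ → α → α}

theorem Geo.dw (h : Geo μ q K g τ) (w w' z : α) (r : ℝ) (hr : 0 ≤ r)
    (hh : ‖g w z‖ ≤ r ^ 2 ∨ ‖g w' z‖ ≤ r ^ 2) :
    ‖g w z - g w' z‖ ≤ qd g w w' ^ 2 + K ^ 3 * qd g w w' * r := by
  have hK := h.one_le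
  have key : ∀ w w', ‖g w' z‖ ≤ r ^ 2 → ‖g w z - g w' z‖ ≤ qd g w w' ^ 2 + K ^ 3 * qd g w w' * r := by
    intro w w' hw
    have h1 := h.coc w w' z
    have h2 := g_le_qd g w w'
    have h3 := h.dist_le_qd w w'
    have h4 := h.dist_le w' z r hr hw
    have h5 := qd_nonneg g w w'
    calc _ = ‖(g w z - g w w' - g w' z) + g w w'‖ := by congr 1; ring
      _ ≤ _ := norm_add_le _ _
      _ ≤ K * (K * qd g w w') * (K * r) + qd g w w' ^ 2 := by
          gcongr
          exact h1.trans (by gcongr)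
      _ = _ := by ring
  rcases hh with hh | hh
  · rw [norm_sub_rev, qd_symm]; exact key w' w hh
  · exact key w w' hh

theorem Geo.dz (h : Geo μ q K g τ) (w z z' : α) (r : ℝ) (hr : 0 ≤ r)
    (hh : ‖g w z‖ ≤ r ^ 2 ∨ ‖g w z'‖ ≤ r ^ 2) :
    ‖g w z - g w z'‖ ≤ qd g z z' ^ 2 + K ^ 3 * qd g z z' * r := by
  have hK := h.one_le
  have key : ∀ z z', ‖g w z'‖ ≤ r ^ 2 → ‖g w z - g w z'‖ ≤ qd g z z' ^ 2 + K ^ 3 * qd g z z' * r := by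
    intro z z' hw
    have h1 := h.coc w z' z
    have h2 := g_le_qd g z' z
    have h3 := h.dist_le_qd z' z
    have h4 := h.dist_le w z' r hr hw
    have h5 := qd_nonneg g z' z
    rw [qd_symm g z z']
    calc _ = ‖(g w z - g w z' - g z' z) + g z' z‖ := by congr 1; ring
      _ ≤ _ := norm_add_le _ _
      _ ≤ K * (K * r) * (K * qd g z' z) + qd g z' z ^ 2 := by
          gcongr
          exact h1.trans (by gcongr)
      _ = _ := by ring
  rcases hh with hh | hh
  · rw [norm_sub_rev, qd_symm]; exact key z' z hh
  · exact key z z' hh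

theorem Geo.mulow2 (h : Geo μ q K g τ) (S : Set α) (hS : MeasurableSet S) (s : ℝ) (hs : |s| ≤ K⁻¹) :
    μ S ≤ ENNReal.ofReal (1 + K * |s|) * μ (τ s ⁻¹' S) := by
  have hK := h.one_le
  have hs' : |-s| ≤ K⁻¹ := by rwa [abs_neg]
  have h1 := h.tμ (-s) (τ s ⁻¹' S) hs' (h.tm s hs hS)
  have e : τ (-s) ⁻¹' (τ s ⁻¹' S) = S := by
    ext w
    have := h.ti (-s) w hs'
    rw [neg_neg] at this
    simp only [Set.mem_preimage, this]
  rwa [e, abs_neg] at h1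

theorem Geo.can [IsFiniteMeasure μ] {C : ℝ} {κ Γ : ℂ → ℂ} (kp : KP q C κ Γ) (h : Geo μ q K g τ)
    (i : ℕ) (sg : ℝ) (hsg : |sg| = 1) (v : α → ℂ) (hv : Measurable v) (z : α)
    (hd : ∀ w r, 0 ≤ r → ‖v w‖ ≤ r ^ 2 → dist w z ≤ K * r)
    (hsh : ∀ w s, |s| ≤ K⁻¹ → ‖v (τ s w) - v w - sg * s * I‖ ≤ 2 * K ^ 3 * (s ^ 2 + |s| * dist w z))
    (V : ℝ) (hV : μ.real {w | ‖v w‖ ≤ ((2 ^ i)⁻¹ : ℝ) ^ 2} ≤ V) :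
    ‖∫ w, κ (4 ^ i * v w) ∂μ‖ ≤ 24 * C * K ^ 4 * V * (2 ^ i)⁻¹ := by
  have hC := kp.one_le
  have hK := h.one_le
  have hV0 : 0 ≤ V := measureReal_nonneg.trans hV
  set r : ℝ := (2 ^ i)⁻¹ with hr
  have hr0 : 0 < r := by positivity
  have hr1 : r ≤ 1 := inv_le_one_of_one_le₀ (one_le_pow₀ (by norm_num))
  have h4 : (4:ℝ) ^ i * r ^ 2 = 1 := by
    have : (4:ℝ) ^ i = 2 ^ i * 2 ^ i := by rw [← mul_pow]; norm_num
    rw [this, hr]; field_simp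
  have hKi : K⁻¹ ≤ 1 := inv_le_one_of_one_le₀ hK
  have hKi0 : 0 < K⁻¹ := by positivity
  set s0 := K⁻¹ * r ^ 3 with hs0
  have hs00 : 0 < s0 := by positivity
  have hr3 : r ^ 3 ≤ r := pow_le_of_le_one hr0.le hr1 (by norm_num)
  have hs0r : s0 ≤ r := by
    calc s0 ≤ 1 * r := by rw [hs0]; gcongr
      _ = r := one_mul r
  have hKs0 : K * s0 = r ^ 3 := by rw [hs0]; field_simp
  set s := sg * s0 with hs
  have hsa : |s| = s0 := by rw [hs, abs_mul, hsg, one_mul, abs_of_pos hs00]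
  have hsK : |s| ≤ K⁻¹ := by
    rw [hsa, hs0]
    exact mul_le_of_le_one_right hKi0.le (pow_le_one₀ hr0.le hr1)
  have hsgs : sg * s = s0 := by
    have : sg * sg = 1 := by rw [← abs_mul_abs_self, hsg, one_mul]
    rw [hs, ← mul_assoc, this, one_mul]
  set R : ℝ := 4 ^ i with hR
  have hR0 : 0 < R := by positivity
  set t := R * s0 with ht
  have htr : t = K⁻¹ * r := by
    rw [ht, hs0]; linear_combination (K⁻¹ * r) * h4
  have ht0 : 0 < t := by positivity
  have ht1 : t ≤ 1 := by rw [htr]; exact mul_le_one₀ hKi hr0.le hr1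
  have hsc : ∀ w, ‖(4:ℂ) ^ i * v w‖ ≤ 1 ↔ ‖v w‖ ≤ r ^ 2 := by
    intro w
    rw [norm_mul, norm_pow, show ‖(4:ℂ)‖ = 4 by simp, ← h4, mul_le_mul_iff_right₀ hR0]
  have main := can_core kp (τ s) (h.tm s hsK) (K * |s|) (by positivity) (by rw [hsa, hKs0]; exact pow_le_one₀ hr0.le hr1)
    (fun S hS => h.tμ s S hsK hS) (fun S hS => h.mulow2 S hS s hsK) (fun w => (4:ℂ) ^ i * v w)
    (measurable_const.mul hv) t (6 * K ^ 4 * t * r) V ht0.le ht1 (by positivity) ?_ ?_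
  · rw [hsa] at main
    have e1 : t ^ 2 ≤ t * r := by rw [pow_two, htr]; gcongr; exact mul_le_of_le_one_left hr0.le hKi
    have e2 : s0 ≤ t * r := by
      have : s0 = r ^ 2 * t := by rw [ht]; linear_combination (-s0) * h4
      rw [this]
      have : r ^ 2 * t ≤ r * t := by gcongr; exact pow_le_of_le_one hr0.le hr1 (by norm_num)
      linarith
    have e3 : t * ‖∫ w, κ (4 ^ i * v w) ∂μ‖ ≤ t * (24 * C * K ^ 4 * V * r) := by
      refine main.trans ?_
      have hK4 : K ≤ K ^ 4 := le_self_pow₀ hK (by norm_num)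
      have hK41 : 1 ≤ K ^ 4 := one_le_pow₀ hK
      calc C * (3 * (6 * K ^ 4 * t * r + t ^ 2) * V + 3 * (K * s0) * V)
          ≤ C * (3 * (6 * K ^ 4 * t * r + K ^ 4 * (t * r)) * V + 3 * (K ^ 4 * (t * r)) * V) := by
            gcongr
            exact e1.trans (le_mul_of_one_le_left (by positivity) hK41)
        _ = t * (24 * C * K ^ 4 * V * r) := by ring
    exact le_of_mul_le_mul_left e3 ht0
  · intro w hw
    simp only [hsc] at hw
    have hdist : dist w z ≤ 2 * K * r := by
      rcases hw with hw | hw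
      · have := hd w r hr0.le hw
        nlinarith [mul_nonneg (by linarith : (0:ℝ) ≤ K) hr0.le]
      · have h1 := hd _ r hr0.le hw
        have h2 := h.td s w hsK
        rw [hsa, hKs0] at h2
        have h3 := dist_triangle w (τ s w) z
        rw [dist_comm w (τ s w)] at h3
        have : r ≤ K * r := le_mul_of_one_le_left hr0.le hK
        linarith
    have h1 := hsh w s hsK
    have e : (4:ℂ) ^ i * v (τ s w) - 4 ^ i * v w - t * I = 4 ^ i * (v (τ s w) - v w - sg * s * I) := by
      have : (sg:ℂ) * s = s0 := by exact_mod_cast hsgs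
      rw [this, ht, hR]; push_cast; ring
    rw [e, norm_mul, norm_pow, show ‖(4:ℂ)‖ = 4 by simp]
    calc R * ‖v (τ s w) - v w - sg * s * I‖ ≤ R * (2 * K ^ 3 * (s ^ 2 + |s| * dist w z)) := by gcongr
      _ ≤ R * (2 * K ^ 3 * (s0 * (K * r) + s0 * (2 * K * r))) := by
          rw [hsa, ← sq_abs, hsa, pow_two]
          gcongr
          exact hs0r.trans (le_mul_of_one_le_left hr0.le hK)
      _ = _ := by rw [ht]; ring
  · simpa only [hsc] using hV

theorem Geo.kf [IsFiniteMeasure μ] {C : ℝ} {κ Γ : ℂ → ℂ} (kp : KP q C κ Γ) (h : Geo μ q K g τ) :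
    ∃ A, HS μ (qd g) A (2 * q + 2) ∧
      KF μ (qd g) A (2 * q + 2) (fun i z w => ((4:ℂ) ^ i) ^ (q + 1) * κ (4 ^ i * g w z)) := by
  obtain ⟨A0, hA0⟩ := h.hs
  have hs0 := hA0 A0 le_rfl
  have hK := h.one_le
  have hC := kp.one_le
  have hA01 := hs0.one_le
  set V0 := A0 * (2 * K) ^ (2 * q + 2) with hV0
  set A := A0 + 2 * K + 2 * C * K ^ 3 + 24 * C * K ^ 4 * V0 with hA
  have hVnn : 0 ≤ V0 := by positivity
  have g1 : 0 ≤ 2 * C * K ^ 3 := by positivity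
  have g2 : 0 ≤ 24 * C * K ^ 4 * V0 := by positivity
  have hA1 : A0 ≤ A := by rw [hA]; nlinarith
  have hA2 : 2 * C * K ^ 3 ≤ A := by rw [hA]; nlinarith
  have hA3 : 24 * C * K ^ 4 * V0 ≤ A := by rw [hA]; nlinarith
  have hA4 : 2 * K ≤ A := by rw [hA]; nlinarith
  have hCA : C ≤ A := by
    have : (1:ℝ) ≤ K ^ 3 := one_le_pow₀ hK
    nlinarith
  have hn4 : ∀ i : ℕ, ‖((4:ℂ) ^ i) ^ (q + 1)‖ = (2 ^ i) ^ (2 * q + 2) := by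
    intro i
    rw [norm_pow, norm_pow, show ‖(4:ℂ)‖ = 2 ^ 2 by simp; norm_num, ← pow_mul, ← pow_mul, ← pow_mul]
    congr 1; ring
  have hqr : ∀ w z r, 0 ≤ r → ‖g w z‖ ≤ r ^ 2 → qd g w z ≤ 2 * K * r := by
    intro w z r hr hg
    have h1 := h.qd_le w z
    apply le_of_sq_le_sq _ (by positivity)
    calc _ ≤ _ := h1
      _ ≤ 3 * K ^ 2 * r ^ 2 := by gcongr
      _ ≤ _ := by nlinarith [mul_nonneg (sq_nonneg K) (sq_nonneg r)]
  have hvol : ∀ (i : ℕ) (z : α) (S : Set α), (∀ w ∈ S, qd g z w ≤ 2 * K * (2 ^ i)⁻¹) →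
      μ.real S ≤ V0 * ((2 ^ i)⁻¹) ^ (2 * q + 2) := by
    intro i z S hS
    have h1 := (measure_mono (μ := μ) (fun w hw => hS w hw : S ⊆ {w | qd g z w ≤ 2 * K * (2 ^ i)⁻¹})).trans
      (hs0.ub z _ (by positivity))
    have h2 := ENNReal.toReal_mono ENNReal.ofReal_ne_top h1
    rw [ENNReal.toReal_ofReal (by positivity)] at h2
    rw [hV0, mul_assoc, ← mul_pow]; exact h2
  have hfin : ∀ (i : ℕ) (x : ℂ), ‖x‖ ≤ 24 * C * K ^ 4 * (V0 * ((2 ^ i)⁻¹) ^ (2 * q + 2)) * (2 ^ i)⁻¹ →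
      2 ^ i * ((2 ^ i) ^ (2 * q + 2) * ‖x‖) ≤ A := by
    intro i x hx
    refine le_trans ?_ hA3
    calc 2 ^ i * ((2 ^ i) ^ (2 * q + 2) * ‖x‖) ≤ 2 ^ i * ((2 ^ i) ^ (2 * q + 2) * (24 * C * K ^ 4 * (V0 * ((2 ^ i)⁻¹) ^ (2 * q + 2)) * (2 ^ i)⁻¹)) := by gcongr
      _ = 24 * C * K ^ 4 * V0 * (2 ^ i * (2 ^ i)⁻¹) * (2 ^ i * (2 ^ i)⁻¹) ^ (2 * q + 2) := by
          rw [mul_pow]; ring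
      _ = _ := by rw [mul_inv_cancel₀ (by positivity)]; simp
  refine ⟨A, hA0 A hA1, ?_, ?_, ?_, ?_, ?_, ?_, ?_⟩
  · intro i
    have : Measurable (fun x : α × α => g x.2 x.1) := h.gm.comp measurable_swap
    exact measurable_const.mul (kp.kc.measurable.comp (measurable_const.mul this))
  · intro i x y
    rw [norm_mul, hn4, mul_comm]
    gcongr
    exact (kp.kb _).trans hCA
  · intro i x y hxy
    rw [kp.ks, mul_zero]
    by_contra hcon
    push Not at hcon
    have h4 : (4:ℝ) ^ i = 2 ^ i * 2 ^ i := by rw [← mul_pow]; norm_num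
    have h1 : ‖g y x‖ ≤ ((2 ^ i)⁻¹ : ℝ) ^ 2 := by
      rw [norm_mul, norm_pow, show ‖(4:ℂ)‖ = 4 by simp, h4] at hcon
      rw [inv_pow, ← one_div, le_div_iff₀ (by positivity)]
      nlinarith
    have h2 := hqr y x _ (by positivity) h1
    rw [qd_symm] at h2
    have h3 : 2 ^ i * qd g x y ≤ 2 ^ i * (2 * K * (2 ^ i)⁻¹) := by gcongr
    rw [show (2:ℝ) ^ i * (2 * K * (2 ^ i)⁻¹) = 2 * K by field_simp] at h3
    linarith
  · intro i x x' y
    rw [← mul_sub, norm_mul, hn4, mul_comm A, mul_assoc]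
    gcongr
    refine (sm_core kp hK (qd_nonneg g x x') i _ _ (fun hh => h.dz y x x' _ (by positivity) hh)).trans ?_
    have := qd_nonneg g x x'
    gcongr
  · intro i x y y'
    rw [← mul_sub, norm_mul, hn4, mul_comm A, mul_assoc]
    gcongr
    refine (sm_core kp hK (qd_nonneg g y y') i _ _ (fun hh => h.dw y y' x _ (by positivity) hh)).trans ?_
    have := qd_nonneg g y y'
    gcongr
  · intro i y
    rw [integral_const_mul, norm_mul, hn4]
    apply hfin
    refine h.can kp i (-1) (by simp) (fun x => g y x) h.gm.of_uncurry_left y ?_ ?_ _ ?_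
    · intro w r hr hw
      rw [dist_comm]; exact h.dist_le y w r hr hw
    · intro w s hs
      have := h.shift2 y w s hs
      rw [dist_comm]
      convert this using 2
      push_cast; ring
    · exact hvol i y _ (fun w hw => hqr _ _ _ (by positivity) hw)
  · intro i x
    rw [integral_const_mul, norm_mul, hn4]
    apply hfin
    refine h.can kp i 1 (by simp) (fun y => g y x) h.gm.of_uncurry_right x ?_ ?_ _ ?_
    · intro w r hr hw
      exact h.dist_le w x r hr hw
    · intro w s hs
      have := h.shift1 w x s hs
      convert this using 2
      push_cast; ring
    · exact hvol i x _ (fun w hw => by rw [qd_symm]; exact hqr _ _ _ (by positivity) hw)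

end GeoKF2

end PartNoM

section PartNoN
open MeasureTheory Complex

section GeoMain

variable {α : Type*} [MetricSpace α] [MeasurableSpace α] {μ : Measure α} {q : ℕ} {K : ℝ}
  {g : α → α → ℂ} {τ : ℝ → α → α}

theorem Geo.main [IsFiniteMeasure μ] (h : Geo μ q K g τ) (p : ℝ) (hp : 1 < p) :
    ∃ A : ℝ, ∀ ε : ℝ, 0 < ε → ∀ f : α → ℂ, MemLp f (ENNReal.ofReal p) μ →
      eLpNorm (fun z => ∫ w in {w | ε < ‖g w z‖}, f w * (g w z ^ (q + 1))⁻¹ ∂μ) (ENNReal.ofReal p) μ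
        ≤ ENNReal.ofReal A * eLpNorm f (ENNReal.ofReal p) μ := by
  classical
  obtain ⟨C, κ, Γ, kp⟩ := exists_KP q
  obtain ⟨A, hs, kf⟩ := h.kf kp
  set k : ℕ → α → α → ℂ := fun i z w => ((4:ℂ) ^ i) ^ (q + 1) * κ (4 ^ i * g w z) with hk
  obtain ⟨B, hB0, hB⟩ := kf.Lp_bound (by omega) hs p hp
  have hK := h.one_le
  have hC := kp.one_le
  have hA := hs.one_le
  set C1 := C + K ^ 3 with hC1
  have hC10 : 0 ≤ C1 := by positivity
  set B2 := C * (A * (4 * K) ^ (2 * q + 2)) with hB2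
  refine ⟨B + C1 * μ.real Set.univ + B2, ?_⟩
  intro ε hε f hf
  have hp1 : (1:ENNReal) ≤ ENNReal.ofReal p := by
    rw [← ENNReal.ofReal_one]; exact ENNReal.ofReal_le_ofReal hp.le
  have hfi : Integrable f μ := hf.integrable hp1
  have hex : ∃ N : ℕ, 1 ≤ 4 ^ N * ε := by
    obtain ⟨N, hN⟩ := pow_unbounded_of_one_lt ε⁻¹ (by norm_num : (1:ℝ) < 4)
    refine ⟨N, ?_⟩
    rw [inv_lt_iff_one_lt_mul₀ hε] at hN
    linarith
  obtain ⟨N, hN1, hN2⟩ : ∃ N : ℕ, 1 ≤ 4 ^ N * ε ∧ (N = 0 ∨ 4 ^ N * ε < 4) := by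
    refine ⟨Nat.find hex, Nat.find_spec hex, ?_⟩
    rcases Nat.eq_zero_or_pos (Nat.find hex) with h0 | h0
    · exact Or.inl h0
    · right
      have := Nat.find_min hex (Nat.sub_lt h0 one_pos)
      push Not at this
      calc (4:ℝ) ^ Nat.find hex * ε = 4 * (4 ^ (Nat.find hex - 1) * ε) := by
            rw [← mul_assoc, ← pow_succ', Nat.sub_add_cancel h0]
        _ < 4 * 1 := by gcongr
        _ = 4 := by norm_num
  have gsw : Measurable (fun x : α × α => g x.2 x.1) := h.gm.comp measurable_swap
  have hSm : MeasurableSet {x : α × α | ε < ‖g x.2 x.1‖} := measurableSet_lt measurable_const gsw.norm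
  set E0 : α → α → ℂ := fun z w => if ε < ‖g w z‖ then (g w z ^ (q + 1))⁻¹ - KS k N z w else 0 with hE0
  set E1 : α → α → ℂ := fun z w => if ε < ‖g w z‖ then 0 else - KS k N z w with hE1
  have hKSm := (kf.bkS N).meas
  have bk0 : BK E0 C1 := by
    refine ⟨?_, ?_⟩
    · exact Measurable.ite hSm (((gsw.pow_const _).inv).sub hKSm) measurable_const
    · intro z w
      simp only [hE0]
      split_ifs with hgt
      · have hpos : 0 < ‖g w z‖ := hε.trans hgt
        have h1 := kp.sum N (g w z) (hN1.trans (by gcongr))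
        rw [norm_sub_rev]
        refine h1.trans ?_
        rw [hC1]
        gcongr
        split_ifs with hq
        · rw [div_le_iff₀ (by positivity)]
          calc _ ≤ _ := h.re w z
            _ ≤ K * (K * ‖g w z‖) ^ 2 := by gcongr; exact h.low1 hq w z
            _ = _ := by ring
        · positivity
      · simpa using hC10
  have hn : ((4:ℝ) ^ N) ^ (q + 1) = (2 ^ N) ^ (2 * q + 2) := by
    rw [show (4:ℝ) = 2 ^ 2 by norm_num, ← pow_mul, ← pow_mul, ← pow_mul]; congr 1; ring
  have bk1 : BK E1 (C * (2 ^ N) ^ (2 * q + 2)) := by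
    refine ⟨?_, ?_⟩
    · exact Measurable.ite hSm measurable_const hKSm.neg
    · intro z w
      simp only [hE1]
      split_ifs with hgt
      · simp; positivity
      · rw [norm_neg, ← hn]; exact kp.sumb N _
  have supp1 : ∀ z w, 4 * K * (2 ^ N)⁻¹ < qd g z w → E1 z w = 0 := by
    intro z w hzw
    simp only [hE1]
    split_ifs with hgt
    · rfl
    · push Not at hgt
      rcases hN2 with h0 | h0
      · simp [h0, KS]
      · exfalso
        have h4 : (4:ℝ) ^ N = 2 ^ N * 2 ^ N := by rw [← mul_pow]; norm_num
        have h1 : ‖g w z‖ ≤ (2 * (2 ^ N)⁻¹ : ℝ) ^ 2 := by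
          have : ‖g w z‖ * 4 ^ N ≤ 4 := by nlinarith [pow_pos (by norm_num : (0:ℝ) < 4) N]
          rw [← le_div_iff₀ (by positivity), h4] at this
          refine this.trans (le_of_eq ?_)
          field_simp; norm_num
        have h2 := h.qd_le w z
        rw [qd_symm g w z] at h2
        have h3 : qd g z w ^ 2 ≤ (4 * K * (2 ^ N)⁻¹) ^ 2 := by
          calc _ ≤ _ := h2
            _ ≤ 3 * K ^ 2 * (2 * (2 ^ N)⁻¹ : ℝ) ^ 2 := by gcongr
            _ ≤ 4 * K ^ 2 * (2 * (2 ^ N)⁻¹ : ℝ) ^ 2 := by gcongr; norm_num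
            _ = _ := by ring
        exact absurd (le_of_sq_le_sq h3 (by positivity)) (not_le.2 hzw)
  have hcst : C * (2 ^ N) ^ (2 * q + 2) * (A * (4 * K * (2 ^ N)⁻¹) ^ (2 * q + 2)) = B2 := by
    rw [hB2, mul_pow (4 * K), inv_pow]; field_simp
  have l1 : ∀ x, ∫⁻ y, ‖E1 x y‖ₑ ∂μ ≤ ENNReal.ofReal B2 := fun x => by
    have := hs.lint_supp (E1 x) x _ (4 * K * (2 ^ N)⁻¹) (by positivity) (bk1.bdd x) (supp1 x)
    rwa [hcst] at this
  have l2 : ∀ y, ∫⁻ x, ‖E1 x y‖ₑ ∂μ ≤ ENNReal.ofReal B2 := fun y => by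
    have := hs.lint_supp (fun x => E1 x y) y _ (4 * K * (2 ^ N)⁻¹) (by positivity) (fun x => bk1.bdd x y)
      (fun x hx => supp1 x y (by rwa [qd_symm]))
    rwa [hcst] at this
  have n1 := schur_eLpNorm μ E1 bk1.meas f hf.1 _ p hp l1 l2
  have n0 := bk0.eLp hf.1 hp
  have n2 := hB N f hf
  have dec : (fun z => ∫ w in {w | ε < ‖g w z‖}, f w * (g w z ^ (q + 1))⁻¹ ∂μ) =
      (TN μ k N f + fun z => ∫ w, E0 z w * f w ∂μ) + fun z => ∫ w, E1 z w * f w ∂μ := by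
    funext z
    have hS : MeasurableSet {w | ε < ‖g w z‖} := measurableSet_lt measurable_const h.gm.of_uncurry_right.norm
    rw [← integral_indicator hS]
    simp only [Pi.add_apply, TN]
    have i12 : Integrable (fun w => KS k N z w * f w + E0 z w * f w) μ :=
      ((kf.bkS N).integrable_mul hfi z).add (bk0.integrable_mul hfi z)
    rw [← integral_add ((kf.bkS N).integrable_mul hfi z) (bk0.integrable_mul hfi z),
      ← integral_add i12 (bk1.integrable_mul hfi z)]
    congr 1
    funext w
    simp only [Set.indicator, Set.mem_setOf_eq, hE0, hE1]
    split_ifs with hgt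
    · ring
    · ring
  rw [dec]
  have a0 := bk0.aesm hf.1
  have a1 := bk1.aesm hf.1
  have a2 : AEStronglyMeasurable (TN μ k N f) μ := (kf.bkS N).aesm hf.1
  calc _ ≤ _ := eLpNorm_add_le (a2.add a0) a1 hp1
    _ ≤ (eLpNorm (TN μ k N f) (ENNReal.ofReal p) μ + eLpNorm (fun z => ∫ w, E0 z w * f w ∂μ) (ENNReal.ofReal p) μ)
        + eLpNorm (fun z => ∫ w, E1 z w * f w ∂μ) (ENNReal.ofReal p) μ := by
          gcongr; exact eLpNorm_add_le a2 a0 hp1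
    _ ≤ (ENNReal.ofReal B * eLpNorm f (ENNReal.ofReal p) μ + ENNReal.ofReal (C1 * μ.real Set.univ) * eLpNorm f (ENNReal.ofReal p) μ)
        + ENNReal.ofReal B2 * eLpNorm f (ENNReal.ofReal p) μ := by gcongr
    _ = _ := by
        rw [ENNReal.ofReal_add (by positivity) (by positivity), ENNReal.ofReal_add (by positivity) (by positivity)]
        ring

end GeoMain

end PartNoN

section PartNoO
open MeasureTheory

section Regul

variable {E : Type*} [NormedAddCommGroup E] [NormedSpace ℝ E] [FiniteDimensional ℝ E]

theorem exists_straight (d : ℕ) (hd : Module.finrank ℝ E = d + 1) (l : E →L[ℝ] ℝ) (hl : l ≠ 0) :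
    ∃ Φ : E ≃L[ℝ] (Fin d → ℝ) × ℝ, ∀ x, (Φ x).2 = l x := by
  obtain ⟨v0, hv0⟩ : ∃ v, l v ≠ 0 := by
    by_contra hcon
    push Not at hcon
    exact hl (ContinuousLinearMap.ext hcon)
  set v := (l v0)⁻¹ • v0 with hv
  have hlv : l v = 1 := by rw [hv, map_smul, smul_eq_mul, inv_mul_cancel₀ hv0]
  set f2 : ℝ →L[ℝ] E := ContinuousLinearMap.toSpanSingleton ℝ v with hf2
  have hri : Function.RightInverse f2 l := by
    intro t
    simp [hf2, ContinuousLinearMap.toSpanSingleton_apply, hlv]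
  have hrange : Module.finrank ℝ (LinearMap.range (l : E →ₗ[ℝ] ℝ)) = 1 := by
    have : LinearMap.range (l : E →ₗ[ℝ] ℝ) = ⊤ := LinearMap.range_eq_top.2 hri.surjective
    rw [this]; simp
  have hker : Module.finrank ℝ (LinearMap.ker (l : E →ₗ[ℝ] ℝ)) = Module.finrank ℝ (Fin d → ℝ) := by
    have := LinearMap.finrank_range_add_finrank_ker (l : E →ₗ[ℝ] ℝ)
    rw [hrange, hd] at this
    simp; omega
  refine ⟨((ContinuousLinearEquiv.equivOfRightInverse l f2 hri).trans
    (ContinuousLinearEquiv.prodComm ℝ ℝ _)).trans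
    ((ContinuousLinearEquiv.ofFinrankEq hker).prodCongr (ContinuousLinearEquiv.refl ℝ ℝ)), ?_⟩
  intro x
  simp [ContinuousLinearEquiv.equivOfRightInverse]

variable [MeasurableSpace E] [BorelSpace E]

theorem regul_local (d : ℕ) (hd : Module.finrank ℝ E = d + 1) (M U : Set E) (hU : IsOpen U) 
    (ρ : E → ℝ) (L : E → (E →L[ℝ] ℝ)) (hρ : ∀ w ∈ U, HasFDerivAt ρ (L w) w)
    (hL : ContinuousOn L U) (hM : ∀ w ∈ U, ρ w = 0 ↔ w ∈ M) (z0 : E) (hz0 : z0 ∈ U) (hz0L : L z0 ≠ 0) :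
    ∃ r0 > 0, ∃ K : ℝ, 1 ≤ K ∧ ∀ z ∈ M, dist z z0 ≤ r0 → ∀ r, 0 < r → r ≤ r0 →
      μH[(d:ℝ)] (M ∩ Metric.closedBall z r) ≤ ENNReal.ofReal (K * r ^ d) ∧
      ENNReal.ofReal (K⁻¹ * r ^ d) ≤ μH[(d:ℝ)] (M ∩ Metric.closedBall z r) := by
  obtain ⟨Φ, hΦ⟩ := exists_straight d hd (L z0) hz0L
  set B : ℝ := ‖(Φ.symm : (Fin d → ℝ) × ℝ →L[ℝ] E)‖ + 1 with hB
  have hB0 : 0 < B := by positivity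
  have hBb : ∀ y, ‖Φ.symm y‖ ≤ B * ‖y‖ := by
    intro y
    refine ((Φ.symm : (Fin d → ℝ) × ℝ →L[ℝ] E).le_opNorm y).trans ?_
    gcongr; rw [hB]; linarith
  set P : E →L[ℝ] (Fin d → ℝ) := (ContinuousLinearMap.fst ℝ _ _).comp (Φ : E →L[ℝ] (Fin d → ℝ) × ℝ) with hP
  have hPx : ∀ x, P x = (Φ x).1 := fun x => rfl
  set A : ℝ := ‖P‖ + 1 with hA
  have hA0 : 0 < A := by positivity
  have hAb : ∀ x, ‖P x‖ ≤ A * ‖x‖ := by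
    intro y
    refine (P.le_opNorm y).trans ?_
    gcongr; rw [hA]; linarith
  set η := 1 / (2 * B) with hη
  have hη0 : 0 < η := by positivity
  -- neighborhood
  obtain ⟨R, hR0, hRU, hRL⟩ : ∃ R > 0, Metric.ball z0 R ⊆ U ∧ ∀ w ∈ Metric.ball z0 R, ‖L w - L z0‖ ≤ η := by
    have h1 : U ∈ nhds z0 := hU.mem_nhds hz0
    have h2 := (hL.continuousAt h1)
    have h3 : ∀ᶠ w in nhds z0, dist (L w) (L z0) < η := Metric.tendsto_nhds.1 h2 η hη0
    obtain ⟨R, hR, hR2⟩ := Metric.mem_nhds_iff.1 (Filter.inter_mem h1 h3)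
    refine ⟨R, hR, fun w hw => (hR2 hw).1, fun w hw => ?_⟩
    have := (hR2 hw).2
    rw [← dist_eq_norm]; exact le_of_lt this
  have mvt : ∀ x ∈ Metric.ball z0 R, ∀ y ∈ Metric.ball z0 R, |ρ y - ρ x - L z0 (y - x)| ≤ η * ‖y - x‖ := by
    intro x hx y hy
    exact Convex.norm_image_sub_le_of_norm_hasFDerivWithin_le' (f := ρ) (f' := L)
      (fun w hw => (hρ w (hRU hw)).hasFDerivWithinAt) hRL (convex_ball z0 R) hx hy
  have normΦ : ∀ x, ‖x‖ ≤ B * max ‖P x‖ |L z0 x| := by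
    intro x
    have := hBb (Φ x)
    rw [Φ.symm_apply_apply] at this
    refine this.trans (le_of_eq ?_)
    rw [Prod.norm_def, hΦ, hPx]; rfl
  have anti : ∀ x ∈ M ∩ Metric.ball z0 R, ∀ y ∈ M ∩ Metric.ball z0 R, ‖y - x‖ ≤ B * ‖P y - P x‖ := by
    intro x hx y hy
    have h1 := mvt x hx.2 y hy.2
    rw [(hM x (hRU hx.2)).2 hx.1, (hM y (hRU hy.2)).2 hy.1, sub_zero, zero_sub, abs_neg] at h1
    have h2 := normΦ (y - x)
    rw [map_sub P] at h2
    rcases le_total ‖P y - P x‖ |L z0 (y - x)| with h3 | h3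
    · rw [max_eq_right h3] at h2
      have h4 : ‖y - x‖ ≤ B * (η * ‖y - x‖) := h2.trans (by gcongr)
      have h5 : B * (η * ‖y - x‖) = ‖y - x‖ / 2 := by rw [hη]; field_simp
      have h6 : ‖y - x‖ ≤ 0 := by linarith
      exact h6.trans (by positivity)
    · rwa [max_eq_left h3] at h2
  have vol : ∀ (y : Fin d → ℝ) (r : ℝ), 0 ≤ r → μH[(d:ℝ)] (Metric.closedBall y r) = ENNReal.ofReal ((2 * r) ^ d) := by
    intro y r hr
    have h1 := @hausdorffMeasure_pi_real (Fin d) _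
    rw [Fintype.card_fin] at h1
    rw [h1, Real.volume_pi_closedBall _ hr, Fintype.card_fin]
  set K := (2 * A * B) ^ d + (2 * A * B) ^ d + 1 + (A * B / 2) ^ d with hK
  have hK1 : 1 ≤ K := by
    have : 0 ≤ (2 * A * B) ^ d + (2 * A * B) ^ d + (A * B / 2) ^ d := by positivity
    linarith
  refine ⟨R / 3, by positivity, K, hK1, ?_⟩
  intro z hz hzz r hr hrr
  have hsub : Metric.closedBall z r ⊆ Metric.ball z0 R := by
    intro x hx
    rw [Metric.mem_closedBall] at hx
    rw [Metric.mem_ball]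
    have := dist_triangle x z z0
    linarith
  constructor
  · set S := M ∩ Metric.closedBall z r with hS
    have hSR : S ⊆ M ∩ Metric.ball z0 R := fun x hx => ⟨hx.1, hsub hx.2⟩
    have inj : Set.InjOn P S := by
      intro x hx y hy hxy
      have := anti x (hSR hx) y (hSR hy)
      rw [hxy, sub_self, norm_zero, mul_zero] at this
      exact (eq_of_sub_eq_zero (norm_le_zero_iff.1 this)).symm
    haveI : Nonempty E := ⟨0⟩
    set f := Function.invFunOn P S with hf
    have hinv : ∀ x ∈ S, f (P x) = x := fun x hx => inj.leftInvOn_invFunOn hx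
    have hlip : LipschitzOnWith (Real.toNNReal B) f (P '' S) := by
      apply LipschitzOnWith.of_dist_le_mul
      rintro _ ⟨x, hx, rfl⟩ _ ⟨y, hy, rfl⟩
      rw [hinv x hx, hinv y hy, Real.coe_toNNReal _ hB0.le, dist_eq_norm, dist_eq_norm]
      exact anti y (hSR hy) x (hSR hx)
    have h1 := hlip.hausdorffMeasure_image_le (d := (d:ℝ)) (by positivity)
    have h2 : f '' (P '' S) = S := by
      rw [Set.image_image]
      exact (Set.image_congr hinv).trans (by simp)
    rw [h2] at h1
    have h3 : P '' S ⊆ Metric.closedBall (P z) (A * r) := by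
      rintro _ ⟨x, hx, rfl⟩
      rw [Metric.mem_closedBall, dist_eq_norm, ← map_sub]
      refine (hAb _).trans ?_
      have := hx.2
      rw [Metric.mem_closedBall, dist_eq_norm] at this
      gcongr
    calc _ ≤ _ := h1
      _ ≤ ENNReal.ofReal (B ^ d) * ENNReal.ofReal ((2 * (A * r)) ^ d) := by
          refine mul_le_mul' (le_of_eq ?_) ((measure_mono h3).trans (le_of_eq (vol _ _ (by positivity))))
          rw [ENNReal.rpow_natCast, ENNReal.ofReal_pow hB0.le]; rfl
      _ = ENNReal.ofReal ((2 * A * B) ^ d * r ^ d) := by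
          rw [← ENNReal.ofReal_mul (by positivity)]; congr 1
          rw [← mul_pow, ← mul_pow]; congr 1; ring
      _ ≤ _ := by
          apply ENNReal.ofReal_le_ofReal
          have : (2 * A * B) ^ d ≤ K := by
            have : 0 ≤ (2 * A * B) ^ d + (A * B / 2) ^ d := by positivity
            rw [hK]; linarith
          gcongr
  · set S := M ∩ Metric.closedBall z r with hS
    have h3 : Metric.closedBall (P z) (r / B) ⊆ P '' S := by
      intro y hy
      rw [Metric.mem_closedBall, dist_eq_norm] at hy
      set x : ℝ → E := fun t => z + Φ.symm (y - P z, t) with hx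
      have hxc : Continuous x := by
        rw [hx]; fun_prop
      have hxz : ∀ t, |t| ≤ r / B → ‖x t - z‖ ≤ r := by
        intro t ht
        simp only [hx, add_sub_cancel_left]
        refine (hBb _).trans ?_
        rw [Prod.norm_def]
        calc _ ≤ B * (r / B) := by gcongr; exact max_le hy ht
          _ = r := by field_simp
      have hxR : ∀ t, |t| ≤ r / B → x t ∈ Metric.ball z0 R := fun t ht => hsub (by
        rw [Metric.mem_closedBall, dist_eq_norm]; exact hxz t ht)
      have hzR : z ∈ Metric.ball z0 R := hsub (Metric.mem_closedBall_self hr.le)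
      have hρx : ∀ t, |t| ≤ r / B → |ρ (x t) - t| ≤ r / (2 * B) := by
        intro t ht
        have h1 := mvt z hzR (x t) (hxR t ht)
        rw [(hM z (hRU hzR)).2 hz, sub_zero] at h1
        have h2 : L z0 (x t - z) = t := by
          rw [← hΦ]; simp [hx]
        rw [h2] at h1
        refine h1.trans ?_
        calc η * ‖x t - z‖ ≤ η * r := by gcongr; exact hxz t ht
          _ = _ := by rw [hη]; field_simp
      have hrB : 0 < r / B := by positivity
      have hrB2 : r / (2 * B) = (r / B) / 2 := by field_simp
      have hcont : ContinuousOn (fun t => ρ (x t)) (Set.Icc (-(r / B)) (r / B)) := by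
        intro t ht
        have : x t ∈ U := hRU (hxR t (abs_le.2 ht))
        exact ((hρ _ this).continuousAt.comp hxc.continuousAt).continuousWithinAt
      have hivt := intermediate_value_Icc (by linarith) hcont
      have e1 := hρx (-(r / B)) (by rw [abs_neg, abs_of_pos hrB])
      have e2 := hρx (r / B) (by rw [abs_of_pos hrB])
      rw [hrB2, abs_le] at e1 e2
      obtain ⟨t, ht, ht0⟩ := hivt (show (0:ℝ) ∈ _ from ⟨by linarith, by linarith⟩)
      have htt : |t| ≤ r / B := abs_le.2 ht
      refine ⟨x t, ⟨(hM _ (hRU (hxR t htt))).1 ht0, ?_⟩, ?_⟩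
      · rw [Metric.mem_closedBall, dist_eq_norm]; exact hxz t htt
      · rw [hPx]
        simp only [hx, map_add, Φ.apply_symm_apply, Prod.fst_add]
        rw [← hPx]; simp
    have hlip : LipschitzOnWith (Real.toNNReal A) P S := by
      apply LipschitzOnWith.of_dist_le_mul
      intro x hx y hy
      rw [Real.coe_toNNReal _ hA0.le, dist_eq_norm, dist_eq_norm, ← map_sub]
      exact hAb _
    have h1 := hlip.hausdorffMeasure_image_le (d := (d:ℝ)) (by positivity)
    have h2 := (measure_mono h3).trans h1
    rw [vol _ _ (by positivity), ENNReal.rpow_natCast] at h2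
    have h4 : ENNReal.ofReal (K⁻¹ * r ^ d) * ENNReal.ofReal (A ^ d) ≤ μH[(d:ℝ)] S * ENNReal.ofReal (A ^ d) := by
      rw [ENNReal.ofReal_pow hA0.le, mul_comm (μH[(d:ℝ)] S)]
      refine le_trans ?_ h2
      rw [← ENNReal.ofReal_pow hA0.le, ← ENNReal.ofReal_mul (by positivity)]
      apply ENNReal.ofReal_le_ofReal
      have : (A * B / 2) ^ d ≤ K := by
        have : 0 ≤ (2 * A * B) ^ d := by positivity
        rw [hK]; linarith
      calc K⁻¹ * r ^ d * A ^ d = K⁻¹ * ((A * B / 2) ^ d * (2 * (r / B)) ^ d) := by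
            rw [mul_assoc, ← mul_pow, ← mul_pow]; congr 2; field_simp
        _ ≤ K⁻¹ * (K * (2 * (r / B)) ^ d) := by gcongr
        _ = _ := by field_simp
    exact (ENNReal.mul_le_mul_iff_left (by simpa using by positivity) ENNReal.ofReal_ne_top).1 h4

theorem regul (d : ℕ) (hd : Module.finrank ℝ E = d + 1) (M U : Set E) (hU : IsOpen U) (hMc : IsCompact M)
    (hMU : M ⊆ U)
    (ρ : E → ℝ) (L : E → (E →L[ℝ] ℝ)) (hρ : ∀ w ∈ U, HasFDerivAt ρ (L w) w)
    (hL : ContinuousOn L U) (hM : ∀ w ∈ U, ρ w = 0 ↔ w ∈ M) (hL0 : ∀ w ∈ M, L w ≠ 0) :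
    ∃ K : ℝ, 1 ≤ K ∧ μH[(d:ℝ)] M < ⊤ ∧ ∀ z ∈ M, ∀ r, 0 < r →
      μH[(d:ℝ)] (M ∩ Metric.closedBall z r) ≤ ENNReal.ofReal (K * r ^ d) ∧
      (r ≤ 1 → ENNReal.ofReal (K⁻¹ * r ^ d) ≤ μH[(d:ℝ)] (M ∩ Metric.closedBall z r)) := by
  classical
  have key : ∀ z0 : M, ∃ r0 > 0, ∃ K : ℝ, 1 ≤ K ∧ ∀ z ∈ M, dist z z0 ≤ r0 → ∀ r, 0 < r → r ≤ r0 →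
      μH[(d:ℝ)] (M ∩ Metric.closedBall z r) ≤ ENNReal.ofReal (K * r ^ d) ∧
      ENNReal.ofReal (K⁻¹ * r ^ d) ≤ μH[(d:ℝ)] (M ∩ Metric.closedBall z r) := fun z0 =>
    regul_local d hd M U hU ρ L hρ hL hM z0 (hMU z0.2) (hL0 _ z0.2)
  choose r0 hr0 K0 hK0 hk using key
  obtain ⟨t, ht⟩ := hMc.elim_nhds_subcover' (fun x hx => Metric.ball x (r0 ⟨x, hx⟩)) 
    (fun x hx => Metric.ball_mem_nhds _ (hr0 _))
  -- uniform radius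
  obtain ⟨s, hs0, hs1, hs⟩ : ∃ s : ℝ, 0 < s ∧ s ≤ 1 ∧ ∀ x ∈ t, s ≤ r0 x := by
    clear ht
    induction t using Finset.induction_on with
    | empty => exact ⟨1, one_pos, le_rfl, by simp⟩
    | insert a t _ ih =>
      obtain ⟨s, h1, h2, h3⟩ := ih
      refine ⟨min s (r0 a), lt_min h1 (hr0 a), (min_le_left _ _).trans h2, ?_⟩
      intro x hx
      rcases Finset.mem_insert.1 hx with rfl | hx
      · exact min_le_right _ _
      · exact (min_le_left _ _).trans (h3 x hx)
  set K1 := 1 + ∑ x ∈ t, K0 x with hK1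
  have hK0p : ∀ x, 0 ≤ K0 x := fun x => by linarith [hK0 x]
  have hK1' : ∀ x ∈ t, K0 x ≤ K1 := fun x hx => by
    have := Finset.single_le_sum (f := K0) (fun i _ => hK0p i) hx
    linarith
  have hK11 : 1 ≤ K1 := by
    have := Finset.sum_nonneg (s := t) (f := K0) (fun i _ => hK0p i)
    linarith
  have loc : ∀ z ∈ M, ∀ r, 0 < r → r ≤ s →
      μH[(d:ℝ)] (M ∩ Metric.closedBall z r) ≤ ENNReal.ofReal (K1 * r ^ d) ∧
      ENNReal.ofReal (K1⁻¹ * r ^ d) ≤ μH[(d:ℝ)] (M ∩ Metric.closedBall z r) := by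
    intro z hz r hr hrs
    obtain ⟨x, hx, hzx⟩ := Set.mem_iUnion₂.1 (ht hz)
    have := hk x z hz (le_of_lt hzx) r hr (hrs.trans (hs x hx))
    refine ⟨this.1.trans (ENNReal.ofReal_le_ofReal ?_), le_trans (ENNReal.ofReal_le_ofReal ?_) this.2⟩
    · gcongr; exact hK1' x hx
    · have := hK0 x
      gcongr; exact hK1' x hx
  have hfin : μH[(d:ℝ)] M < ⊤ := by
    obtain ⟨t2, ht2, ht3⟩ := hMc.elim_nhds_subcover (fun x => Metric.ball x s) 
      (fun x hx => Metric.ball_mem_nhds _ hs0)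
    have hsub : M ⊆ ⋃ x ∈ t2, (M ∩ Metric.closedBall x s) := by
      intro z hz
      obtain ⟨x, hx, hzx⟩ := Set.mem_iUnion₂.1 (ht3 hz)
      exact Set.mem_iUnion₂.2 ⟨x, hx, hz, Metric.ball_subset_closedBall hzx⟩
    refine (measure_mono hsub).trans_lt ?_
    refine (measure_biUnion_finset_le _ _).trans_lt ?_
    refine ENNReal.sum_lt_top.2 fun x hx => ?_
    exact (loc x (ht2 x hx) s hs0 le_rfl).1.trans_lt ENNReal.ofReal_lt_top
  set m := (μH[(d:ℝ)] M).toReal with hm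
  have hm0 : 0 ≤ m := ENNReal.toReal_nonneg
  refine ⟨K1 * (s ^ d)⁻¹ + m * (s ^ d)⁻¹, ?_, hfin, ?_⟩
  · have h1 : 1 ≤ (s ^ d)⁻¹ := (one_le_inv₀ (by positivity)).2 (pow_le_one₀ hs0.le hs1)
    nlinarith [mul_nonneg hm0 (by linarith : (0:ℝ) ≤ (s ^ d)⁻¹)]
  have h1 : 1 ≤ (s ^ d)⁻¹ := (one_le_inv₀ (by positivity)).2 (pow_le_one₀ hs0.le hs1)
  intro z hz r hr
  constructor
  · rcases le_or_gt r s with hrs | hrs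
    · refine (loc z hz r hr hrs).1.trans (ENNReal.ofReal_le_ofReal ?_)
      gcongr
      nlinarith [mul_nonneg hm0 (by linarith : (0:ℝ) ≤ (s ^ d)⁻¹)]
    · refine (measure_mono Set.inter_subset_left).trans ?_
      rw [← ENNReal.ofReal_toReal hfin.ne, ← hm]
      apply ENNReal.ofReal_le_ofReal
      calc m = m * ((s ^ d)⁻¹ * s ^ d) := by rw [inv_mul_cancel₀ (by positivity), mul_one]
        _ ≤ m * ((s ^ d)⁻¹ * r ^ d) := by gcongr
        _ = 0 + m * (s ^ d)⁻¹ * r ^ d := by ring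
        _ ≤ K1 * (s ^ d)⁻¹ * r ^ d + m * (s ^ d)⁻¹ * r ^ d := by gcongr; positivity
        _ = _ := by ring
  · intro hr1
    have h2 := (loc z hz (s * r) (by positivity) (mul_le_of_le_one_right hs0.le hr1)).2
    refine le_trans (ENNReal.ofReal_le_ofReal ?_) (h2.trans (measure_mono (Set.inter_subset_inter_right _
      (Metric.closedBall_subset_closedBall (mul_le_of_le_one_left hr.le hs1)))))
    have : (K1 * (s ^ d)⁻¹ + m * (s ^ d)⁻¹)⁻¹ ≤ (K1 * (s ^ d)⁻¹)⁻¹ := by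
      gcongr
      have : 0 ≤ m * (s ^ d)⁻¹ := by positivity
      linarith
    calc _ ≤ (K1 * (s ^ d)⁻¹)⁻¹ * r ^ d := by gcongr
      _ = _ := by rw [mul_pow, mul_inv, inv_inv]; ring

end Regul

end PartNoO

section PartNoP
open MeasureTheory Set

section FlowSec

variable {E : Type*} [NormedAddCommGroup E] [NormedSpace ℝ E]

/-- `α` is an integral curve of `X` on `[0,T]`. -/
def IsSol (X : E → E) (T : ℝ) (α : ℝ → E) : Prop :=
  ∀ t ∈ Icc (0:ℝ) T, HasDerivWithinAt α (X (α t)) (Icc 0 T) t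

theorem IsSol.right {X : E → E} {T : ℝ} {α : ℝ → E} (h : IsSol X T α) (t : ℝ) (ht : t ∈ Ico (0:ℝ) T) :
    HasDerivWithinAt α (X (α t)) (Ici t) t :=
  (h t ⟨ht.1, ht.2.le⟩).mono_of_mem_nhdsWithin (Icc_mem_nhdsGE_of_mem ht)

theorem IsSol.cont {X : E → E} {T : ℝ} {α : ℝ → E} (h : IsSol X T α) : ContinuousOn α (Icc 0 T) :=
  fun t ht => (h t ht).continuousWithinAt

theorem IsSol.shrink {X : E → E} {T T' : ℝ} {α : ℝ → E} (h : IsSol X T α) (hT : T' ≤ T) : IsSol X T' α :=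
  fun t ht => (h t ⟨ht.1, ht.2.trans hT⟩).mono (Icc_subset_Icc_right hT)

variable {X : E → E} {K : NNReal}

theorem exists_sol [CompleteSpace E] (hX : LipschitzWith K X) (B T : ℝ) (hB : 0 ≤ B) (hT : 0 ≤ T)
    (hTB : T * (B + K) ≤ 1) (w : E) (hw : ‖X w‖ ≤ B) : ∃ α : ℝ → E, α 0 = w ∧ IsSol X T α := by
  have h0 : (0:ℝ) ∈ Icc (0:ℝ) T := ⟨le_rfl, hT⟩
  have pl : IsPicardLindelof (fun _ : ℝ => X) (tmin := 0) (tmax := T) ⟨0, h0⟩ w 1 0 (Real.toNNReal B + K) K := by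
    refine ⟨fun t _ => hX.lipschitzOnWith, fun x _ => continuousOn_const, ?_, ?_⟩
    · intro t _ x hx
      have h1 := hX.dist_le_mul x w
      rw [Metric.mem_closedBall] at hx
      have h2 : ‖X x‖ ≤ ‖X w‖ + dist (X x) (X w) := by
        rw [dist_eq_norm]
        have := norm_add_le (X w) (X x - X w)
        rwa [add_sub_cancel] at this
      push_cast
      rw [Real.coe_toNNReal _ hB]
      have h3 : (K:ℝ) * dist x w ≤ K * 1 := by gcongr; exact_mod_cast hx
      linarith
    · push_cast
      rw [Real.coe_toNNReal _ hB]
      simp only [sub_zero, sub_self]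
      rw [max_eq_left hT]; linarith
  obtain ⟨α, h1, h2⟩ := pl.exists_eq_forall_mem_Icc_hasDerivWithinAt (x := w) (Metric.mem_closedBall_self (by simp))
  exact ⟨α, h1, h2⟩

theorem IsSol.dist_le (hX : LipschitzWith K X) (hK : 1 ≤ (K:ℝ)) (B T : ℝ) (hB : 0 ≤ B)
    (hTB : T * (B + K) ≤ 1) {α : ℝ → E} (h : IsSol X T α) (hw : ‖X (α 0)‖ ≤ B) (t : ℝ) (ht : t ∈ Icc 0 T) :
    ‖α t - α 0‖ ≤ 2 * B * t := by
  have key := norm_le_gronwallBound_of_norm_deriv_right_le (f := fun t => α t - α 0) (f' := fun t => X (α t))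
    (δ := 0) (K := K) (ε := B) (a := 0) (b := T) (h.cont.sub continuousOn_const)
    (fun x hx => (h.right x hx).sub_const _) (by simp) (by
      intro x hx
      have h1 := hX.dist_le_mul (α x) (α 0)
      rw [dist_eq_norm, dist_eq_norm] at h1
      have := norm_add_le (X (α 0)) (X (α x) - X (α 0))
      rw [add_sub_cancel] at this
      linarith) t ht
  have hK0 : (K:ℝ) ≠ 0 := by linarith
  rw [gronwallBound_of_K_ne_0 hK0] at key
  simp only [zero_mul, zero_add, sub_zero] at key
  have hKt : K * t ≤ 1 := by
    have : t * K ≤ T * (B + K) := by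
      have := ht.1
      have := ht.2
      gcongr <;> linarith
    linarith
  have h1 := Real.abs_exp_sub_one_le (x := K * t) (by rw [abs_of_nonneg (mul_nonneg (by linarith) ht.1)]; exact hKt)
  rw [abs_of_nonneg (mul_nonneg (by linarith) ht.1 : (0:ℝ) ≤ K * t)] at h1
  have h2 := le_abs_self (Real.exp (K * t) - 1)
  calc _ ≤ _ := key
    _ ≤ B / K * (2 * (K * t)) := by gcongr; linarith
    _ = _ := by field_simp

theorem IsSol.lip (hX : LipschitzWith K X) {T : ℝ} {α β : ℝ → E} (h : IsSol X T α) (h' : IsSol X T β) 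
    (t : ℝ) (ht : t ∈ Icc 0 T) : dist (α t) (β t) ≤ dist (α 0) (β 0) * Real.exp (K * t) := by
  have := dist_le_of_trajectories_ODE (v := fun _ => X) (fun _ => hX) h.cont h.right h'.cont h'.right le_rfl t ht
  simpa using this

theorem IsSol.tay (hX : LipschitzWith K X) (hK : 1 ≤ (K:ℝ)) (B T : ℝ) (hB : 0 ≤ B)
    (hTB : T * (B + K) ≤ 1) {α : ℝ → E} (h : IsSol X T α) (hw : ‖X (α 0)‖ ≤ B) (t : ℝ) (ht : t ∈ Icc 0 T) :
    ‖α t - α 0 - t • X (α 0)‖ ≤ 2 * K * B * t ^ 2 := by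
  have h' := h.shrink ht.2
  have key := norm_image_sub_le_of_norm_deriv_le_segment' (f := fun s => α s - s • X (α 0)) 
    (f' := fun s => X (α s) - (1:ℝ) • X (α 0)) (C := 2 * K * B * t) (a := 0) (b := t) 
    (fun s hs => (h' s hs).sub ((hasDerivWithinAt_id s _).smul_const _)) (by
      intro s hs
      rw [one_smul, ← dist_eq_norm]
      have h1 := hX.dist_le_mul (α s) (α 0)
      have h2 := h.dist_le hX hK B T hB hTB hw s ⟨hs.1, hs.2.le.trans ht.2⟩
      rw [← dist_eq_norm] at h2
      calc _ ≤ _ := h1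
        _ ≤ K * (2 * B * s) := by gcongr
        _ ≤ K * (2 * B * t) := by gcongr; exact hs.2.le
        _ = _ := by ring) t ⟨ht.1, le_rfl⟩
  simp only [zero_smul, sub_zero] at key
  rw [show α t - α 0 - t • X (α 0) = α t - t • X (α 0) - α 0 by abel]
  exact key.trans (le_of_eq (by ring))

theorem IsSol.inv (hX : LipschitzWith K X) {T : ℝ} {α β : ℝ → E} (h : IsSol X T α)
    (h' : IsSol (fun x => - X x) T β) (t : ℝ) (ht : t ∈ Icc 0 T) (hb : β 0 = α t) : β t = α 0 := by
  have hr : IsSol (fun x => - X x) t (fun s => α (t - s)) := by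
    intro s hs
    have h1 := (h.shrink ht.2) (t - s) ⟨by linarith [hs.2], by linarith [hs.1]⟩
    have h2 : HasDerivWithinAt (fun s => t - s) (-1) (Icc 0 t) s := by
      simpa using (hasDerivWithinAt_id s (Icc 0 t)).const_sub t
    have := h1.scomp s h2 (fun x hx => ⟨by linarith [hx.2], by linarith [hx.1]⟩)
    rw [neg_smul, one_smul] at this
    exact this
  have hX' : LipschitzWith K (fun x => - X x) := hX.neg
  have := (h'.shrink ht.2).lip hX' hr t ⟨ht.1, le_rfl⟩
  simp only [sub_zero, sub_self, hb, dist_self, zero_mul] at this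
  exact dist_le_zero.1 this

theorem IsSol.mem {T : ℝ} {α : ℝ → E} (h : IsSol X T α) (M U V : Set E) (ρ : E → ℝ) (L : E → (E →L[ℝ] ℝ)) 
    (hρ : ∀ w ∈ U, HasFDerivAt ρ (L w) w) (hM : ∀ w ∈ U, ρ w = 0 ↔ w ∈ M) (hV : V ⊆ U)
    (hLX : ∀ w ∈ V, L w (X w) = 0) (h0 : α 0 ∈ M) (hα : ∀ t ∈ Icc 0 T, α t ∈ V) (t : ℝ) (ht : t ∈ Icc 0 T) : α t ∈ M := by
  have key := norm_image_sub_le_of_norm_deriv_le_segment' (f := fun s => ρ (α s))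
    (f' := fun s => (0:ℝ)) (C := 0) (a := 0) (b := T) 
    (fun s hs => by
      have h1 := (hρ (α s) (hV (hα s hs))).comp_hasDerivWithinAt s (h s hs)
      rw [hLX _ (hα s hs)] at h1
      exact h1) (by simp) t ht
  rw [zero_mul] at key
  have h00 : (0:ℝ) ∈ Icc (0:ℝ) T := ⟨le_rfl, ht.1.trans ht.2⟩
  rw [(hM _ (hV (hα 0 h00))).2 h0, sub_zero] at key
  exact (hM _ (hV (hα t ht))).1 (norm_le_zero_iff.1 key)

theorem exists_flow [CompleteSpace E] (hX : LipschitzWith K X) (hK : 1 ≤ (K:ℝ)) (M U V : Set E)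
    (ρ : E → ℝ) (L : E → (E →L[ℝ] ℝ)) (hMc : IsCompact M)
    (hρ : ∀ w ∈ U, HasFDerivAt ρ (L w) w) (hM : ∀ w ∈ U, ρ w = 0 ↔ w ∈ M) (hV : V ⊆ U)
    (hLX : ∀ w ∈ V, L w (X w) = 0) (δ : ℝ) (hδ : 0 < δ) (hMV : ∀ w ∈ M, ∀ x, dist x w ≤ δ → x ∈ V) :
    ∃ A : ℝ, 1 ≤ A ∧ ∃ τ : ℝ → E → E, ∀ h w, |h| ≤ A⁻¹ → w ∈ M → τ h w ∈ M ∧ τ (-h) (τ h w) = w ∧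
      ‖τ h w - w‖ ≤ A * |h| ∧ ‖τ h w - w - h • X w‖ ≤ A * h ^ 2 ∧
      ∀ z ∈ M, dist (τ h w) (τ h z) ≤ dist w z * Real.exp (K * |h|) := by
  classical
  obtain ⟨B0, hB0⟩ := hMc.exists_bound_of_continuousOn hX.continuous.continuousOn
  set B := max B0 1 with hB
  have hB1 : 1 ≤ B := le_max_right _ _
  have hBb : ∀ w ∈ M, ‖X w‖ ≤ B := fun w hw => (hB0 w hw).trans (le_max_left _ _)
  set A := (B + K) * (1 + 2 * K) + 2 * B * δ⁻¹ with hA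
  have hA0 : 0 ≤ 2 * B * δ⁻¹ := by positivity
  have hA1 : B + K ≤ A := by rw [hA]; nlinarith
  have hA11 : 1 ≤ A := by linarith
  have hA2 : 2 * B ≤ A := by rw [hA]; nlinarith
  have hA3 : 2 * K * B ≤ A := by rw [hA]; nlinarith
  have hA4 : 2 * B * δ⁻¹ ≤ A := by
    rw [hA]; have : 0 ≤ (B + K) * (1 + 2 * K) := by positivity
    linarith
  set T := A⁻¹ with hT
  have hT0 : 0 < T := by positivity
  have hTB : T * (B + K) ≤ 1 := by
    calc _ ≤ T * A := by gcongr
      _ = 1 := inv_mul_cancel₀ (by positivity)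
  have hTδ : 2 * B * T ≤ δ := by
    have : 2 * B ≤ A * δ := by
      have := mul_le_mul_of_nonneg_right hA4 hδ.le
      rwa [mul_assoc, inv_mul_cancel₀ hδ.ne', mul_one] at this
    calc 2 * B * T ≤ A * δ * T := by gcongr
      _ = δ := by rw [hT]; field_simp
  have hX' : LipschitzWith K (fun x => - X x) := hX.neg
  have ex1 : ∀ w, ∃ α : ℝ → E, w ∈ M → α 0 = w ∧ IsSol X T α := by
    intro w
    by_cases hw : w ∈ M
    · obtain ⟨α, h1⟩ := exists_sol hX B T (by positivity) hT0.le hTB w (hBb w hw)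
      exact ⟨α, fun _ => h1⟩
    · exact ⟨fun _ => 0, fun h => absurd h hw⟩
  have ex2 : ∀ w, ∃ α : ℝ → E, w ∈ M → α 0 = w ∧ IsSol (fun x => - X x) T α := by
    intro w
    by_cases hw : w ∈ M
    · obtain ⟨α, h1⟩ := exists_sol hX' B T (by positivity) hT0.le hTB w (by simpa using hBb w hw)
      exact ⟨α, fun _ => h1⟩
    · exact ⟨fun _ => 0, fun h => absurd h hw⟩
  choose α hα using ex1
  choose β hβ using ex2
  have gen : ∀ (Y : E → E) (hY : LipschitzWith K Y) (hYb : ∀ w ∈ M, ‖Y w‖ ≤ B) (hLY : ∀ w ∈ V, L w (Y w) = 0)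
      (γ : E → ℝ → E) (hγ : ∀ w, w ∈ M → γ w 0 = w ∧ IsSol Y T (γ w)) (t : ℝ) (ht : t ∈ Icc 0 T) (w : E) (hw : w ∈ M),
      γ w t ∈ M ∧ ‖γ w t - w‖ ≤ A * t ∧ ‖γ w t - w - t • Y w‖ ≤ A * t ^ 2 ∧
      ∀ z ∈ M, dist (γ w t) (γ z t) ≤ dist w z * Real.exp (K * t) := by
    intro Y hY hYb hLY γ hγ t ht w hw
    obtain ⟨h1, h2⟩ := hγ w hw
    have hw0 : ‖Y (γ w 0)‖ ≤ B := by rw [h1]; exact hYb w hw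
    have d1 := h2.dist_le hY hK B T (by positivity) hTB hw0
    have d2 := h2.tay hY hK B T (by positivity) hTB hw0 t ht
    rw [h1] at d1 d2
    have t0 := ht.1
    refine ⟨?_, (d1 t ht).trans (by gcongr), d2.trans (by gcongr), ?_⟩
    · refine h2.mem M U V ρ L hρ hM hV hLY (by rwa [h1]) ?_ t ht
      intro s hs
      refine hMV w hw _ ?_
      rw [dist_eq_norm]
      refine (d1 s hs).trans (le_trans ?_ hTδ)
      gcongr; exact hs.2
    · intro z hz
      have := h2.lip hY (hγ z hz).2 t ht
      rwa [h1, (hγ z hz).1] at this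
  have gα := gen X hX hBb hLX α hα
  have gβ := gen (fun x => - X x) hX' (fun w hw => by simpa using hBb w hw) (fun w hw => by simp [hLX w hw]) β hβ
  refine ⟨A, hA11, fun h w => if 0 ≤ h then α w h else β w (-h), ?_⟩
  intro h w hh hw
  rcases lt_trichotomy h 0 with h0 | h0 | h0
  · rw [abs_of_neg h0] at hh ⊢
    have ht : -h ∈ Icc 0 T := ⟨by linarith, hh⟩
    have h1 := not_le.2 h0
    simp only [if_neg h1, if_pos (show 0 ≤ -h by linarith)]
    obtain ⟨a1, a2, a3, a4⟩ := gβ (-h) ht w hw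
    refine ⟨a1, ?_, a2, ?_, a4⟩
    · have hh2 : IsSol (fun x => - (fun x => - X x) x) T (α (β w (-h))) := by
        simp only [neg_neg]; exact (hα _ a1).2
      have := (hβ w hw).2.inv hX' hh2 (-h) ht (hα _ a1).1
      rw [this, (hβ w hw).1]
    · simpa using a3
  · subst h0
    simp only [le_refl, if_true, neg_zero, abs_zero, mul_zero, Real.exp_zero, mul_one, zero_smul, sub_zero]
    have e := (hα w hw).1
    rw [e]
    refine ⟨hw, e, by simp, by simp, ?_⟩
    intro z hz
    rw [(hα z hz).1]
  · rw [abs_of_pos h0] at hh ⊢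
    have ht : h ∈ Icc 0 T := ⟨h0.le, hh⟩
    have h1 : ¬ 0 ≤ -h := by linarith
    simp only [if_pos h0.le, if_neg h1, neg_neg]
    obtain ⟨a1, a2, a3, a4⟩ := gα h ht w hw
    refine ⟨a1, ?_, a2, a3, a4⟩
    have := (hα w hw).2.inv hX (hβ _ a1).2 h ht (hβ _ a1).1
    rw [this, (hα w hw).1]

end FlowSec

end PartNoP

section PartNoQ
open MeasureTheory Complex

noncomputable section PairSec

variable {n : ℕ}

/-- The complex-linear pairing attached to a real functional. -/
def pairF (l : Cn n →L[ℝ] ℝ) (ξ : Cn n) : ℂ := (1/2) * ((l ξ : ℂ) - I * (l (I • ξ) : ℂ))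

theorem pairF_re (l : Cn n →L[ℝ] ℝ) (ξ : Cn n) : (pairF l ξ).re = (1/2) * l ξ := by
  simp [pairF]

theorem pairF_add (l : Cn n →L[ℝ] ℝ) (ξ η : Cn n) : pairF l (ξ + η) = pairF l ξ + pairF l η := by
  simp only [pairF, smul_add, map_add, ofReal_add]; ring

theorem pairF_sub (l : Cn n →L[ℝ] ℝ) (ξ η : Cn n) : pairF l (ξ - η) = pairF l ξ - pairF l η := by
  simp only [pairF, smul_sub, map_sub, ofReal_sub]; ring

theorem pairF_subl (l m : Cn n →L[ℝ] ℝ) (ξ : Cn n) : pairF (l - m) ξ = pairF l ξ - pairF m ξ := by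
  simp only [pairF, ContinuousLinearMap.sub_apply, ofReal_sub]; ring

theorem pairF_rsmul (l : Cn n →L[ℝ] ℝ) (h : ℝ) (ξ : Cn n) : pairF l (h • ξ) = h * pairF l ξ := by
  simp only [pairF, smul_comm I h ξ, map_smul, smul_eq_mul, ofReal_mul]; ring

theorem pairF_Ismul (l : Cn n →L[ℝ] ℝ) (ξ : Cn n) : pairF l (I • ξ) = I * pairF l ξ := by
  simp only [pairF, smul_smul, I_mul_I, neg_smul, one_smul, map_neg, ofReal_neg]
  linear_combination (1/2) * (l ξ : ℂ) * I_sq - I * (l ξ : ℂ) * 0 + (1/2) * (l (I • ξ) : ℂ) * I_sq - (1/2) * (l ξ : ℂ) * I_sq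

theorem pairF_smul (l : Cn n →L[ℝ] ℝ) (a : ℂ) (ξ : Cn n) : pairF l (a • ξ) = a * pairF l ξ := by
  have : a • ξ = a.re • ξ + a.im • (I • ξ) := by
    conv_lhs => rw [← re_add_im a]
    rw [add_smul, mul_smul, coe_smul, coe_smul]
  rw [this, pairF_add, pairF_rsmul, pairF_rsmul, pairF_Ismul]
  conv_rhs => rw [← re_add_im a]
  ring

theorem pairF_norm (l : Cn n →L[ℝ] ℝ) (ξ : Cn n) : ‖pairF l ξ‖ ≤ ‖l‖ * ‖ξ‖ := by
  have h1 : ‖(l ξ : ℂ)‖ ≤ ‖l‖ * ‖ξ‖ := by rw [norm_real]; exact l.le_opNorm ξ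
  have h2 : ‖(l (I • ξ) : ℂ)‖ ≤ ‖l‖ * ‖ξ‖ := by
    rw [norm_real]; refine (l.le_opNorm _).trans ?_
    rw [norm_smul, norm_I, one_mul]
  have h3 := norm_sub_le (l ξ : ℂ) (I * (l (I • ξ) : ℂ))
  rw [norm_mul, norm_I, one_mul] at h3
  rw [pairF, norm_mul]
  have : ‖(1/2 : ℂ)‖ = 1/2 := by simp
  rw [this]
  linarith

/-- The gradient of a functional. -/
def gradF : (Cn n →L[ℝ] ℝ) →ₗ[ℝ] Cn n where
  toFun l := ∑ j, ((l (EuclideanSpace.single j 1) : ℂ) + I * (l (EuclideanSpace.single j I) : ℂ)) • EuclideanSpace.single j (1:ℂ)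
  map_add' l m := by
    rw [← Finset.sum_add_distrib]
    refine Finset.sum_congr rfl fun j _ => ?_
    rw [← add_smul]; congr 1
    simp only [ContinuousLinearMap.add_apply, ofReal_add]; ring
  map_smul' h l := by
    rw [Finset.smul_sum]
    refine Finset.sum_congr rfl fun j _ => ?_
    rw [RingHom.id_apply, ← coe_smul, smul_smul]; congr 1
    simp only [ContinuousLinearMap.smul_apply, smul_eq_mul, ofReal_mul]; ring

theorem single_I (j : Fin n) : (EuclideanSpace.single j I : Cn n) = I • EuclideanSpace.single j (1:ℂ) := by
  ext k; simp [EuclideanSpace.single_apply]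

theorem sum_single (ξ : Cn n) : ∑ j, ξ j • EuclideanSpace.single j (1:ℂ) = ξ := by
  ext k
  simp [EuclideanSpace.single_apply, Pi.single_apply]

theorem pairF_sum (l : Cn n →L[ℝ] ℝ) (a : Fin n → ℂ) (v : Fin n → Cn n) :
    pairF l (∑ j, a j • v j) = ∑ j, a j * pairF l (v j) := by
  classical
  induction (Finset.univ : Finset (Fin n)) using Finset.induction_on with
  | empty => simp [pairF]
  | insert j s hj ih => rw [Finset.sum_insert hj, Finset.sum_insert hj, pairF_add, ih, pairF_smul]

theorem pairF_eq (l : Cn n →L[ℝ] ℝ) (ξ : Cn n) : pairF l ξ = ∑ j, (1/2) * ((l (EuclideanSpace.single j 1) : ℂ)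
    - I * (l (EuclideanSpace.single j I) : ℂ)) * ξ j := by
  conv_lhs => rw [← sum_single ξ]
  rw [pairF_sum]
  refine Finset.sum_congr rfl fun j _ => ?_
  rw [pairF, ← single_I]; ring

theorem gradF_apply (l : Cn n →L[ℝ] ℝ) (k : Fin n) : gradF l k = 
    (l (EuclideanSpace.single k 1) : ℂ) + I * (l (EuclideanSpace.single k I) : ℂ) := by
  simp [gradF, EuclideanSpace.single_apply, Pi.single_apply]

theorem pairF_grad (l : Cn n →L[ℝ] ℝ) : pairF l (gradF l) = (1/2) * (‖gradF l‖ ^ 2 : ℝ) := by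
  rw [pairF_eq, EuclideanSpace.norm_sq_eq, ofReal_sum, Finset.mul_sum]
  refine Finset.sum_congr rfl fun j _ => ?_
  rw [← normSq_eq_norm_sq, ← mul_conj, gradF_apply]
  simp only [map_add, map_mul, conj_ofReal, conj_I]
  ring

theorem gradF_ne (l : Cn n →L[ℝ] ℝ) (hl : l ≠ 0) : gradF l ≠ 0 := by
  intro h
  apply hl
  have h2 : ∀ j, (l (EuclideanSpace.single j 1) : ℂ) - I * (l (EuclideanSpace.single j I) : ℂ) = 0 := by
    intro j
    have := congrArg (starRingEnd ℂ) (gradF_apply l j)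
    rw [h] at this
    simp only [map_add, map_mul, conj_ofReal, conj_I] at this
    simp only [PiLp.zero_apply, map_zero] at this
    linear_combination -this
  ext ξ
  have h3 := pairF_eq l ξ
  simp only [h2, mul_zero, zero_mul, Finset.sum_const_zero] at h3
  have h4 := pairF_re l ξ
  rw [h3, zero_re] at h4
  simp only [ContinuousLinearMap.zero_apply]
  linarith

theorem delPair_eq (ρ : Cn n → ℝ) (w ξ : Cn n) (h : DifferentiableAt ℝ ρ w) :
    delPair ρ w ξ = pairF (fderiv ℝ ρ w) ξ := by
  rw [pairF_eq, delPair]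
  have : fderiv ℝ (realToC ρ) w = ofRealCLM.comp (fderiv ℝ ρ w) := by
    have := ofRealCLM.hasFDerivAt.comp w h.hasFDerivAt
    exact this.fderiv
  refine Finset.sum_congr rfl fun j _ => ?_
  rw [wderiv, this]
  rfl

theorem inv_lip {F : Type*} [NormedAddCommGroup F] [NormedSpace ℝ F] (m : ℝ) (hm : 0 < m) (u v : F) 
    (hu : m ≤ ‖u‖) (hv : m ≤ ‖v‖) : ‖(‖u‖ ^ 2)⁻¹ • u - (‖v‖ ^ 2)⁻¹ • v‖ ≤ 3 * (m ^ 2)⁻¹ * ‖u - v‖ := by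
  have u0 : 0 < ‖u‖ := by linarith
  have v0 : 0 < ‖v‖ := by linarith
  have e : (‖u‖ ^ 2)⁻¹ • u - (‖v‖ ^ 2)⁻¹ • v = (‖u‖ ^ 2)⁻¹ • (u - v) + ((‖u‖ ^ 2)⁻¹ - (‖v‖ ^ 2)⁻¹) • v := by
    rw [smul_sub, sub_smul]; abel
  have h1 : |‖v‖ - ‖u‖| ≤ ‖u - v‖ := by rw [norm_sub_rev]; exact abs_norm_sub_norm_le v u
  have h2 : |(‖u‖ ^ 2)⁻¹ - (‖v‖ ^ 2)⁻¹| * ‖v‖ = |‖v‖ - ‖u‖| * ((‖u‖ ^ 2)⁻¹ + ‖u‖⁻¹ * ‖v‖⁻¹) := by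
    have : (‖u‖ ^ 2)⁻¹ - (‖v‖ ^ 2)⁻¹ = (‖v‖ - ‖u‖) * ((‖v‖ + ‖u‖) * (‖u‖ ^ 2)⁻¹ * (‖v‖ ^ 2)⁻¹) := by
      field_simp; ring
    rw [this, abs_mul, abs_of_pos (show 0 < (‖v‖ + ‖u‖) * (‖u‖ ^ 2)⁻¹ * (‖v‖ ^ 2)⁻¹ by positivity)]
    field_simp
  have h3 : (‖u‖ ^ 2)⁻¹ ≤ (m ^ 2)⁻¹ := by gcongr
  have h4 : ‖u‖⁻¹ * ‖v‖⁻¹ ≤ (m ^ 2)⁻¹ := by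
    rw [← mul_inv]; apply inv_anti₀ (by positivity); rw [sq]; gcongr
  rw [e]
  refine (norm_add_le _ _).trans ?_
  rw [norm_smul, norm_smul, Real.norm_eq_abs, Real.norm_eq_abs, h2, abs_of_pos (by positivity)]
  have h5 : (‖u‖ ^ 2)⁻¹ * ‖u - v‖ ≤ (m ^ 2)⁻¹ * ‖u - v‖ := by gcongr
  have h6 : |‖v‖ - ‖u‖| * ((‖u‖ ^ 2)⁻¹ + ‖u‖⁻¹ * ‖v‖⁻¹) ≤ ‖u - v‖ * ((m ^ 2)⁻¹ + (m ^ 2)⁻¹) := by gcongr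
  linarith

/-- The transversal field. -/
theorem exists_field (V : Set (Cn n)) (hV : IsCompact V) (L : Cn n → Cn n →L[ℝ] ℝ) (K0 : NNReal)
    (hL : LipschitzOnWith K0 L V) (hL0 : ∀ w ∈ V, L w ≠ 0) :
    ∃ (k : NNReal) (X : Cn n → Cn n), 1 ≤ (k:ℝ) ∧ LipschitzWith k X ∧ ∀ w ∈ V, pairF (L w) (X w) = I := by
  set G : (Cn n →L[ℝ] ℝ) →L[ℝ] Cn n := LinearMap.toContinuousLinearMap gradF with hG
  have hGe : ∀ l, G l = gradF l := fun l => rfl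
  have hGc : ContinuousOn (fun w => ‖G (L w)‖⁻¹) V := by
    refine ContinuousOn.inv₀ (G.continuous.comp_continuousOn hL.continuousOn).norm ?_
    intro w hw
    rw [hGe]
    exact norm_ne_zero_iff.2 (gradF_ne _ (hL0 w hw))
  obtain ⟨b, hb⟩ := hV.exists_bound_of_continuousOn hGc
  have hlow : ∀ w ∈ V, (max b 1)⁻¹ ≤ ‖G (L w)‖ := by
    intro w hw
    have h1 := hb w hw
    rw [norm_inv, norm_norm] at h1
    have h2 : 0 < ‖G (L w)‖ := norm_pos_iff.2 (gradF_ne _ (hL0 w hw))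
    rw [inv_le_comm₀ (by positivity) h2]
    exact h1.trans (le_max_left _ _)
  set m := (max b 1)⁻¹ with hm
  have hm0 : 0 < m := by positivity
  have hlipY : LipschitzOnWith (Real.toNNReal (2 * (3 * (m ^ 2)⁻¹) * (‖G‖ * K0))) 
      (fun w => (2 * I) • ((‖G (L w)‖ ^ 2)⁻¹ • G (L w))) V := by
    refine LipschitzOnWith.of_dist_le_mul fun x hx y hy => ?_
    rw [Real.coe_toNNReal _ (by positivity), dist_eq_norm, ← smul_sub, norm_smul]
    have h1 := inv_lip m hm0 _ _ (hlow x hx) (hlow y hy)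
    have h2 : ‖G (L x) - G (L y)‖ ≤ ‖G‖ * (K0 * dist x y) := by
      rw [← map_sub]
      refine (G.le_opNorm _).trans ?_
      gcongr
      rw [← dist_eq_norm]; exact hL.dist_le_mul x hx y hy
    have h3 : ‖(2 * I : ℂ)‖ = 2 := by simp
    rw [h3]
    calc _ ≤ 2 * (3 * (m ^ 2)⁻¹ * (‖G‖ * (K0 * dist x y))) := by gcongr; exact h1.trans (by gcongr)
      _ = _ := by ring
  obtain ⟨X, hX, hXe⟩ := hlipY.extend_finite_dimension
  refine ⟨lipschitzExtensionConstant (Cn n) * (Real.toNNReal (2 * (3 * (m ^ 2)⁻¹) * (‖G‖ * K0))) + 1, X, ?_, ?_, ?_⟩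
  · rw [NNReal.coe_add, NNReal.coe_one]; exact le_add_of_nonneg_left (NNReal.coe_nonneg _)
  · exact hX.weaken (by simp)
  · intro w hw
    rw [← hXe hw, pairF_smul, pairF_rsmul, hGe, pairF_grad]
    have : ((‖gradF (L w)‖ ^ 2 : ℝ) : ℂ) ≠ 0 := by
      have := norm_ne_zero_iff.2 (gradF_ne _ (hL0 w hw))
      exact_mod_cast pow_ne_zero 2 this
    rw [ofReal_inv]
    field_simp

end PairSec

end PartNoQ

section PartNoR
open MeasureTheory Complex

section GeoAssembly

variable {q : ℕ}

theorem geo_exists (M U : Set (Cn (q+1))) (hUo : IsOpen U) (hMc : IsCompact M) (hMU : M ⊆ U)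
    (ρ : Cn (q+1) → ℝ) (L : Cn (q+1) → Cn (q+1) →L[ℝ] ℝ) (hρ : ∀ w ∈ U, HasFDerivAt ρ (L w) w)
    (K0 : NNReal) (hL : LipschitzOnWith K0 L U) (hM : ∀ w ∈ U, ρ w = 0 ↔ w ∈ M) (hL0 : ∀ w ∈ U, L w ≠ 0)
    (c : ℝ) (hc : 0 < c) (hconv : ∀ w ∈ M, ∀ z ∈ M, c * ‖w - z‖ ^ 2 ≤ ‖pairF (L w) (w - z)‖) :
    ∃ (K : ℝ) (τ : ℝ → M → M), IsFiniteMeasure (μH[((2*q+1:ℕ):ℝ)] : Measure M) ∧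
      Geo (μH[((2*q+1:ℕ):ℝ)] : Measure M) q K (fun w z => pairF (L w) ((w:Cn (q+1)) - z)) τ := by
  classical
  have hfin : Module.finrank ℝ (Cn (q+1)) = (2*q+1) + 1 := by
    rw [finrank_real_of_complex, finrank_euclideanSpace_fin]; ring
  obtain ⟨δ, hδ, hVU⟩ := hMc.exists_cthickening_subset_open hUo hMU
  set V := Metric.cthickening δ M with hVdef
  have hVc : IsCompact V := hMc.cthickening
  have hMV : ∀ w ∈ M, ∀ x, dist x w ≤ δ → x ∈ V := fun w hw x hx =>
    Metric.mem_cthickening_of_dist_le x w δ M hw hx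
  have hMV' : ∀ w ∈ M, w ∈ V := fun w hw => hMV w hw w (by simp [hδ.le])
  obtain ⟨R, hR1, hRf, hR⟩ := regul (2*q+1) hfin M U hUo hMc hMU ρ L hρ hL.continuousOn hM (fun w hw => hL0 w (hMU hw))
  obtain ⟨k, X, hk, hX, hXI⟩ := exists_field V hVc L K0 (hL.mono hVU) (fun w hw => hL0 w (hVU hw))
  have hLX : ∀ w ∈ V, L w (X w) = 0 := by
    intro w hw
    have := pairF_re (L w) (X w)
    rw [hXI w hw, I_re] at this
    linarith
  obtain ⟨A, hA, τ, hτ⟩ := exists_flow hX hk M U V ρ L hMc hρ hM hVU hLX δ hδ hMV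
  obtain ⟨B0, hB0⟩ := hVc.exists_bound_of_continuousOn (hL.continuousOn.mono hVU)
  obtain ⟨B1, hB1⟩ := hVc.exists_bound_of_continuousOn (hX.continuous.continuousOn (s := V))
  set B := max B0 (max B1 0) with hB
  have hBL : ∀ w ∈ M, ‖L w‖ ≤ B := fun w hw => (hB0 w (hMV' w hw)).trans (le_max_left _ _)
  have hBX : ∀ w ∈ M, ‖X w‖ ≤ B := fun w hw => (hB1 w (hMV' w hw)).trans ((le_max_left _ _).trans (le_max_right _ _))
  have hBn : 0 ≤ B := (le_max_right _ _).trans (le_max_right _ _)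
  have hdiff : ∀ w ∈ M, ∀ z ∈ M, ‖L w - L z‖ ≤ K0 * dist w z := fun w hw z hz => by
    rw [← dist_eq_norm]; exact hL.dist_le_mul w (hMU hw) z (hMU hz)
  set K := R + A + K0 + c⁻¹ + B + B * δ⁻¹ + (B * A + K0 * A ^ 2) + 2 * (k * (2*q+1)) with hK
  have p1 : 0 ≤ B * δ⁻¹ := by positivity
  have p2 : 0 ≤ B * A := by positivity
  have p3 : 0 ≤ K0 * A ^ 2 := by positivity
  have p4 : 0 ≤ k * (2*(q:ℝ)+1) := by positivity
  have p5 : 0 < c⁻¹ := by positivity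
  have p6 : (0:ℝ) ≤ K0 := K0.coe_nonneg
  have hKA : A ≤ K := by linarith
  have hKR : R ≤ K := by linarith
  have hK0 : 0 < K := by linarith
  have hinv : ∀ h : ℝ, |h| ≤ K⁻¹ → |h| ≤ A⁻¹ := fun h hh => hh.trans (by gcongr)
  let τ' : ℝ → M → M := fun h w => if hh : |h| ≤ A⁻¹ then ⟨τ h w, (hτ h w hh w.2).1⟩ else w
  have hτ' : ∀ h : ℝ, |h| ≤ K⁻¹ → ∀ w : M, ((τ' h w : M) : Cn (q+1)) = τ h w := by
    intro h hh w
    simp only [τ', dif_pos (hinv h hh)]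
  have hlip : ∀ h : ℝ, |h| ≤ K⁻¹ → LipschitzWith (Real.toNNReal (Real.exp (k * |h|))) (τ' h) := by
    intro h hh
    refine LipschitzWith.of_dist_le_mul fun x y => ?_
    rw [Real.coe_toNNReal _ (Real.exp_pos _).le, Subtype.dist_eq, hτ' h hh, hτ' h hh, mul_comm]
    exact (hτ h x (hinv h hh) x.2).2.2.2.2 y y.2
  have hti : ∀ h w, |h| ≤ K⁻¹ → τ' (-h) (τ' h w) = w := by
    intro h w hh
    apply Subtype.ext
    rw [hτ' _ (by rwa [abs_neg]), hτ' _ hh]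
    exact (hτ h w (hinv h hh) w.2).2.1
  have hball : ∀ (z : M) (r : ℝ), (μH[((2*q+1:ℕ):ℝ)] : Measure M) (Metric.closedBall z r) = 
      μH[((2*q+1:ℕ):ℝ)] (M ∩ Metric.closedBall (z : Cn (q+1)) r) := by
    intro z r
    rw [← (isometry_subtype_coe (s := M)).hausdorffMeasure_image (Or.inl (by positivity))]
    congr 1
    ext x
    simp only [Set.mem_image, Metric.mem_closedBall, Subtype.exists, Set.mem_inter_iff, Subtype.dist_eq]
    constructor
    · rintro ⟨a, ha, h1, rfl⟩; exact ⟨ha, h1⟩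
    · rintro ⟨h1, h2⟩; exact ⟨x, h1, h2, rfl⟩
  refine ⟨K, τ', ⟨?_⟩, ?_⟩
  · rw [← (isometry_subtype_coe (s := M)).hausdorffMeasure_image (Or.inl (by positivity)), Set.image_univ, Subtype.range_coe]
    exact hRf
  refine { one_le := by linarith, gm := ?_, diag := ?_, coc := ?_, low := ?_, re := ?_, up := ?_, low1 := ?_, tm := ?_, ti := hti, td := ?_, tg := ?_, tμ := ?_, ub := ?_, lb := ?_ }
  · apply Continuous.measurable
    have hLc : Continuous (fun w : M => L w) := 
      continuousOn_iff_continuous_restrict.1 (hL.continuousOn.mono hMU)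
    have h1 : Continuous (fun x : M × M => L x.1) := hLc.comp continuous_fst
    have h2 : Continuous (fun x : M × M => (x.1 : Cn (q+1)) - x.2) := 
      (continuous_subtype_val.comp continuous_fst).sub (continuous_subtype_val.comp continuous_snd)
    have h3 := h1.clm_apply h2
    have h4 := h1.clm_apply (h2.const_smul I)
    exact continuous_const.mul ((continuous_ofReal.comp h3).sub (continuous_const.mul (continuous_ofReal.comp h4)))
  · intro z; simp [pairF]
  · intro w t z
    have e : pairF (L w) ((w:Cn (q+1)) - z) - pairF (L w) ((w:Cn (q+1)) - t) - pairF (L t) ((t:Cn (q+1)) - z)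
        = pairF (L w - L t) ((t:Cn (q+1)) - z) := by
      rw [pairF_subl, ← pairF_sub]; congr 2; abel
    rw [e]
    refine (pairF_norm _ _).trans ?_
    rw [Subtype.dist_eq, Subtype.dist_eq, dist_eq_norm (t:Cn (q+1))]
    gcongr
    refine (hdiff w w.2 t t.2).trans ?_
    gcongr; linarith
  · intro w z
    have h1 := hconv w w.2 z z.2
    rw [Subtype.dist_eq, dist_eq_norm]
    calc _ = c⁻¹ * (c * ‖(w:Cn (q+1)) - z‖ ^ 2) := by field_simp
      _ ≤ c⁻¹ * ‖pairF (L w) ((w:Cn (q+1)) - z)‖ := by gcongr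
      _ ≤ _ := by gcongr; linarith
  · intro w z
    rw [pairF_re, abs_mul, Subtype.dist_eq]
    have hh : |(1/2:ℝ)| = 1/2 := by norm_num
    rw [hh]
    by_cases hd : dist (w:Cn (q+1)) z ≤ δ
    · have hsub : Metric.closedBall (w:Cn (q+1)) (dist (w:Cn (q+1)) z) ⊆ U := fun x hx =>
        hVU (hMV w w.2 x ((Metric.mem_closedBall.1 hx).trans hd))
      have key := (convex_closedBall (w:Cn (q+1)) (dist (w:Cn (q+1)) z)).norm_image_sub_le_of_norm_hasFDerivWithin_le'
        (f := ρ) (f' := L) (φ := L w) (C := K0 * dist (w:Cn (q+1)) z) 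
        (fun x hx => (hρ x (hsub hx)).hasFDerivWithinAt) (fun x hx => by
          rw [← dist_eq_norm]
          refine (hL.dist_le_mul x (hsub hx) w (hMU w.2)).trans ?_
          gcongr; exact hx) (x := w) (y := z) (Metric.mem_closedBall_self dist_nonneg) (by rw [Metric.mem_closedBall, dist_comm])
      rw [(hM _ (hMU w.2)).2 w.2, (hM _ (hMU z.2)).2 z.2, sub_zero, zero_sub, norm_neg, Real.norm_eq_abs, 
        ← dist_eq_norm, dist_comm (z:Cn (q+1))] at key
      have e : |L w ((w:Cn (q+1)) - z)| = |L w ((z:Cn (q+1)) - w)| := by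
        rw [← neg_sub, map_neg, abs_neg]
      rw [e]
      have : (K0:ℝ) * (dist (w:Cn (q+1)) z) ^ 2 ≤ K * (dist (w:Cn (q+1)) z) ^ 2 := by gcongr; linarith
      have := abs_nonneg (L w ((z:Cn (q+1)) - w))
      nlinarith
    · push Not at hd
      have h1 : |L w ((w:Cn (q+1)) - z)| ≤ B * dist (w:Cn (q+1)) z := by
        rw [← Real.norm_eq_abs]
        refine ((L w).le_opNorm _).trans ?_
        rw [← dist_eq_norm]; gcongr; exact hBL w w.2
      have h2 : B * dist (w:Cn (q+1)) z ≤ B * δ⁻¹ * dist (w:Cn (q+1)) z ^ 2 := by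
        calc _ = B * δ⁻¹ * (δ * dist (w:Cn (q+1)) z) := by field_simp
          _ ≤ _ := by rw [sq]; gcongr
      have h3 : B * δ⁻¹ * dist (w:Cn (q+1)) z ^ 2 ≤ K * dist (w:Cn (q+1)) z ^ 2 := by gcongr; linarith
      have := abs_nonneg (L w ((w:Cn (q+1)) - z))
      linarith
  · intro w z
    refine (pairF_norm _ _).trans ?_
    rw [Subtype.dist_eq, dist_eq_norm]
    gcongr
    refine (hBL w w.2).trans ?_
    linarith
  · intro hq w z
    rw [Subtype.dist_eq, dist_eq_norm]
    have hf1 : Module.finrank ℂ (Cn (q+1)) = 1 := by rw [finrank_euclideanSpace_fin, hq]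
    have hX0 : X w ≠ 0 := by
      intro h
      have := hXI w (hMV' w w.2)
      rw [h] at this
      simp [pairF] at this
      exact I_ne_zero this.symm
    obtain ⟨a, ha⟩ := exists_smul_eq_of_finrank_eq_one hf1 hX0 ((w:Cn (q+1)) - z)
    rw [← ha, pairF_smul, hXI w (hMV' w w.2), norm_smul, norm_mul, norm_I, mul_one, mul_comm]
    gcongr
    refine (hBX w w.2).trans ?_
    linarith
  · intro h hh
    exact (hlip h hh).continuous.measurable
  · intro h w hh
    rw [Subtype.dist_eq, hτ' h hh, dist_eq_norm]
    refine (hτ h w (hinv h hh) w.2).2.2.1.trans ?_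
    gcongr
  · intro h w hh
    simp only [hτ' h hh]
    obtain ⟨a1, a2, a3, a4, -⟩ := hτ h w (hinv h hh) w.2
    set v := τ h w with hv
    have e : pairF (L v) (v - w) - h * I = pairF (L w) (v - w - h • X w) + pairF (L v - L w) (v - w) := by
      rw [pairF_subl, pairF_sub (L w) (v - w), pairF_rsmul, hXI w (hMV' w w.2)]; ring
    rw [e]
    have h1 : ‖pairF (L w) (v - w - h • X w)‖ ≤ B * (A * h ^ 2) := by
      refine (pairF_norm _ _).trans ?_
      gcongr; exact hBL w w.2
    have h2 : ‖pairF (L v - L w) (v - w)‖ ≤ (K0 * (A * |h|)) * (A * |h|) := by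
      refine (pairF_norm _ _).trans ?_
      gcongr
      refine (hdiff v a1 w w.2).trans ?_
      rw [dist_eq_norm]; gcongr
    have h3 : (K0 * (A * |h|)) * (A * |h|) = K0 * A ^ 2 * h ^ 2 := by
      rw [← sq_abs h]; ring
    have h4 : (B * A + K0 * A ^ 2) * h ^ 2 ≤ K * h ^ 2 := by gcongr; linarith
    have := norm_add_le (pairF (L w) (v - w - h • X w)) (pairF (L v - L w) (v - w))
    linarith
  · intro h S hh hS
    have hh' : |-h| ≤ K⁻¹ := by rwa [abs_neg]
    have hsub : τ' h ⁻¹' S ⊆ τ' (-h) '' S := fun w hw => ⟨τ' h w, hw, hti h w hh⟩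
    refine (measure_mono hsub).trans ?_
    refine ((hlip (-h) hh').hausdorffMeasure_image_le (by positivity) S).trans ?_
    gcongr
    rw [abs_neg, ENNReal.rpow_natCast]
    change (ENNReal.ofReal (Real.exp (k * |h|))) ^ (2*q+1) ≤ _
    rw [← ENNReal.ofReal_pow (Real.exp_pos _).le, ← Real.exp_nat_mul]
    apply ENNReal.ofReal_le_ofReal
    have h1 : ((2*q+1:ℕ):ℝ) * (k * |h|) = k * (2*q+1) * |h| := by push_cast; ring
    rw [h1]
    have h2 : k * (2*q+1) * |h| ≤ 1 := by
      calc _ ≤ K * K⁻¹ := by gcongr; linarith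
        _ = 1 := mul_inv_cancel₀ hK0.ne'
    have h3 : 0 ≤ k * (2*(q:ℝ)+1) * |h| := by positivity
    have h4 := Real.abs_exp_sub_one_le (x := k * (2*q+1) * |h|) (by rwa [abs_of_nonneg h3])
    rw [abs_of_nonneg h3] at h4
    have h5 := le_abs_self (Real.exp (k * (2*q+1) * |h|) - 1)
    have h6 : 2 * (k * (2*(q:ℝ)+1)) * |h| ≤ K * |h| := by gcongr; linarith
    linarith
  · intro z r hr
    rw [hball]
    refine (hR z z.2 r hr).1.trans ?_
    gcongr
  · intro z r hr hr1
    rw [hball]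
    refine le_trans ?_ ((hR z z.2 r hr).2 hr1)
    gcongr

end GeoAssembly

end PartNoR


section Transfer

variable {E : Type*} [MetricSpace E] [MeasurableSpace E] [BorelSpace E]

theorem transfer (M : Set E) (hM : MeasurableSet M) (d : ℝ) (hd : 0 ≤ d) (q : ℕ) (g : E → E → ℂ)
    (p : ℝ)
    (H : ∃ A : ℝ, ∀ ε : ℝ, 0 < ε → ∀ f : M → ℂ, MemLp f (ENNReal.ofReal p) (μH[d] : Measure M) →
      eLpNorm (fun z : M => ∫ w in {w : M | ε < ‖g w z‖}, f w * (g w z ^ q)⁻¹ ∂(μH[d] : Measure M))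
        (ENNReal.ofReal p) (μH[d] : Measure M) ≤ ENNReal.ofReal A * eLpNorm f (ENNReal.ofReal p) (μH[d] : Measure M)) :
    ∃ A : ℝ, ∀ ε : ℝ, 0 < ε → ∀ f : E → ℂ, MemLp f (ENNReal.ofReal p) ((μH[d] : Measure E).restrict M) →
      eLpNorm (fun z : E => ∫ w in {w : E | ε < ‖g w z‖}, f w * (g w z ^ q)⁻¹ ∂((μH[d] : Measure E).restrict M))
        (ENNReal.ofReal p) ((μH[d] : Measure E).restrict M) ≤
      ENNReal.ofReal A * eLpNorm f (ENNReal.ofReal p) ((μH[d] : Measure E).restrict M) := by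
  obtain ⟨A, hA⟩ := H
  have hemb : MeasurableEmbedding ((↑) : M → E) := MeasurableEmbedding.subtype_coe hM
  have hmap : ((μH[d] : Measure M).map ((↑) : M → E)) = (μH[d] : Measure E).restrict M := by
    rw [(isometry_subtype_coe (s := M)).map_hausdorffMeasure (Or.inl hd), Subtype.range_coe]
  refine ⟨A, fun ε hε f hf => ?_⟩
  rw [← hmap] at hf ⊢
  have hf' : MemLp (fun w : M => f w) (ENNReal.ofReal p) (μH[d] : Measure M) := 
    (hemb.memLp_map_measure_iff).1 hf
  rw [hemb.eLpNorm_map_measure, hemb.eLpNorm_map_measure]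
  refine le_trans (le_of_eq ?_) (hA ε hε _ hf')
  congr 1
  funext z
  simp only [Function.comp]
  rw [hemb.setIntegral_map]
  rfl

end Transfer

/-- For a bounded domain `D ⊂ ℂⁿ` of class `C^{1,1}` that is strongly
ℂ-linearly convex, the truncated Cauchy–Leray integrals are bounded on `Lᵖ(bD, σ)`,
`1 < p < ∞`, uniformly in the truncation parameter `ε`. -/
theorem cauchyLeray_truncated_Lp_bounded_C11
    {n : ℕ} (hn : 1 ≤ n) (D U : Set (Cn n)) (ρ : Cn n → ℝ)
    (hDo : IsOpen D) (hDconn : IsConnected D) (hDb : Bornology.IsBounded D)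
    (hUo : IsOpen U) (hUb : frontier D ⊆ U)
    (hρ : ContDiffOn ℝ 1 ρ U)
    (hlip : ∃ K : NNReal, LipschitzOnWith K (fun w => fderiv ℝ ρ w) U)
    (hdef : U ∩ D = {w ∈ U | ρ w < 0})
    (hgrad : ∀ w ∈ U, fderiv ℝ ρ w ≠ 0)
    (c : ℝ) (hc : 0 < c)
    (hconv : ∀ w ∈ frontier D, ∀ z ∈ closure D,
      c * ‖w - z‖ ^ 2 ≤ ‖delPair ρ w (w - z)‖)
    (p : ℝ) (hp : 1 < p) :
    ∃ A : ℝ, ∀ ε : ℝ, 0 < ε → ∀ f : Cn n → ℂ,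
      MemLp f (ENNReal.ofReal p) (bSigma D) →
      eLpNorm
        (fun z : Cn n => ∫ w in {w : Cn n | ε < ‖delPair ρ w (w - z)‖},
          f w * (delPair ρ w (w - z) ^ n)⁻¹ ∂(bSigma D))
        (ENNReal.ofReal p) (bSigma D)
      ≤ ENNReal.ofReal A * eLpNorm f (ENNReal.ofReal p) (bSigma D) := by
  obtain ⟨q, rfl⟩ : ∃ q, n = q + 1 := ⟨n - 1, by omega⟩
  obtain ⟨K0, hL⟩ := hlip
  have hdiff : ∀ w ∈ U, HasFDerivAt ρ (fderiv ℝ ρ w) w := fun w hw =>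
    ((hρ.contDiffAt (hUo.mem_nhds hw)).differentiableAt (by simp)).hasFDerivAt
  have hMc : IsCompact (frontier D) := by
    refine Metric.isCompact_of_isClosed_isBounded isClosed_frontier ?_
    exact hDb.closure.subset frontier_subset_closure
  have hneg : ∀ w ∈ U, w ∈ D ↔ ρ w < 0 := by
    intro w hw
    constructor
    · intro h
      have : w ∈ U ∩ D := ⟨hw, h⟩
      rw [hdef] at this
      exact this.2
    · intro h
      have : w ∈ {w ∈ U | ρ w < 0} := ⟨hw, h⟩
      rw [← hdef] at this
      exact this.2
  have hM : ∀ w ∈ U, ρ w = 0 ↔ w ∈ frontier D := by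
    intro w hw
    rw [hDo.frontier_eq, Set.mem_diff]
    constructor
    · intro h0
      refine ⟨?_, fun h => absurd ((hneg w hw).1 h) (by rw [h0]; exact lt_irrefl _)⟩
      by_contra hcl
      have hev : ∀ᶠ x in nhds w, x ∈ U ∧ x ∉ D := by
        filter_upwards [hUo.mem_nhds hw, isClosed_closure.isOpen_compl.mem_nhds hcl] with x h1 h2
        exact ⟨h1, fun h => h2 (subset_closure h)⟩
      have hmin : IsLocalMin ρ w := by
        filter_upwards [hev] with x hx
        rw [h0]
        by_contra hlt
        push Not at hlt
        exact hx.2 ((hneg x hx.1).2 hlt)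
      exact hgrad w hw hmin.fderiv_eq_zero
    · rintro ⟨h1, h2⟩
      have h3 : 0 ≤ ρ w := by
        by_contra hlt
        push Not at hlt
        exact h2 ((hneg w hw).2 hlt)
      refine le_antisymm ?_ h3
      by_contra hlt
      push Not at hlt
      have hc0 : ContinuousAt ρ w := (hdiff w hw).continuousAt
      obtain ⟨x, ⟨hx1, hx2⟩, hx3⟩ := mem_closure_iff_nhds.1 h1 _
        (Filter.inter_mem (hUo.mem_nhds hw) (hc0.eventually (lt_mem_nhds hlt)))
      have h4 := (hneg x hx1).1 hx3
      have h5 : 0 < ρ x := hx2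
      linarith
  have hconv' : ∀ w ∈ frontier D, ∀ z ∈ frontier D, c * ‖w - z‖ ^ 2 ≤ ‖pairF (fderiv ℝ ρ w) (w - z)‖ := by
    intro w hw z hz
    rw [← delPair_eq ρ w _ (hdiff w (hUb hw)).differentiableAt]
    exact hconv w hw z (frontier_subset_closure hz)
  obtain ⟨K, τ, hfin, hG⟩ := geo_exists (frontier D) U hUo hMc hUb ρ (fun w => fderiv ℝ ρ w) hdiff K0 hL hM hgrad c hc hconv'
  have main := hG.main p hp
  have hd : (2*((q+1:ℕ):ℝ) - 1) = ((2*q+1:ℕ):ℝ) := by push_cast; ring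
  unfold bSigma
  rw [hd]
  refine transfer (frontier D) isClosed_frontier.measurableSet _ (by positivity) (q+1) (fun w z => delPair ρ w (w - z)) p ?_
  obtain ⟨A, hA⟩ := main
  refine ⟨A, fun ε hε f hf => ?_⟩
  have e : ∀ w z : frontier D, delPair ρ (w:Cn (q+1)) ((w:Cn (q+1)) - z) = pairF (fderiv ℝ ρ w) ((w:Cn (q+1)) - z) :=
    fun w z => delPair_eq ρ w _ (hdiff w (hUb w.2)).differentiableAt
  simp only [e]
  exact hA ε hε f hf

end
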